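/- arXiv:0707.0313 — 4 statements merged into one kernel-verified Lean document; each statement's English description precedes it below -/
import Mathlib

section
/- Let f, g : [0,T]² → ℝ be continuous, f of finite 2D q-variation controlled by ω_f, g of finite 2D p-variation controlled by ω_g, with 1/p + 1/q > 1, and suppose f(s,·) = f(·,u) = 0 (vanishing on the lower edges of the rectangle). Then the 2D Young integral ∫_{[s,t]×[u,v]} f dg exists and |∫_{[s,t]×[u,v]} f dg| ≤ C_{p,q} |f|_{q-var;[s,t]×[u,v]} · |g|_{p-var;[s,t]×[u,v]} for a constant C_{p,q} depending only on p and q. -/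
/-- A dissection (subdivision) of the interval `[s,t]`:
a monotone tuple starting at `s` and ending at `t`. -/
def IsDissection (s t : ℝ) {n : ℕ} (P : Fin (n + 1) → ℝ) : Prop :=
  Monotone P ∧ P 0 = s ∧ P (Fin.last n) = t

/-- The rectangular increment `f((s,t),(u,v)) = f(s,u)+f(t,v)-f(s,v)-f(t,u)`. -/
def rectInc {B : Type*} [NormedAddCommGroup B] (f : ℝ → ℝ → B) (s t u v : ℝ) : B :=
  f s u + f t v - f s v - f t u

/-- The set of approximating sums for the 2D `ρ`-variation of `f` over `[s,t] × [u,v]`: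
sums over pairs of dissections of the `ρ`-th powers of rectangular increments. -/
def varSums2D {B : Type*} [NormedAddCommGroup B] (f : ℝ → ℝ → B)
    (ρ s t u v : ℝ) : Set ℝ :=
  { x | ∃ (n m : ℕ) (P : Fin (n + 1) → ℝ) (Q : Fin (m + 1) → ℝ),
      IsDissection s t P ∧ IsDissection u v Q ∧
      x = ∑ i : Fin n, ∑ j : Fin m,
        ‖rectInc f (P i.castSucc) (P i.succ) (Q j.castSucc) (Q j.succ)‖ ^ ρ }

/-- The set of approximating sums for the (1D) `ρ`-variation of a path over `[s,t]`. -/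
def varSums1D {B : Type*} [NormedAddCommGroup B] (x : ℝ → B) (ρ s t : ℝ) : Set ℝ :=
  { y | ∃ (n : ℕ) (P : Fin (n + 1) → ℝ), IsDissection s t P ∧
      y = ∑ i : Fin n, ‖x (P i.succ) - x (P i.castSucc)‖ ^ ρ }

section Helpers

open Finset

/-- ℕ-indexed dissection, constant after index `n`. -/
def NDiss {α : Type*} [Preorder α] (s t : α) (n : ℕ) (P : ℕ → α) : Prop :=
  Monotone P ∧ P 0 = s ∧ ∀ k, n ≤ k → P k = t

def rinc {α : Type*} (f : α → α → ℝ) (a b c d : α) : ℝ := f a c + f b d - f a d - f b c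

def VB {α : Type*} [Preorder α] (f : α → α → ℝ) (q : ℝ) (s t u v : α) (A : ℝ) : Prop :=
  ∀ (n m : ℕ) (P Q : ℕ → α), NDiss s t n P → NDiss u v m Q →
    ∑ i ∈ range n, ∑ j ∈ range m, |rinc f (P i) (P (i+1)) (Q j) (Q (j+1))| ^ q ≤ A

def sk (j k : ℕ) : ℕ := if k ≤ j then k else k + 1

lemma sk_mono (j : ℕ) : Monotone (sk j) := by
  intro a b h
  unfold sk
  split_ifs <;> omega

lemma NDiss.skip {α : Type*} [Preorder α] {s t : α} {M : ℕ} {P : ℕ → α}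
    (h : NDiss s t (M+2) P) {j : ℕ} (hj : j ≤ M) : NDiss s t (M+1) (fun k => P (sk j k)) := by
  refine ⟨h.1.comp (sk_mono j), by simpa [sk] using h.2.1, fun k hk => h.2.2 _ ?_⟩
  unfold sk
  split_ifs <;> omega

lemma sum_skip (u w : ℕ → ℝ) (j d : ℕ) :
    ∑ k ∈ range (j + d + 2), u k * (w (k+1) - w k) =
      ∑ k ∈ range (j + d + 1), u (sk j k) * (w (sk j (k+1)) - w (sk j k)) +
        (u (j+1) - u j) * (w (j+2) - w (j+1)) := by
  induction d with
  | zero =>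
    rw [sum_range_succ, sum_range_succ, add_zero, sum_range_succ]
    have : ∑ k ∈ range j, u (sk j k) * (w (sk j (k+1)) - w (sk j k)) =
        ∑ k ∈ range j, u k * (w (k+1) - w k) := by
      refine sum_congr rfl fun k hk => ?_
      have hk := mem_range.1 hk
      simp [sk, hk.le, Nat.succ_le_of_lt hk]
    rw [this]
    simp [sk]
    ring
  | succ d ih =>
    rw [show j + (d+1) + 2 = (j + d + 2) + 1 by ring, sum_range_succ, ih,
      show j + (d+1) + 1 = (j + d + 1) + 1 by ring, sum_range_succ _ (j+d+1)]
    have h1 : sk j (j+d+1) = j+d+2 := by unfold sk; split_ifs <;> omega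
    have h2 : sk j (j+d+1+1) = j+d+2+1 := by unfold sk; split_ifs <;> omega
    rw [h1, h2]
    ring

lemma sum_skip' (u w : ℕ → ℝ) {j M : ℕ} (hj : j ≤ M) :
    ∑ k ∈ range (M + 2), u k * (w (k+1) - w k) =
      ∑ k ∈ range (M + 1), u (sk j k) * (w (sk j (k+1)) - w (sk j k)) +
        (u (j+1) - u j) * (w (j+2) - w (j+1)) := by
  obtain ⟨d, rfl⟩ := Nat.exists_eq_add_of_le hj
  exact sum_skip u w j d

lemma sum_rpow_le_rpow_sum' (N : ℕ) (x : ℕ → ℝ) (c : ℝ) (hc : 1 ≤ c) (hx : ∀ i, 0 ≤ x i) :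
    ∑ i ∈ range N, x i ^ c ≤ (∑ i ∈ range N, x i) ^ c := by
  induction N with
  | zero => simp; positivity
  | succ n ih =>
    rw [sum_range_succ, sum_range_succ]
    exact (add_le_add_left ih _).trans
      (Real.add_rpow_le_rpow_add (sum_nonneg fun i _ => hx i) (hx n) hc)

lemma pick (p q r : ℝ) (hp : 1 ≤ p) (hq : 1 ≤ q) (hpq : 1 < p⁻¹ + q⁻¹) (hr : 0 < r)
    (hr' : 1 < r * (p⁻¹ + q⁻¹)) (N M : ℕ) (a b : ℕ → ℕ → ℝ) (A B : ℝ)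
    (hA : ∑ i ∈ range N, ∑ j ∈ range (M+1), |a i j| ^ q ≤ A)
    (hB : ∑ i ∈ range N, ∑ j ∈ range (M+1), |b i j| ^ p ≤ B) :
    ∃ j ≤ M, ∑ i ∈ range N, |a i j * b i j| ^ r ≤
      (1 / ((M:ℝ)+1) ^ (r * (p⁻¹ + q⁻¹))) * (A ^ q⁻¹ * B ^ p⁻¹) ^ r := by
  set θ := p⁻¹ + q⁻¹ with hθ
  have hθ0 : 0 < θ := by linarith
  have hp0 : 0 < p := by linarith
  have hq0 : 0 < q := by linarith
  have hA0 : 0 ≤ A := le_trans (by positivity) hA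
  have hB0 : 0 ≤ B := le_trans (by positivity) hB
  have hconj : (q * θ).HolderConjugate (p * θ) := by
    rw [Real.holderConjugate_iff]
    constructor
    · rw [hθ, mul_add, mul_inv_cancel₀ hq0.ne']
      have : 0 < q * p⁻¹ := by positivity
      linarith
    · rw [mul_inv, mul_inv, ← add_mul, add_comm, ← hθ, mul_inv_cancel₀ hθ0.ne']
  have hold := Real.inner_le_Lp_mul_Lq (range N ×ˢ range (M+1))
    (fun z => |a z.1 z.2| ^ θ⁻¹) (fun z => |b z.1 z.2| ^ θ⁻¹) hconj
  have e1 : ∀ x : ℝ, ∀ q : ℝ, |(|x| ^ θ⁻¹)| ^ (q * θ) = |x| ^ q := by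
    intro x q
    rw [abs_of_nonneg (by positivity), ← Real.rpow_mul (abs_nonneg _)]
    congr 1
    field_simp
  simp only [e1] at hold
  rw [sum_product, sum_product, sum_product] at hold
  simp only at hold
  have h2 : ∑ i ∈ range N, ∑ j ∈ range (M+1), |a i j * b i j| ^ θ⁻¹ ≤
      (A ^ q⁻¹ * B ^ p⁻¹) ^ θ⁻¹ := by
    calc _ = ∑ i ∈ range N, ∑ j ∈ range (M+1), |a i j| ^ θ⁻¹ * |b i j| ^ θ⁻¹ := by
          simp_rw [abs_mul, Real.mul_rpow (abs_nonneg _) (abs_nonneg _)]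
      _ ≤ _ := hold
      _ ≤ A ^ (1 / (q * θ)) * B ^ (1 / (p * θ)) := by
          gcongr
      _ = _ := by
          rw [Real.mul_rpow (by positivity) (by positivity), ← Real.rpow_mul hA0,
            ← Real.rpow_mul hB0]
          congr 2 <;> rw [one_div, mul_inv]
  rw [sum_comm] at h2
  have hM : (0:ℝ) < (M:ℝ) + 1 := by positivity
  obtain ⟨j, hj, h3⟩ : ∃ j ∈ range (M+1), ∑ i ∈ range N, |a i j * b i j| ^ θ⁻¹ ≤
      (A ^ q⁻¹ * B ^ p⁻¹) ^ θ⁻¹ / ((M:ℝ)+1) := by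
    apply exists_le_of_sum_le (by simp)
    rw [sum_const, card_range, nsmul_eq_mul]
    push_cast
    rwa [mul_div_cancel₀ _ hM.ne']
  refine ⟨j, by simpa [Nat.lt_succ_iff] using hj, ?_⟩
  have h4 : ∑ i ∈ range N, |a i j * b i j| ^ r ≤
      (∑ i ∈ range N, |a i j * b i j| ^ θ⁻¹) ^ (r * θ) := by
    have := sum_rpow_le_rpow_sum' N (fun i => |a i j * b i j| ^ θ⁻¹) _ hr'.le
      (fun i => by positivity)
    refine le_trans (le_of_eq (sum_congr rfl fun i _ => ?_)) this
    rw [← Real.rpow_mul (abs_nonneg _)]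
    congr 1
    field_simp
  refine h4.trans ((Real.rpow_le_rpow (by positivity) h3 (by positivity)).trans_eq ?_)
  rw [Real.div_rpow (by positivity) hM.le, ← Real.rpow_mul (by positivity)]
  rw [show θ⁻¹ * (r * θ) = r by field_simp]
  ring

lemma sum_sub_le (N M : ℕ) (F : ℕ → ℕ → ℝ) (hF : ∀ i j, 0 ≤ F i j) :
    ∑ i ∈ range N, ∑ j ∈ range M, F i j ≤ ∑ i ∈ range (N+1), ∑ j ∈ range (M+1), F i j := by
  rw [sum_range_succ _ N]
  have h : ∀ i, ∑ j ∈ range M, F i j ≤ ∑ j ∈ range (M+1), F i j := fun i => by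
    rw [sum_range_succ]; linarith [hF i M]
  have := sum_le_sum (s := range N) fun i _ => h i
  have h2 : 0 ≤ ∑ j ∈ range (M+1), F N j := sum_nonneg fun j _ => hF _ _
  linarith

lemma sum_sub_le' (N M : ℕ) (F : ℕ → ℕ → ℝ) (hF : ∀ i j, 0 ≤ F i j) :
    ∑ i ∈ range N, ∑ j ∈ range M, F (i+1) (j+1) ≤
      ∑ i ∈ range (N+1), ∑ j ∈ range (M+1), F i j := by
  rw [sum_range_succ' _ N]
  have h : ∀ i, ∑ j ∈ range M, F i (j+1) ≤ ∑ j ∈ range (M+1), F i j := fun i => by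
    rw [sum_range_succ']; linarith [hF i 0]
  have := sum_le_sum (s := range N) fun i _ => h (i+1)
  have h2 : 0 ≤ ∑ j ∈ range (M+1), F 0 j := sum_nonneg fun j _ => hF _ _
  linarith

/-- The `y`-direction Young sums in the strip attached to the removal of `P (i+1)`. -/
def strip {α : Type*} (f g : α → α → ℝ) (P Q : ℕ → α) (m i : ℕ) : ℝ :=
  ∑ j ∈ range m, (f (P (i+1)) (Q j) - f (P i) (Q j)) *
    ((g (P (i+2)) (Q (j+1)) - g (P (i+1)) (Q (j+1))) - (g (P (i+2)) (Q j) - g (P (i+1)) (Q j)))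

lemma abs_add_rpow_le {x y r : ℝ} (hr : 0 < r) (hr1 : r ≤ 1) :
    |x + y| ^ r ≤ |x| ^ r + |y| ^ r :=
  (Real.rpow_le_rpow (abs_nonneg _) (abs_add_le x y) hr.le).trans
    (Real.rpow_add_le_add_rpow (abs_nonneg _) (abs_nonneg _) hr.le hr1)

lemma strip_bound {α : Type*} [Preorder α] (p q r : ℝ) (hp : 1 ≤ p) (hq : 1 ≤ q)
    (hpq : 1 < p⁻¹ + q⁻¹) (hr : 0 < r) (hr1 : r < 1)
    (hr' : 1 < r * (p⁻¹ + q⁻¹)) (f g : α → α → ℝ) (s t u v : α) (A B : ℝ)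
    (hf : VB f q s t u v A) (hg : VB g p s t u v B) (hu : ∀ x, f x u = 0)
    (N : ℕ) (P : ℕ → α) (hP : NDiss s t (N+1) P) (M : ℕ) :
    ∀ (Q : ℕ → α), NDiss u v (M+1) Q →
    ∑ i ∈ range N, |strip f g P Q (M+1) i| ^ r ≤
      (∑ k ∈ range M, 1 / ((k:ℝ)+1) ^ (r * (p⁻¹ + q⁻¹))) * (A ^ q⁻¹ * B ^ p⁻¹) ^ r := by
  induction M with
  | zero =>
    intro Q hQ
    simp [strip, hQ.2.1, hu, Real.zero_rpow hr.ne']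
  | succ M ih =>
    intro Q hQ
    obtain ⟨j, hj, h⟩ := pick p q r hp hq hpq hr hr' N M
      (fun i j => rinc f (P i) (P (i+1)) (Q j) (Q (j+1)))
      (fun i j => rinc g (P (i+1)) (P (i+2)) (Q (j+1)) (Q (j+2))) A B
      ((sum_sub_le N (M+1) (fun i j => |rinc f (P i) (P (i+1)) (Q j) (Q (j+1))| ^ q)
        (fun i j => by positivity)).trans (hf _ _ P Q hP hQ))
      ((sum_sub_le' N (M+1) (fun i j => |rinc g (P i) (P (i+1)) (Q j) (Q (j+1))| ^ p)
        (fun i j => by positivity)).trans (hg _ _ P Q hP hQ))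
    have key : ∀ i, strip f g P Q (M+1+1) i = strip f g P (fun k => Q (sk j k)) (M+1) i +
        rinc f (P i) (P (i+1)) (Q j) (Q (j+1)) *
          rinc g (P (i+1)) (P (i+2)) (Q (j+1)) (Q (j+2)) := by
      intro i
      unfold strip rinc
      rw [sum_skip' (fun j => f (P (i+1)) (Q j) - f (P i) (Q j))
        (fun j => g (P (i+2)) (Q j) - g (P (i+1)) (Q j)) hj]
      ring
    rw [sum_range_succ _ M, add_mul]
    calc _ ≤ ∑ i ∈ range N, (|strip f g P (fun k => Q (sk j k)) (M+1) i| ^ r +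
          |rinc f (P i) (P (i+1)) (Q j) (Q (j+1)) *
          rinc g (P (i+1)) (P (i+2)) (Q (j+1)) (Q (j+2))| ^ r) :=
          sum_le_sum fun i _ => by rw [key]; exact abs_add_rpow_le hr hr1.le
      _ ≤ _ := by
          rw [sum_add_distrib]
          exact add_le_add (ih _ (hQ.skip hj)) h

def ysum {α : Type*} (f g : α → α → ℝ) (P Q : ℕ → α) (n m : ℕ) : ℝ :=
  ∑ i ∈ range n, ∑ j ∈ range m, f (P i) (Q j) * rinc g (P i) (P (i+1)) (Q j) (Q (j+1))

lemma ysum_skip {α : Type*} (f g : α → α → ℝ) (P Q : ℕ → α) (N m : ℕ) {i : ℕ} (hi : i ≤ N) :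
    ysum f g P Q (N+2) m = ysum f g (fun k => P (sk i k)) Q (N+1) m + strip f g P Q m i := by
  unfold ysum strip
  rw [sum_comm, sum_comm (s := range (N+1)), ← sum_add_distrib]
  refine sum_congr rfl fun j _ => ?_
  have := sum_skip' (fun i => f (P i) (Q j)) (fun i => g (P i) (Q (j+1)) - g (P i) (Q j)) hi
  unfold rinc
  refine Eq.trans (sum_congr rfl fun k _ => ?_) (this.trans ?_)
  · ring
  · congr 1
    · exact sum_congr rfl fun k _ => by ring
    · ring

lemma ysum_bound {α : Type*} [Preorder α] (p q r K : ℝ) (hp : 1 ≤ p) (hq : 1 ≤ q)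
    (hpq : 1 < p⁻¹ + q⁻¹) (hr : 0 < r) (hr1 : r < 1)
    (hr' : 1 < r * (p⁻¹ + q⁻¹)) (hK0 : 0 ≤ K)
    (hK : ∀ M, ∑ k ∈ range M, 1 / ((k:ℝ)+1) ^ (r * (p⁻¹ + q⁻¹)) ≤ K)
    (f g : α → α → ℝ) (s t u v : α) (A B : ℝ) (hA : 0 ≤ A) (hB : 0 ≤ B)
    (hf : VB f q s t u v A) (hg : VB g p s t u v B) (hu : ∀ x, f x u = 0) (hs : ∀ y, f s y = 0)
    (m : ℕ) (Q : ℕ → α) (hQ : NDiss u v (m+1) Q) (N : ℕ) :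
    ∀ (P : ℕ → α), NDiss s t (N+1) P →
    |ysum f g P Q (N+1) (m+1)| ≤
      (∑ k ∈ range N, 1 / ((k:ℝ)+1) ^ r⁻¹) * (K ^ r⁻¹ * (A ^ q⁻¹ * B ^ p⁻¹)) := by
  induction N with
  | zero =>
    intro P hP
    simp [ysum, hP.2.1, hs]
  | succ N ih =>
    intro P hP
    have h := strip_bound p q r hp hq hpq hr hr1 hr' f g s t u v A B hf hg hu (N+1) P hP m Q hQ
    have hN : (0:ℝ) < (N:ℝ) + 1 := by positivity
    obtain ⟨i, hi, h3⟩ : ∃ i ∈ range (N+1), |strip f g P Q (m+1) i| ^ r ≤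
        K * (A ^ q⁻¹ * B ^ p⁻¹) ^ r / ((N:ℝ)+1) := by
      apply exists_le_of_sum_le (by simp)
      rw [sum_const, card_range, nsmul_eq_mul]
      push_cast
      rw [mul_div_cancel₀ _ hN.ne']
      exact h.trans (mul_le_mul_of_nonneg_right (hK _) (by positivity))
    have h4 : |strip f g P Q (m+1) i| ≤
        1 / ((N:ℝ)+1) ^ r⁻¹ * (K ^ r⁻¹ * (A ^ q⁻¹ * B ^ p⁻¹)) := by
      have := Real.rpow_le_rpow (by positivity) h3 (inv_nonneg.2 hr.le)
      rw [Real.rpow_rpow_inv (abs_nonneg _) hr.ne', Real.div_rpow (by positivity) hN.le,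
        Real.mul_rpow hK0 (by positivity), Real.rpow_rpow_inv (by positivity) hr.ne'] at this
      refine this.trans_eq ?_
      ring
    have hi' : i ≤ N := by simpa [Nat.lt_succ_iff] using hi
    rw [ysum_skip f g P Q N (m+1) hi', sum_range_succ, add_mul]
    exact (abs_add_le _ _).trans (add_le_add (ih _ (hP.skip hi')) h4)

/-- Discrete 2D Young (Towghi) inequality. -/
lemma young_discrete (p q : ℝ) (hp : 1 ≤ p) (hq : 1 ≤ q) (hpq : 1 < p⁻¹ + q⁻¹) :
    ∃ C : ℝ, 0 < C ∧ ∀ (α : Type) [Preorder α] (f g : α → α → ℝ) (s t u v : α) (A B : ℝ),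
      0 ≤ A → 0 ≤ B → VB f q s t u v A → VB g p s t u v B →
      (∀ x, f x u = 0) → (∀ y, f s y = 0) → ∀ (n m : ℕ) (P Q : ℕ → α),
      NDiss s t n P → NDiss u v m Q → |ysum f g P Q n m| ≤ C * A ^ q⁻¹ * B ^ p⁻¹ := by
  obtain ⟨r, hr, hr1, hr'⟩ : ∃ r : ℝ, 0 < r ∧ r < 1 ∧ 1 < r * (p⁻¹ + q⁻¹) := by
    obtain ⟨r, h1, h2⟩ := exists_between (inv_lt_one_of_one_lt₀ hpq)
    have h0 : 0 < p⁻¹ + q⁻¹ := by linarith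
    refine ⟨r, lt_trans (by positivity) h1, h2, ?_⟩
    rwa [inv_lt_iff_one_lt_mul₀ h0] at h1
  have hsum : ∀ c : ℝ, 1 < c → Summable fun k : ℕ => 1 / ((k:ℝ)+1) ^ c := by
    intro c hc
    have := (summable_nat_add_iff 1).2 (Real.summable_one_div_nat_rpow.2 hc)
    simpa using this
  have hpart : ∀ c : ℝ, 1 < c → ∀ M, ∑ k ∈ range M, 1 / ((k:ℝ)+1) ^ c ≤
      ∑' k : ℕ, 1 / ((k:ℝ)+1) ^ c := fun c hc M =>
    (hsum c hc).sum_le_tsum _ (fun k _ => by positivity)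
  set K := ∑' k : ℕ, 1 / ((k:ℝ)+1) ^ (r * (p⁻¹ + q⁻¹)) with hKdef
  set Z := ∑' k : ℕ, 1 / ((k:ℝ)+1) ^ r⁻¹ with hZdef
  have hK0 : 0 ≤ K := tsum_nonneg fun k => by positivity
  have hZ0 : 0 ≤ Z := tsum_nonneg fun k => by positivity
  refine ⟨Z * K ^ r⁻¹ + 1, by positivity, ?_⟩
  intro α _ f g s t u v A B hA hB hf hg hu hs n m P Q hP hQ
  rcases n with _ | n
  · simp [ysum]; positivity
  rcases m with _ | m
  · simp [ysum]; positivity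
  refine (ysum_bound p q r K hp hq hpq hr hr1 hr' hK0 (hpart _ hr') f g s t u v A B hA hB hf hg
    hu hs m Q hQ n P hP).trans ?_
  have := hpart r⁻¹ ((one_lt_inv₀ hr).2 hr1) n
  have hX : 0 ≤ A ^ q⁻¹ * B ^ p⁻¹ := by positivity
  calc _ ≤ Z * (K ^ r⁻¹ * (A ^ q⁻¹ * B ^ p⁻¹)) := by gcongr
    _ ≤ _ := by nlinarith

lemma NDiss.comp {α : Type*} [Preorder α] {s t : α} {N n : ℕ} {R : ℕ → α} {P : ℕ → ℕ}
    (hR : NDiss s t N R) (hP : NDiss 0 N n P) : NDiss s t n (fun k => R (P k)) :=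
  ⟨hR.1.comp hP.1, by simp [hP.2.1, hR.2.1], fun k hk => by
    simp only [hP.2.2 k hk]; exact hR.2.2 N le_rfl⟩

lemma NDiss.mem {s t : ℝ} {n : ℕ} {P : ℕ → ℝ} (h : NDiss s t n P) (k : ℕ) :
    P k ∈ Set.Icc s t := by
  constructor
  · rw [← h.2.1]; exact h.1 (Nat.zero_le _)
  · rw [← h.2.2 (max k n) (le_max_right _ _)]; exact h.1 (le_max_left _ _)

lemma merge {s t : ℝ} {n n' : ℕ} {P P' : ℕ → ℝ} (hP : NDiss s t n P) (hP' : NDiss s t n' P') :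
    ∃ (N : ℕ) (R : ℕ → ℝ) (σ σ' : ℕ → ℕ), NDiss s t N R ∧ NDiss 0 N n σ ∧ NDiss 0 N n' σ' ∧
      (∀ k, P k = R (σ k)) ∧ (∀ k, P' k = R (σ' k)) := by
  classical
  set U : Finset ℝ := (range (n+1)).image P ∪ (range (n'+1)).image P' with hU
  have m1 : ∀ k, P k ∈ U := by
    intro k
    refine mem_union_left _ (mem_image.2 ?_)
    rcases le_total k n with h | h
    · exact ⟨k, by simp; omega, rfl⟩
    · exact ⟨n, by simp, by rw [hP.2.2 k h, hP.2.2 n le_rfl]⟩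
  have m2 : ∀ k, P' k ∈ U := by
    intro k
    refine mem_union_right _ (mem_image.2 ?_)
    rcases le_total k n' with h | h
    · exact ⟨k, by simp; omega, rfl⟩
    · exact ⟨n', by simp, by rw [hP'.2.2 k h, hP'.2.2 n' le_rfl]⟩
  have hUI : ∀ x ∈ U, x ∈ Set.Icc s t := by
    intro x hx
    rcases mem_union.1 hx with h | h
    · obtain ⟨k, -, rfl⟩ := mem_image.1 h
      exact hP.mem k
    · obtain ⟨k, -, rfl⟩ := mem_image.1 h
      exact hP'.mem k
  have hpos : 0 < U.card := card_pos.2 ⟨_, m1 0⟩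
  obtain ⟨N, hN⟩ : ∃ N, U.card = N + 1 := ⟨U.card - 1, by omega⟩
  let e := U.orderIsoOfFin hN
  let R : ℕ → ℝ := fun k => (e ⟨min k N, by omega⟩ : ℝ)
  let τ : {x // x ∈ U} → ℕ := fun x => ((e.symm x : Fin (N+1)) : ℕ)
  have hτN : ∀ x, τ x ≤ N := fun x => Nat.lt_succ_iff.1 (e.symm x).2
  have hRτ : ∀ x, R (τ x) = x := by
    intro x
    have : (⟨min (τ x) N, by omega⟩ : Fin (N+1)) = e.symm x := by
      ext; simp [hτN x]; rfl
    simp only [R, this, OrderIso.apply_symm_apply]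
  have hτmono : ∀ x y, x ≤ y → τ x ≤ τ y := fun x y h => by
    have := e.symm.monotone h
    exact this
  have hRmono : Monotone R := by
    intro a b h
    have : (⟨min a N, by omega⟩ : Fin (N+1)) ≤ ⟨min b N, by omega⟩ := by
      simp only [Fin.mk_le_mk]; omega
    exact e.monotone this
  have hRU : ∀ k, R k ∈ U := fun k => (e ⟨min k N, by omega⟩).2
  have hsU : s ∈ U := hP.2.1 ▸ m1 0
  have htU : t ∈ U := hP.2.2 n le_rfl ▸ m1 n
  have hτR : ∀ k (hk : k ≤ N), τ ⟨R k, hRU k⟩ = k := by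
    intro k hk
    have : (⟨R k, hRU k⟩ : {x // x ∈ U}) = e ⟨min k N, by omega⟩ := rfl
    simp only [τ, this, OrderIso.symm_apply_apply]
    exact min_eq_left hk
  have hτs : τ ⟨s, hsU⟩ = 0 := by
    have := hτmono ⟨s, hsU⟩ ⟨R 0, hRU 0⟩ (hUI _ (hRU 0)).1
    rw [hτR 0 (Nat.zero_le _)] at this
    omega
  have hτt : τ ⟨t, htU⟩ = N := by
    have := hτmono ⟨R N, hRU N⟩ ⟨t, htU⟩ (hUI _ (hRU N)).2
    rw [hτR N le_rfl] at this
    have := hτN ⟨t, htU⟩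
    omega
  have hRN : R N = t := by rw [← hτt, hRτ]
  refine ⟨N, R, fun k => τ ⟨P k, m1 k⟩, fun k => τ ⟨P' k, m2 k⟩, ⟨hRmono, ?_, ?_⟩, ⟨?_, ?_, ?_⟩,
    ⟨?_, ?_, ?_⟩, fun k => (hRτ ⟨P k, m1 k⟩).symm,
    fun k => (hRτ ⟨P' k, m2 k⟩).symm⟩
  · rw [← hτs, hRτ]
  · intro k hk
    rw [← hRN]
    simp [R, hk]
  · exact fun a b h => hτmono _ _ (hP.1 h)
  · simp only [hP.2.1, hτs]
  · intro k hk
    simp only [hP.2.2 k hk, hτt]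
  · exact fun a b h => hτmono _ _ (hP'.1 h)
  · simp only [hP'.2.1, hτs]
  · intro k hk
    simp only [hP'.2.2 k hk, hτt]

lemma exists_cell (σ : ℕ → ℕ) (h0 : σ 0 = 0) (k : ℕ) (n : ℕ) (hk : k < σ n) :
    ∃ i < n, σ i ≤ k ∧ k < σ (i+1) := by
  induction n with
  | zero => omega
  | succ n ih =>
    by_cases h : σ n ≤ k
    · exact ⟨n, by omega, h, hk⟩
    · obtain ⟨i, hi, h⟩ := ih (by omega)
      exact ⟨i, by omega, h⟩

lemma floor_map {N n : ℕ} {σ : ℕ → ℕ} (hσ : NDiss 0 N n σ) :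
    ∃ φ : ℕ → ℕ, NDiss 0 N N φ ∧ (∀ i < n, ∀ k, σ i ≤ k → k < σ (i+1) → φ k = σ i) := by
  refine ⟨fun k => ((range (n+1)).filter (fun i => σ i ≤ k)).sup σ, ⟨?_, ?_, ?_⟩, ?_⟩
  · intro a b h
    refine Finset.sup_mono ?_
    intro i hi
    simp only [mem_filter] at hi ⊢
    exact ⟨hi.1, hi.2.trans h⟩
  · refine Nat.le_zero.1 (Finset.sup_le fun i hi => ?_)
    exact (mem_filter.1 hi).2
  · intro k hk
    have hn := hσ.2.2 n le_rfl
    apply le_antisymm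
    · refine Finset.sup_le fun i hi => ?_
      rw [← hn]
      exact hσ.1 (by have := mem_range.1 (mem_filter.1 hi).1; omega)
    · conv_lhs => rw [← hn]
      refine Finset.le_sup (f := σ) (mem_filter.2 ⟨by simp, ?_⟩)
      omega
  · intro i hi k h1 h2
    apply le_antisymm
    · refine Finset.sup_le fun i' hi' => ?_
      refine hσ.1 ?_
      by_contra hlt
      have := hσ.1 (show i + 1 ≤ i' by omega)
      have := (mem_filter.1 hi').2
      omega
    · exact Finset.le_sup (f := σ) (mem_filter.2 ⟨by simp; omega, h1⟩)

lemma sum_floor (σ φ : ℕ → ℕ) (hσ : Monotone σ) (h0 : σ 0 = 0) (H w : ℕ → ℝ) (n : ℕ)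
    (hφ : ∀ i < n, ∀ k, σ i ≤ k → k < σ (i+1) → φ k = σ i) :
    ∑ k ∈ range (σ n), H (φ k) * (w (k+1) - w k) =
      ∑ i ∈ range n, H (σ i) * (w (σ (i+1)) - w (σ i)) := by
  induction n with
  | zero => simp [h0]
  | succ n ih =>
    obtain ⟨d, hd⟩ := Nat.exists_eq_add_of_le (hσ (Nat.le_succ n))
    rw [Nat.succ_eq_add_one] at hd
    rw [sum_range_succ, ← ih (fun i hi => hφ i (by omega)), hd, sum_range_add]
    congr 1
    have : ∀ x ∈ range d, H (φ (σ n + x)) * (w (σ n + x + 1) - w (σ n + x)) =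
        H (σ n) * (w (σ n + (x+1)) - w (σ n + x)) := by
      intro x hx
      have := mem_range.1 hx
      rw [hφ n (by omega) (σ n + x) (by omega) (by omega)]
      rfl
    rw [sum_congr rfl this, ← mul_sum, sum_range_sub (fun x => w (σ n + x))]
    simp

lemma ysum_floor (F G : ℕ → ℕ → ℝ) {N M n m : ℕ} {σ φ τ ψ : ℕ → ℕ}
    (hσ : NDiss 0 N n σ) (hτ : NDiss 0 M m τ)
    (hφ : ∀ i < n, ∀ k, σ i ≤ k → k < σ (i+1) → φ k = σ i)
    (hψ : ∀ i < m, ∀ k, τ i ≤ k → k < τ (i+1) → ψ k = τ i) :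
    ysum (fun k l => F (φ k) (ψ l)) G (fun k => min k N) (fun l => min l M) N M =
      ysum F G σ τ n m := by
  unfold ysum
  have e1 : ∀ k ∈ range N, ∑ l ∈ range M, F (φ (min k N)) (ψ (min l M)) *
      rinc G (min k N) (min (k+1) N) (min l M) (min (l+1) M) =
      ∑ j ∈ range m, F (φ k) (τ j) * rinc G k (k+1) (τ j) (τ (j+1)) := by
    intro k hk
    have hk := mem_range.1 hk
    have := sum_floor τ ψ hτ.1 hτ.2.1 (fun l => F (φ k) l) (fun l => G (k+1) l - G k l) m hψ
    rw [hτ.2.2 m le_rfl] at this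
    refine Eq.trans (sum_congr rfl fun l hl => ?_) (this.trans (sum_congr rfl fun j _ => ?_))
    · have hl := mem_range.1 hl
      rw [min_eq_left hk.le, min_eq_left hl.le, min_eq_left (Nat.succ_le_of_lt hk),
        min_eq_left (Nat.succ_le_of_lt hl)]
      unfold rinc
      ring
    · unfold rinc
      ring
  rw [sum_congr rfl e1, sum_comm, sum_comm (s := range n)]
  refine sum_congr rfl fun j _ => ?_
  have := sum_floor σ φ hσ.1 hσ.2.1 (fun k => F k (τ j))
    (fun k => G k (τ (j+1)) - G k (τ j)) n hφ
  rw [hσ.2.2 n le_rfl] at this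
  refine Eq.trans (sum_congr rfl fun l hl => ?_) (this.trans (sum_congr rfl fun j _ => ?_))
  · unfold rinc
    ring
  · unfold rinc
    ring

lemma floor_close {s t δ : ℝ} (hδ : 0 < δ) {N n : ℕ} {R : ℕ → ℝ} {σ φ : ℕ → ℕ}
    (hR : NDiss s t N R) (hσ : NDiss 0 N n σ) (hφN : NDiss 0 N N φ)
    (hφ : ∀ i < n, ∀ k, σ i ≤ k → k < σ (i+1) → φ k = σ i)
    (hmesh : ∀ i < n, R (σ (i+1)) - R (σ i) < δ) (k : ℕ) :
    R k - δ < R (φ k) ∧ R (φ k) ≤ R k := by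
  rcases lt_or_ge k N with h | h
  · obtain ⟨i, hi, h1, h2⟩ := exists_cell σ hσ.2.1 k n (by rw [hσ.2.2 n le_rfl]; exact h)
    rw [hφ i hi k h1 h2]
    have := hmesh i hi
    have := hR.1 h2.le
    exact ⟨by linarith, hR.1 h1⟩
  · rw [hφN.2.2 k h, hR.2.2 N le_rfl, hR.2.2 k h]
    exact ⟨by linarith, le_rfl⟩

lemma pow_interp {x y q q' η : ℝ} (hq : 1 ≤ q) (hq' : q < q') (h : |x - y| ≤ η) :
    |x - y| ^ q' ≤ η ^ (q' - q) * (2 ^ q * (|x| ^ q + |y| ^ q)) := by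
  have hη : 0 ≤ η := (abs_nonneg _).trans h
  have e : |x - y| ^ q' = |x - y| ^ (q' - q) * |x - y| ^ q := by
    rw [← Real.rpow_add_of_nonneg (abs_nonneg _) (by linarith) (by linarith)]
    congr 1; ring
  rw [e]
  have h1 : |x - y| ^ (q' - q) ≤ η ^ (q' - q) :=
    Real.rpow_le_rpow (abs_nonneg _) h (by linarith)
  have h2 : |x - y| ^ q ≤ 2 ^ q * (|x| ^ q + |y| ^ q) := by
    have a1 : |x - y| ≤ 2 * max |x| |y| := by
      have := abs_sub x y
      have := le_max_left |x| |y|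
      have := le_max_right |x| |y|
      linarith
    refine (Real.rpow_le_rpow (abs_nonneg _) a1 (by linarith)).trans ?_
    rw [Real.mul_rpow (by norm_num) (by positivity)]
    refine mul_le_mul_of_nonneg_left ?_ (by positivity)
    have p1 : 0 ≤ |x| ^ q := by positivity
    have p2 : 0 ≤ |y| ^ q := by positivity
    rcases max_choice |x| |y| with h | h <;> rw [h] <;> linarith
  exact mul_le_mul h1 h2 (by positivity) (by positivity)

lemma ysum_sub {α : Type*} (f₁ f₂ g : α → α → ℝ) (P Q : ℕ → α) (n m : ℕ) :
    ysum f₁ g P Q n m - ysum f₂ g P Q n m = ysum (fun x y => f₁ x y - f₂ x y) g P Q n m := by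
  unfold ysum
  simp_rw [← sum_sub_distrib, sub_mul]

lemma cauchy_est (p q q' C : ℝ) (hq : 1 ≤ q) (hq' : q < q')
    (hC : ∀ (α : Type) [Preorder α] (f g : α → α → ℝ) (s t u v : α) (A B : ℝ),
      0 ≤ A → 0 ≤ B → VB f q' s t u v A → VB g p s t u v B →
      (∀ x, f x u = 0) → (∀ y, f s y = 0) → ∀ (n m : ℕ) (P Q : ℕ → α),
      NDiss s t n P → NDiss u v m Q → |ysum f g P Q n m| ≤ C * A ^ q'⁻¹ * B ^ p⁻¹)
    (f g : ℝ → ℝ → ℝ) (s t u v A B δ η : ℝ) (hA : 0 ≤ A) (hB : 0 ≤ B) (hδ : 0 < δ) (hη : 0 ≤ η)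
    (hf : VB f q s t u v A) (hg : VB g p s t u v B) (hu : ∀ x, f x u = 0) (hs : ∀ y, f s y = 0)
    (hosc : ∀ x ∈ Set.Icc s t, ∀ x' ∈ Set.Icc s t, ∀ y ∈ Set.Icc u v, ∀ y' ∈ Set.Icc u v,
      |x - x'| < δ → |y - y'| < δ → |f x y - f x' y'| ≤ η)
    (n m n' m' : ℕ) (P Q P' Q' : ℕ → ℝ) (hP : NDiss s t n P) (hQ : NDiss u v m Q)
    (hP' : NDiss s t n' P') (hQ' : NDiss u v m' Q')
    (mP : ∀ i < n, P (i+1) - P i < δ) (mQ : ∀ i < m, Q (i+1) - Q i < δ)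
    (mP' : ∀ i < n', P' (i+1) - P' i < δ) (mQ' : ∀ i < m', Q' (i+1) - Q' i < δ) :
    |ysum f g P Q n m - ysum f g P' Q' n' m'| ≤
      C * ((4 * η) ^ (q' - q) * (2 ^ q * (A + A))) ^ q'⁻¹ * B ^ p⁻¹ := by
  obtain ⟨N, R, σ, σ', hR, hσ, hσ', eP, eP'⟩ := merge hP hP'
  obtain ⟨M, S, τ, τ', hS, hτ, hτ', eQ, eQ'⟩ := merge hQ hQ'
  obtain ⟨φ, hφN, hφ⟩ := floor_map hσ
  obtain ⟨φ', hφN', hφ'⟩ := floor_map hσ'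
  obtain ⟨ψ, hψN, hψ⟩ := floor_map hτ
  obtain ⟨ψ', hψN', hψ'⟩ := floor_map hτ'
  obtain rfl : P = fun k => R (σ k) := funext eP
  obtain rfl : P' = fun k => R (σ' k) := funext eP'
  obtain rfl : Q = fun k => S (τ k) := funext eQ
  obtain rfl : Q' = fun k => S (τ' k) := funext eQ'
  set F : ℕ → ℕ → ℝ := fun k l => f (R k) (S l) with hF
  set G : ℕ → ℕ → ℝ := fun k l => g (R k) (S l) with hG
  have y1 : ysum f g (fun k => R (σ k)) (fun k => S (τ k)) n m = ysum F G σ τ n m := rfl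
  have y2 : ysum f g (fun k => R (σ' k)) (fun k => S (τ' k)) n' m' = ysum F G σ' τ' n' m' := rfl
  rw [y1, y2, ← ysum_floor F G hσ hτ hφ hψ, ← ysum_floor F G hσ' hτ' hφ' hψ', ysum_sub]
  have idN : ∀ N : ℕ, NDiss 0 N N (fun k => min k N) := fun N =>
    ⟨fun a b h => min_le_min_right _ h, by simp, fun k hk => min_eq_right hk⟩
  refine hC ℕ _ G 0 N 0 M _ B (by positivity) hB ?_ ?_ ?_ ?_ N M _ _ (idN N) (idN M)
  · have hη' : ∀ k l, |F (φ k) (ψ l) - F (φ' k) (ψ' l)| ≤ η := by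
      intro k l
      have a1 := floor_close hδ hR hσ hφN hφ mP k
      have a2 := floor_close hδ hR hσ' hφN' hφ' mP' k
      have a3 := floor_close hδ hS hτ hψN hψ mQ l
      have a4 := floor_close hδ hS hτ' hψN' hψ' mQ' l
      refine hosc _ (hR.mem _) _ (hR.mem _) _ (hS.mem _) _ (hS.mem _) ?_ ?_
      · rw [abs_lt]; constructor <;> linarith
      · rw [abs_lt]; constructor <;> linarith
    intro a b X Y hX hY
    have v1 := hf _ _ _ _ ((hR.comp hφN).comp hX) ((hS.comp hψN).comp hY)
    have v2 := hf _ _ _ _ ((hR.comp hφN').comp hX) ((hS.comp hψN').comp hY)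
    refine (sum_le_sum fun i _ => sum_le_sum fun j _ => ?_).trans
      (b := ∑ i ∈ range a, ∑ j ∈ range b, (4 * η) ^ (q' - q) * (2 ^ q *
        (|rinc f (R (φ (X i))) (R (φ (X (i+1)))) (S (ψ (Y j))) (S (ψ (Y (j+1))))| ^ q +
        |rinc f (R (φ' (X i))) (R (φ' (X (i+1)))) (S (ψ' (Y j))) (S (ψ' (Y (j+1))))| ^ q))) ?_
    · have e : rinc (fun x y => F (φ x) (ψ y) - F (φ' x) (ψ' y)) (X i) (X (i+1)) (Y j) (Y (j+1)) =
        rinc f (R (φ (X i))) (R (φ (X (i+1)))) (S (ψ (Y j))) (S (ψ (Y (j+1)))) -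
        rinc f (R (φ' (X i))) (R (φ' (X (i+1)))) (S (ψ' (Y j))) (S (ψ' (Y (j+1)))) := by
        simp only [rinc, hF]; ring
      have hb : |rinc (fun x y => F (φ x) (ψ y) - F (φ' x) (ψ' y)) (X i) (X (i+1)) (Y j)
          (Y (j+1))| ≤ 4 * η := by
        have b1 := abs_le.1 (hη' (X i) (Y j))
        have b2 := abs_le.1 (hη' (X (i+1)) (Y j))
        have b3 := abs_le.1 (hη' (X i) (Y (j+1)))
        have b4 := abs_le.1 (hη' (X (i+1)) (Y (j+1)))
        simp only [rinc]
        rw [abs_le]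
        constructor <;> linarith
      rw [e] at hb ⊢
      exact pow_interp hq hq' hb
    · simp_rw [← mul_sum, sum_add_distrib]
      gcongr
  · intro n m X Y hX hY
    exact hg _ _ _ _ (hR.comp hX) (hS.comp hY)
  · intro x
    simp [hF, hψN.2.1, hψN'.2.1, hS.2.1, hu]
  · intro x
    simp [hF, hφN.2.1, hφN'.2.1, hR.2.1, hs]

/-- Extension of a `Fin`-tuple to a sequence. -/
def extFin {n : ℕ} (P : Fin (n+1) → ℝ) (k : ℕ) : ℝ := P ⟨min k n, by omega⟩

lemma extFin_castSucc {n : ℕ} (P : Fin (n+1) → ℝ) (i : Fin n) :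
    P i.castSucc = extFin P i := by
  unfold extFin
  congr 1
  ext
  simp [i.2.le]

lemma extFin_succ {n : ℕ} (P : Fin (n+1) → ℝ) (i : Fin n) :
    P i.succ = extFin P (i + 1) := by
  unfold extFin
  congr 1
  ext
  simp [Nat.succ_le_of_lt i.2]

lemma IsDissection.ndiss {s t : ℝ} {n : ℕ} {P : Fin (n+1) → ℝ} (h : IsDissection s t P) :
    NDiss s t n (extFin P) := by
  refine ⟨fun a b hab => h.1 ?_, ?_, fun k hk => ?_⟩
  · simp only [Fin.mk_le_mk]; omega
  · rw [← h.2.1]; unfold extFin; congr 1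
  · rw [← h.2.2]; unfold extFin; congr 1; ext; simp [hk]

lemma NDiss.isDissection {s t : ℝ} {n : ℕ} {P : ℕ → ℝ} (h : NDiss s t n P) :
    IsDissection s t (fun i : Fin (n+1) => P i) :=
  ⟨fun a b hab => h.1 hab, by simpa using h.2.1, by simpa using h.2.2 n le_rfl⟩

lemma mem_varSums2D {f : ℝ → ℝ → ℝ} {q s t u v : ℝ} {n m : ℕ} {P Q : ℕ → ℝ}
    (hP : NDiss s t n P) (hQ : NDiss u v m Q) :
    ∑ i ∈ range n, ∑ j ∈ range m, |rinc f (P i) (P (i+1)) (Q j) (Q (j+1))| ^ q ∈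
      varSums2D f q s t u v := by
  refine ⟨n, m, _, _, hP.isDissection, hQ.isDissection, ?_⟩
  rw [sum_range]
  refine sum_congr rfl fun i _ => ?_
  rw [sum_range]
  rfl

lemma exists_of_mem_varSums2D {f : ℝ → ℝ → ℝ} {q s t u v x : ℝ} (h : x ∈ varSums2D f q s t u v) :
    ∃ (n m : ℕ) (P Q : ℕ → ℝ), NDiss s t n P ∧ NDiss u v m Q ∧
      x = ∑ i ∈ range n, ∑ j ∈ range m, |rinc f (P i) (P (i+1)) (Q j) (Q (j+1))| ^ q := by
  obtain ⟨n, m, P, Q, hP, hQ, rfl⟩ := h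
  refine ⟨n, m, _, _, hP.ndiss, hQ.ndiss, ?_⟩
  rw [sum_range]
  refine sum_congr rfl fun i _ => ?_
  rw [sum_range]
  refine sum_congr rfl fun j _ => ?_
  rw [extFin_castSucc P, extFin_castSucc Q, extFin_succ P, extFin_succ Q]
  rfl

lemma NDiss.enlarge {s t a b : ℝ} {n : ℕ} {P : ℕ → ℝ} (h : NDiss s t n P) (ha : a ≤ s)
    (hb : t ≤ b) : ∃ E : ℕ → ℝ, NDiss a b (n+2) E ∧ ∀ i ≤ n, E (i+1) = P i := by
  refine ⟨fun k => if k = 0 then a else if k ≤ n+1 then P (k-1) else b, ⟨?_, by simp, ?_⟩, ?_⟩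
  · intro x y hxy
    have hx := h.mem (x-1)
    have hy := h.mem (y-1)
    have hm := h.1 (show x - 1 ≤ y - 1 by omega)
    have := hx.1
    have := hx.2
    have := hy.1
    have := hy.2
    simp only
    split_ifs <;> first | omega | linarith
  · intro k hk
    simp only
    rw [if_neg (by omega), if_neg (by omega)]
  · intro i hi
    simp only
    rw [if_neg (by omega), if_pos (by omega)]
    simp

lemma bdd_sub {f : ℝ → ℝ → ℝ} {q s t u v a b c d : ℝ} (ha : a ≤ s) (hb : t ≤ b) (hc : c ≤ u)
    (hd : v ≤ d) (h : BddAbove (varSums2D f q a b c d)) : BddAbove (varSums2D f q s t u v) := by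
  obtain ⟨K, hK⟩ := h
  refine ⟨K, fun x hx => ?_⟩
  obtain ⟨n, m, P, Q, hP, hQ, rfl⟩ := exists_of_mem_varSums2D hx
  obtain ⟨E, hE, eE⟩ := hP.enlarge ha hb
  obtain ⟨D, hD, eD⟩ := hQ.enlarge hc hd
  refine le_trans ?_ (hK (mem_varSums2D hE hD))
  refine le_trans ?_ (sum_sub_le (n+1) (m+1)
    (fun i j => |rinc f (E i) (E (i+1)) (D j) (D (j+1))| ^ q) (fun i j => by positivity))
  refine le_trans (le_of_eq ?_) (sum_sub_le' n m
    (fun i j => |rinc f (E i) (E (i+1)) (D j) (D (j+1))| ^ q) (fun i j => by positivity))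
  refine sum_congr rfl fun i hi => sum_congr rfl fun j hj => ?_
  have hi := mem_range.1 hi
  have hj := mem_range.1 hj
  rw [eE i hi.le, eE (i+1) hi, eD j hj.le, eD (j+1) hj]

lemma sSup_varSums_nonneg (f : ℝ → ℝ → ℝ) (q s t u v : ℝ) : 0 ≤ sSup (varSums2D f q s t u v) := by
  refine Real.sSup_nonneg fun x hx => ?_
  obtain ⟨n, m, P, Q, hP, hQ, rfl⟩ := exists_of_mem_varSums2D hx
  positivity

lemma fin_sum_eq_ysum (f g : ℝ → ℝ → ℝ) {n m : ℕ} (P : Fin (n+1) → ℝ) (Q : Fin (m+1) → ℝ) :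
    (∑ i : Fin n, ∑ j : Fin m, f (P i.castSucc) (Q j.castSucc) *
      rectInc g (P i.castSucc) (P i.succ) (Q j.castSucc) (Q j.succ)) =
      ysum f g (extFin P) (extFin Q) n m := by
  unfold ysum
  rw [sum_range]
  refine sum_congr rfl fun i _ => ?_
  rw [sum_range]
  refine sum_congr rfl fun j _ => ?_
  rw [extFin_castSucc P, extFin_castSucc Q, extFin_succ P, extFin_succ Q]
  rfl

/-- The uniform dissection. -/
noncomputable def unif (s t : ℝ) (k i : ℕ) : ℝ := s + (t - s) * (min i (k+1) : ℕ) / ((k:ℝ)+1)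

lemma unif_ndiss {s t : ℝ} (h : s ≤ t) (k : ℕ) : NDiss s t (k+1) (unif s t k) := by
  have hk : (0:ℝ) < (k:ℝ) + 1 := by positivity
  refine ⟨fun a b hab => ?_, by simp [unif], fun i hi => ?_⟩
  · unfold unif
    have h1 : ((min a (k+1) : ℕ) : ℝ) ≤ ((min b (k+1) : ℕ) : ℝ) := by
      exact_mod_cast min_le_min_right _ hab
    have h2 : 0 ≤ t - s := by linarith
    gcongr
  · unfold unif
    rw [min_eq_right hi]
    push_cast
    field_simp
    ring

lemma unif_mesh {s t : ℝ} (k i : ℕ) (hi : i < k+1) :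
    unif s t k (i+1) - unif s t k i = (t - s) / ((k:ℝ)+1) := by
  unfold unif
  rw [min_eq_left hi.le, min_eq_left (Nat.succ_le_of_lt hi)]
  push_cast
  ring

end Helpers

/-- 2D Young integral: for continuous `f` of finite 2D `q`-variation and
`g` of finite 2D `p`-variation with `1/p + 1/q > 1`, and `f` vanishing on the lower edges
of the rectangle, the 2D Young integral `∫_{[s,t]×[u,v]} f dg` exists (as the limit of 2D
Riemann–Stieltjes sums as the meshes tend to `0`) and is bounded by
`C_{p,q} |f|_{q-var} |g|_{p-var}` with `C_{p,q}` depending only on `p, q`. -/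
theorem stmt_4 (p q : ℝ) (hp : 1 ≤ p) (hq : 1 ≤ q) (hpq : 1 / p + 1 / q > 1) :
    ∃ C : ℝ, 0 < C ∧
    ∀ (T : ℝ) (f g : ℝ → ℝ → ℝ), 0 < T →
      ContinuousOn (fun z : ℝ × ℝ => f z.1 z.2) (Set.Icc 0 T ×ˢ Set.Icc 0 T) →
      ContinuousOn (fun z : ℝ × ℝ => g z.1 z.2) (Set.Icc 0 T ×ˢ Set.Icc 0 T) →
      BddAbove (varSums2D f q 0 T 0 T) →
      BddAbove (varSums2D g p 0 T 0 T) →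
      ∀ s t u v, 0 ≤ s → s ≤ t → t ≤ T → 0 ≤ u → u ≤ v → v ≤ T →
      (∀ y, f s y = 0) → (∀ x, f x u = 0) →
      ∃ I : ℝ,
        (∀ ε > (0:ℝ), ∃ δ > (0:ℝ), ∀ (n m : ℕ) (P : Fin (n + 1) → ℝ) (Q : Fin (m + 1) → ℝ),
          IsDissection s t P → IsDissection u v Q →
          (∀ i : Fin n, P i.succ - P i.castSucc < δ) →
          (∀ j : Fin m, Q j.succ - Q j.castSucc < δ) →
          |(∑ i : Fin n, ∑ j : Fin m, f (P i.castSucc) (Q j.castSucc) *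
              rectInc g (P i.castSucc) (P i.succ) (Q j.castSucc) (Q j.succ)) - I| < ε) ∧
        |I| ≤ C * (sSup (varSums2D f q s t u v)) ^ q⁻¹ *
              (sSup (varSums2D g p s t u v)) ^ p⁻¹ := by
  have hpq' : 1 < p⁻¹ + q⁻¹ := by simpa [one_div] using hpq
  have hq0 : 0 < q := by linarith
  have hp0 : 0 < p := by linarith
  obtain ⟨C, hC0, hC⟩ := young_discrete p q hp hq hpq'
  obtain ⟨q', hqq', hpq2⟩ : ∃ q', q < q' ∧ 1 < p⁻¹ + q'⁻¹ := by
    have hc : ContinuousAt (fun x : ℝ => p⁻¹ + x⁻¹) q :=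
      continuousAt_const.add (continuousAt_inv₀ hq0.ne')
    have h1 := (hc.eventually (lt_mem_nhds hpq')).filter_mono
      (nhdsWithin_le_nhds (s := Set.Ioi q))
    obtain ⟨x, hx1, hx2⟩ := (h1.and self_mem_nhdsWithin).exists
    exact ⟨x, hx2, hx1⟩
  have hq'0 : 0 < q' := by linarith
  obtain ⟨C', hC'0, hC'⟩ := young_discrete p q' hp (by linarith) hpq2
  refine ⟨C, hC0, ?_⟩
  intro T f g hT hfc hgc hfb hgb s t u v hs hst htT hu huv hvT hfs hfu
  have bf := bdd_sub hs htT hu hvT hfb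
  have bg := bdd_sub hs htT hu hvT hgb
  set A := sSup (varSums2D f q s t u v) with hA
  set B := sSup (varSums2D g p s t u v) with hB
  have hA0 : 0 ≤ A := sSup_varSums_nonneg _ _ _ _ _ _
  have hB0 : 0 ≤ B := sSup_varSums_nonneg _ _ _ _ _ _
  have vf : VB f q s t u v A := fun n m P Q hP hQ => le_csSup bf (mem_varSums2D hP hQ)
  have vg : VB g p s t u v B := fun n m P Q hP hQ => le_csSup bg (mem_varSums2D hP hQ)
  -- the uniform Cauchy property
  have cauchy : ∀ ε > (0:ℝ), ∃ δ > (0:ℝ), ∀ (n m n' m' : ℕ) (P Q P' Q' : ℕ → ℝ),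
      NDiss s t n P → NDiss u v m Q → NDiss s t n' P' → NDiss u v m' Q' →
      (∀ i < n, P (i+1) - P i < δ) → (∀ i < m, Q (i+1) - Q i < δ) →
      (∀ i < n', P' (i+1) - P' i < δ) → (∀ i < m', Q' (i+1) - Q' i < δ) →
      |ysum f g P Q n m - ysum f g P' Q' n' m'| < ε := by
    intro ε hε
    obtain ⟨η, hη0, hη⟩ : ∃ η : ℝ, 0 < η ∧
        C' * ((4 * η) ^ (q' - q) * (2 ^ q * (A + A))) ^ q'⁻¹ * B ^ p⁻¹ < ε := by
      have hc : Continuous (fun η : ℝ =>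
          C' * ((4 * η) ^ (q' - q) * (2 ^ q * (A + A))) ^ q'⁻¹ * B ^ p⁻¹) := by
        have c1 : Continuous (fun η : ℝ => (4 * η) ^ (q' - q)) :=
          (Real.continuous_rpow_const (by linarith)).comp (by fun_prop)
        exact (continuous_const.mul ((Real.continuous_rpow_const (by positivity)).comp
          (c1.mul continuous_const))).mul continuous_const
      have h0 : C' * ((4 * (0:ℝ)) ^ (q' - q) * (2 ^ q * (A + A))) ^ q'⁻¹ * B ^ p⁻¹ < ε := by
        rw [mul_zero, Real.zero_rpow (sub_pos.2 hqq').ne', zero_mul,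
          Real.zero_rpow (by positivity), mul_zero, zero_mul]
        exact hε
      have h1 := (hc.continuousAt.eventually (gt_mem_nhds h0)).filter_mono
        (nhdsWithin_le_nhds (s := Set.Ioi (0:ℝ)))
      obtain ⟨x, hx1, hx2⟩ := (h1.and self_mem_nhdsWithin).exists
      exact ⟨x, hx2, hx1⟩
    have huc := (isCompact_Icc.prod isCompact_Icc).uniformContinuousOn_of_continuous hfc
    obtain ⟨δ, hδ, hδ'⟩ := Metric.uniformContinuousOn_iff.1 huc η hη0
    refine ⟨δ, hδ, ?_⟩
    intro n m n' m' P Q P' Q' hP hQ hP' hQ' mP mQ mP' mQ'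
    refine lt_of_le_of_lt (cauchy_est p q q' C' hq hqq' hC' f g s t u v A B δ η hA0 hB0 hδ hη0.le
      vf vg hfu hfs ?_ n m n' m' P Q P' Q' hP hQ hP' hQ' mP mQ mP' mQ') hη
    intro x hx x' hx' y hy y' hy' hxx hyy
    have := hδ' (x, y) ⟨⟨by linarith [hx.1], by linarith [hx.2]⟩,
        ⟨by linarith [hy.1], by linarith [hy.2]⟩⟩ (x', y')
      ⟨⟨by linarith [hx'.1], by linarith [hx'.2]⟩, ⟨by linarith [hy'.1], by linarith [hy'.2]⟩⟩
      (by rw [Prod.dist_eq]; exact max_lt hxx hyy)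
    exact this.le
  set S : ℕ → ℝ := fun k => ysum f g (unif s t k) (unif u v k) (k+1) (k+1) with hS
  have small : ∀ δ > (0:ℝ), ∃ K : ℕ, ∀ k ≥ K, ∀ i < k+1,
      unif s t k (i+1) - unif s t k i < δ ∧ unif u v k (i+1) - unif u v k i < δ := by
    intro δ hδ
    have key : ∀ c : ℝ, ∀ᶠ k : ℕ in Filter.atTop, c / ((k:ℝ)+1) < δ := by
      intro c
      have : Filter.Tendsto (fun k : ℕ => c / ((k:ℝ)+1)) Filter.atTop (nhds 0) :=
        Filter.Tendsto.div_atTop tendsto_const_nhds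
          (Filter.tendsto_atTop_add_const_right _ _ tendsto_natCast_atTop_atTop)
      exact this.eventually (gt_mem_nhds hδ)
    obtain ⟨K, hK⟩ := Filter.eventually_atTop.1 ((key (t - s)).and (key (v - u)))
    refine ⟨K, fun k hk i hi => ?_⟩
    rw [unif_mesh k i hi, unif_mesh k i hi]
    exact hK k hk
  have hcs : CauchySeq S := by
    rw [Metric.cauchySeq_iff]
    intro ε hε
    obtain ⟨δ, hδ, h⟩ := cauchy ε hε
    obtain ⟨K, hK⟩ := small δ hδ
    refine ⟨K, fun a ha b hb => ?_⟩
    exact h _ _ _ _ _ _ _ _ (unif_ndiss hst a) (unif_ndiss huv a) (unif_ndiss hst b)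
      (unif_ndiss huv b) (fun i hi => (hK a ha i hi).1) (fun i hi => (hK a ha i hi).2)
      (fun i hi => (hK b hb i hi).1) (fun i hi => (hK b hb i hi).2)
  obtain ⟨I, hI⟩ := cauchySeq_tendsto_of_complete hcs
  refine ⟨I, ?_, ?_⟩
  · intro ε hε
    obtain ⟨δ, hδ, h⟩ := cauchy (ε / 2) (by linarith)
    refine ⟨δ, hδ, ?_⟩
    intro n m P Q hP hQ mP mQ
    rw [fin_sum_eq_ysum]
    obtain ⟨K, hK⟩ := small δ hδ
    have hle : |ysum f g (extFin P) (extFin Q) n m - I| ≤ ε / 2 := by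
      refine le_of_tendsto ((tendsto_const_nhds.sub hI).abs) ?_
      filter_upwards [Filter.eventually_ge_atTop K] with k hk
      refine (h _ _ _ _ _ _ _ _ hP.ndiss hQ.ndiss (unif_ndiss hst k) (unif_ndiss huv k)
        ?_ ?_ (fun i hi => (hK k hk i hi).1) (fun i hi => (hK k hk i hi).2)).le
      · intro i hi
        have := mP ⟨i, hi⟩
        rwa [extFin_castSucc P, extFin_succ P] at this
      · intro i hi
        have := mQ ⟨i, hi⟩
        rwa [extFin_castSucc Q, extFin_succ Q] at this
    linarith
  · refine le_of_tendsto hI.abs (Filter.Eventually.of_forall fun k => ?_)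
    exact hC ℝ f g s t u v A B hA0 hB0 vf vg hfu hfs _ _ _ _ (unif_ndiss hst k) (unif_ndiss huv k)
end

section
/- Let (X,Y) be a 2-dimensional centered Gaussian process on [0,1] whose covariance has finite 2D ρ-variation controlled by a 2D control ω. Fix s < t. Then the function f(u,v) := E(X_{s,u}Y_{s,u} X_{s,v}Y_{s,v}) on [s,t]² vanishes on the edges u=s and v=s, has finite 2D ρ-variation, and |f|^ρ_{ρ-var;[s,t]²} ≤ C(ρ) ω([s,t]²)². -/
/-- A 2D control: nonnegative and superadditive in each rectangle coordinate. -/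
def IsControl2D (w : ℝ → ℝ → ℝ → ℝ → ℝ) : Prop :=
  (∀ s t u v, 0 ≤ w s t u v) ∧
  (∀ r s t u v, r ≤ s → s ≤ t → u ≤ v → w r s u v + w s t u v ≤ w r t u v) ∧
  (∀ u v r s t, u ≤ v → r ≤ s → s ≤ t → w u v r s + w u v s t ≤ w u v r t)

open MeasureTheory ProbabilityTheory

lemma aux_gauss_four (v : NNReal) : ∫ x, x ^ 4 ∂(gaussianReal 0 v) = 3 * (v : ℝ) ^ 2 := by
  have h := iteratedDeriv_mgf_zero (X := id) (μ := gaussianReal 0 v) (by simp) 4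
  rw [mgf_id_gaussianReal] at h
  have e : ∫ x, x ^ 4 ∂(gaussianReal 0 v) = ∫ x, (id ^ 4 : ℝ → ℝ) x ∂(gaussianReal 0 v) := rfl
  rw [e, ← h]
  have hd (p p' : ℝ → ℝ) (hp : ∀ t, HasDerivAt p (p' t) t) :
      deriv (fun t : ℝ => p t * Real.exp (v * t ^ 2 / 2)) =
        fun t => (p' t + p t * (v * t)) * Real.exp (v * t ^ 2 / 2) := by
    funext t
    have h2 : HasDerivAt (fun t : ℝ => (v : ℝ) * t ^ 2 / 2) (v * t) t := by
      have := (((hasDerivAt_id t).pow 2).const_mul (v : ℝ)).div_const 2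
      refine HasDerivAt.congr_deriv this ?_
      simp; ring
    have := ((hp t).mul h2.exp).deriv
    refine Eq.trans this ?_
    ring
  have hid (t : ℝ) : HasDerivAt (fun t : ℝ => t) 1 t := hasDerivAt_id t
  have e0 : (fun t : ℝ => Real.exp (0 * t + v * t ^ 2 / 2)) =
      fun t => (1 : ℝ) * Real.exp (v * t ^ 2 / 2) := by funext t; simp
  have hpow (n : ℕ) (t : ℝ) : HasDerivAt (fun t : ℝ => t ^ n) (n * t ^ (n - 1)) t := hasDerivAt_pow n t
  rw [e0, iteratedDeriv_succ, iteratedDeriv_succ, iteratedDeriv_succ, iteratedDeriv_succ,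
    iteratedDeriv_zero,
    hd (fun _ => 1) (fun _ => 0) (fun t => hasDerivAt_const t 1)]
  have s1 : (fun t : ℝ => (0 + 1 * ((v : ℝ) * t)) * Real.exp (v * t ^ 2 / 2)) =
      fun t => ((v : ℝ) * t) * Real.exp (v * t ^ 2 / 2) := by funext t; ring
  rw [s1, hd (fun t => (v : ℝ) * t) (fun _ => v)
    (fun t => by simpa using (hid t).const_mul (v : ℝ))]
  have s2 : (fun t : ℝ => ((v : ℝ) + v * t * ((v : ℝ) * t)) * Real.exp (v * t ^ 2 / 2)) =
      fun t => ((v : ℝ) + v ^ 2 * t ^ 2) * Real.exp (v * t ^ 2 / 2) := by funext t; ring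
  rw [s2, hd (fun t => (v : ℝ) + v ^ 2 * t ^ 2) (fun t => 2 * v ^ 2 * t)
    (fun t => by
      have := ((hpow 2 t).const_mul ((v : ℝ) ^ 2)).const_add (v : ℝ)
      exact HasDerivAt.congr_deriv this (by norm_num; ring))]
  have s3 : (fun t : ℝ => (2 * (v : ℝ) ^ 2 * t + ((v : ℝ) + v ^ 2 * t ^ 2) * ((v : ℝ) * t))
      * Real.exp (v * t ^ 2 / 2)) =
      fun t => (3 * (v : ℝ) ^ 2 * t + v ^ 3 * t ^ 3) * Real.exp (v * t ^ 2 / 2) := by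
    funext t; ring
  rw [s3, hd (fun t => 3 * (v : ℝ) ^ 2 * t + v ^ 3 * t ^ 3)
    (fun t => 3 * (v : ℝ) ^ 2 + v ^ 3 * (3 * t ^ 2))
    (fun t => by
      have := ((hid t).const_mul (3 * (v : ℝ) ^ 2)).add ((hpow 3 t).const_mul ((v : ℝ) ^ 3))
      exact HasDerivAt.congr_deriv this (by norm_num))]
  simp

lemma aux_gauss_two (v : NNReal) : ∫ x, x ^ 2 ∂(gaussianReal 0 v) = (v : ℝ) := by
  have h := variance_fun_id_gaussianReal (μ := 0) (v := v)
  rw [variance_of_integral_eq_zero (by fun_prop) (by simp)] at h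
  simpa using h

section
variable {Ω : Type} [MeasurableSpace Ω] {μ : Measure Ω}

lemma aux_memLp {Z : Ω → ℝ} (hZ : Measurable Z) {v : NNReal} (h : μ.map Z = gaussianReal 0 v) :
    MemLp Z 4 μ := by
  have := memLp_id_gaussianReal' (μ := 0) (v := v) 4 (by simp)
  rw [← h] at this
  simpa using (memLp_map_measure_iff (by fun_prop) hZ.aemeasurable).1 this

lemma aux_four {Z : Ω → ℝ} (hZ : Measurable Z) {v : NNReal} (h : μ.map Z = gaussianReal 0 v) :
    ∫ ω, Z ω ^ 4 ∂μ = 3 * (∫ ω, Z ω ^ 2 ∂μ) ^ 2 := by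
  have h4 := integral_map (μ := μ) hZ.aemeasurable (f := fun x : ℝ => x ^ 4) (by fun_prop)
  have h2 := integral_map (μ := μ) hZ.aemeasurable (f := fun x : ℝ => x ^ 2) (by fun_prop)
  rw [h, aux_gauss_four] at h4
  rw [h, aux_gauss_two] at h2
  rw [← h4, ← h2]

lemma aux_int4 {Z : Ω → ℝ} (hZ : MemLp Z 4 μ) : Integrable (fun ω => Z ω ^ 4) μ := by
  have := hZ.integrable_norm_pow (by norm_num)
  refine this.congr (Filter.Eventually.of_forall fun ω => ?_)
  simp only [Real.norm_eq_abs]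
  exact Even.pow_abs (by decide) _

lemma aux_iadd {f g : Ω → ℝ} (hf : Integrable f μ) (hg : Integrable g μ) :
    Integrable (fun ω => f ω + g ω) μ := hf.add hg

lemma aux_isub {f g : Ω → ℝ} (hf : Integrable f μ) (hg : Integrable g μ) :
    Integrable (fun ω => f ω - g ω) μ := hf.sub hg

lemma aux_wick [IsProbabilityMeasure μ] {A B C D : Ω → ℝ} (hA : Measurable A) (hB : Measurable B)
    (hC : Measurable C) (hD : Measurable D)
    (h : ∀ a b c d : ℝ, ∃ v : NNReal,
      μ.map (fun ω => a * A ω + b * B ω + c * C ω + d * D ω) = gaussianReal 0 v) :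
    ∫ ω, A ω * B ω * C ω * D ω ∂μ =
      (∫ ω, A ω * B ω ∂μ) * (∫ ω, C ω * D ω ∂μ) + (∫ ω, A ω * C ω ∂μ) * (∫ ω, B ω * D ω ∂μ)
      + (∫ ω, A ω * D ω ∂μ) * (∫ ω, B ω * C ω ∂μ) := by
  have L : ∀ a b c d : ℝ, MemLp (fun ω => a * A ω + b * B ω + c * C ω + d * D ω) 4 μ := by
    intro a b c d
    obtain ⟨v, hv⟩ := h a b c d
    exact aux_memLp (by fun_prop) hv
  have LA : MemLp A 2 μ := (by simpa using L 1 0 0 0 : MemLp A 4 μ).mono_exponent (by norm_num)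
  have LB : MemLp B 2 μ := (by simpa using L 0 1 0 0 : MemLp B 4 μ).mono_exponent (by norm_num)
  have LC : MemLp C 2 μ := (by simpa using L 0 0 1 0 : MemLp C 4 μ).mono_exponent (by norm_num)
  have LD : MemLp D 2 μ := (by simpa using L 0 0 0 1 : MemLp D 4 μ).mono_exponent (by norm_num)
  have I4 : ∀ a b c d : ℝ, Integrable (fun ω => (a * A ω + b * B ω + c * C ω + d * D ω) ^ 4) μ :=
    fun a b c d => aux_int4 (L a b c d)
  have iAA : Integrable (fun ω => A ω * A ω) μ := LA.integrable_mul LA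
  have iBB : Integrable (fun ω => B ω * B ω) μ := LB.integrable_mul LB
  have iCC : Integrable (fun ω => C ω * C ω) μ := LC.integrable_mul LC
  have iDD : Integrable (fun ω => D ω * D ω) μ := LD.integrable_mul LD
  have iAB : Integrable (fun ω => A ω * B ω) μ := LA.integrable_mul LB
  have iAC : Integrable (fun ω => A ω * C ω) μ := LA.integrable_mul LC
  have iAD : Integrable (fun ω => A ω * D ω) μ := LA.integrable_mul LD
  have iBC : Integrable (fun ω => B ω * C ω) μ := LB.integrable_mul LC
  have iBD : Integrable (fun ω => B ω * D ω) μ := LB.integrable_mul LD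
  have iCD : Integrable (fun ω => C ω * D ω) μ := LC.integrable_mul LD
  have E4 : ∀ a b c d : ℝ, ∫ ω, (a * A ω + b * B ω + c * C ω + d * D ω) ^ 4 ∂μ =
      3 * (a ^ 2 * (∫ ω, A ω * A ω ∂μ) + b ^ 2 * (∫ ω, B ω * B ω ∂μ)
        + c ^ 2 * (∫ ω, C ω * C ω ∂μ) + d ^ 2 * (∫ ω, D ω * D ω ∂μ)
        + 2 * a * b * (∫ ω, A ω * B ω ∂μ) + 2 * a * c * (∫ ω, A ω * C ω ∂μ)
        + 2 * a * d * (∫ ω, A ω * D ω ∂μ) + 2 * b * c * (∫ ω, B ω * C ω ∂μ)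
        + 2 * b * d * (∫ ω, B ω * D ω ∂μ) + 2 * c * d * (∫ ω, C ω * D ω ∂μ)) ^ 2 := by
    intro a b c d
    obtain ⟨v, hv⟩ := h a b c d
    rw [aux_four (by fun_prop) hv]
    congr 2
    have e : (fun ω => (a * A ω + b * B ω + c * C ω + d * D ω) ^ 2) = fun ω =>
        a ^ 2 * (A ω * A ω) + b ^ 2 * (B ω * B ω) + c ^ 2 * (C ω * C ω) + d ^ 2 * (D ω * D ω)
        + 2 * a * b * (A ω * B ω) + 2 * a * c * (A ω * C ω)
        + 2 * a * d * (A ω * D ω) + 2 * b * c * (B ω * C ω)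
        + 2 * b * d * (B ω * D ω) + 2 * c * d * (C ω * D ω) := by
      funext ω; ring
    rw [e]
    have j1 := iAA.const_mul (a ^ 2)
    have j2 := iBB.const_mul (b ^ 2)
    have j3 := iCC.const_mul (c ^ 2)
    have j4 := iDD.const_mul (d ^ 2)
    have j5 := iAB.const_mul (2 * a * b)
    have j6 := iAC.const_mul (2 * a * c)
    have j7 := iAD.const_mul (2 * a * d)
    have j8 := iBC.const_mul (2 * b * c)
    have j9 := iBD.const_mul (2 * b * d)
    have j10 := iCD.const_mul (2 * c * d)
    have k2 := aux_iadd j1 j2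
    have k3 := aux_iadd k2 j3
    have k4 := aux_iadd k3 j4
    have k5 := aux_iadd k4 j5
    have k6 := aux_iadd k5 j6
    have k7 := aux_iadd k6 j7
    have k8 := aux_iadd k7 j8
    have k9 := aux_iadd k8 j9
    rw [integral_add k9 j10, integral_add k8 j9, integral_add k7 j8, integral_add k6 j7,
      integral_add k5 j6, integral_add k4 j5, integral_add k3 j4, integral_add k2 j3,
      integral_add j1 j2]
    simp only [integral_const_mul]
  have e : (fun ω => A ω * B ω * C ω * D ω) = fun ω => (1 / 192 : ℝ) *
      ((1 * A ω + 1 * B ω + 1 * C ω + 1 * D ω) ^ 4 - (1 * A ω + 1 * B ω + 1 * C ω + (-1) * D ω) ^ 4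
      - (1 * A ω + 1 * B ω + (-1) * C ω + 1 * D ω) ^ 4
      + (1 * A ω + 1 * B ω + (-1) * C ω + (-1) * D ω) ^ 4
      - (1 * A ω + (-1) * B ω + 1 * C ω + 1 * D ω) ^ 4
      + (1 * A ω + (-1) * B ω + 1 * C ω + (-1) * D ω) ^ 4
      + (1 * A ω + (-1) * B ω + (-1) * C ω + 1 * D ω) ^ 4
      - (1 * A ω + (-1) * B ω + (-1) * C ω + (-1) * D ω) ^ 4) := by
    funext ω; ring
  rw [e, integral_const_mul]
  have m1 := I4 1 1 1 1
  have m2 := aux_isub m1 (I4 1 1 1 (-1))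
  have m3 := aux_isub m2 (I4 1 1 (-1) 1)
  have m4 := aux_iadd m3 (I4 1 1 (-1) (-1))
  have m5 := aux_isub m4 (I4 1 (-1) 1 1)
  have m6 := aux_iadd m5 (I4 1 (-1) 1 (-1))
  have m7 := aux_iadd m6 (I4 1 (-1) (-1) 1)
  rw [integral_sub m7 (I4 1 (-1) (-1) (-1)), integral_add m6 (I4 1 (-1) (-1) 1),
    integral_add m5 (I4 1 (-1) 1 (-1)), integral_sub m4 (I4 1 (-1) 1 1),
    integral_add m3 (I4 1 1 (-1) (-1)), integral_sub m2 (I4 1 1 (-1) 1),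
    integral_sub m1 (I4 1 1 1 (-1))]
  simp only [E4]
  ring

end

lemma aux_dissection_sum (g : ℝ → ℝ → ℝ) (h0 : ∀ a b, 0 ≤ g a b)
    (hg : ∀ a b c, a ≤ b → b ≤ c → g a b + g b c ≤ g a c) :
    ∀ (n : ℕ) (P : Fin (n + 1) → ℝ), Monotone P →
      ∑ i : Fin n, g (P i.castSucc) (P i.succ) ≤ g (P 0) (P (Fin.last n)) := by
  intro n
  induction n with
  | zero => intro P _; simpa using h0 _ _
  | succ n ih =>
    intro P hP
    rw [Fin.sum_univ_castSucc]
    have := ih (fun i => P i.castSucc) (fun i j hij => hP (by simpa using hij))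
    have h2 := hg (P 0) (P (Fin.last n).castSucc) (P (Fin.last (n + 1)))
      (hP (Fin.zero_le _)) (hP (Fin.le_last _))
    simp only [Fin.succ_castSucc, Fin.castSucc_zero, Fin.succ_last] at this h2 ⊢
    linarith

lemma aux_mono {w : ℝ → ℝ → ℝ → ℝ → ℝ} (hw : IsControl2D w) {a b c d a' b' c' d' : ℝ}
    (h1 : a' ≤ a) (h2 : a ≤ b) (h3 : b ≤ b') (h4 : c' ≤ c) (h5 : c ≤ d) (h6 : d ≤ d') :
    w a b c d ≤ w a' b' c' d' := by
  obtain ⟨h0, hl, hr⟩ := hw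
  have := hl a' a b c d h1 h2 h5
  have := hl a' b b' c d (h1.trans h2) h3 h5
  have hab : a' ≤ b' := by linarith
  have := hr a' b' c' c d hab h4 h5
  have := hr a' b' c' d d' hab (h4.trans h5) h6
  linarith [h0 a' a c d, h0 b b' c d, h0 a' b' c' c, h0 a' b' d d']

lemma aux_sum12 {ρ : ℝ} (hρ : 1 ≤ ρ) (x y z p : Fin 4 → ℝ) (q r : Fin 4 → ℝ)
    (hx : ∀ i, |x i| ^ ρ ≤ p i) (hy : ∀ i, |y i| ^ ρ ≤ q i) (hz : ∀ i, |z i| ^ ρ ≤ r i) :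
    |(∑ i, x i) + (∑ i, y i) + ∑ i, z i| ^ ρ ≤
      12 ^ (ρ - 1) * ((∑ i, p i) + (∑ i, q i) + ∑ i, r i) := by
  have := Real.rpow_sum_le_const_mul_sum_rpow (Finset.univ : Finset ((Fin 4 ⊕ Fin 4) ⊕ Fin 4))
    (Sum.elim (Sum.elim x y) z) hρ
  simp only [Fintype.sum_sum_type, Sum.elim_inl, Sum.elim_inr, Finset.card_univ,
    Fintype.card_sum, Fintype.card_fin] at this
  norm_num at this
  refine le_trans (Real.rpow_le_rpow (abs_nonneg _) ?_ (by linarith)) (this.trans ?_)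
  · refine (abs_add_le _ _).trans (add_le_add ((abs_add_le _ _).trans (add_le_add ?_ ?_)) ?_) <;>
    exact Finset.abs_sum_le_sum_abs _ _
  · gcongr with i _ i _ i _
    exacts [hx i, hy i, hz i]

lemma aux_mul {ρ x y p q : ℝ} (hx : |x| ^ ρ ≤ p) (hy : |y| ^ ρ ≤ q) :
    |x * y| ^ ρ ≤ p * q := by
  rw [abs_mul, Real.mul_rpow (abs_nonneg _) (abs_nonneg _)]
  have h1 := Real.rpow_nonneg (abs_nonneg x) ρ
  have h2 := Real.rpow_nonneg (abs_nonneg y) ρ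
  exact mul_le_mul hx hy h2 (h1.trans hx)

/-- Pointwise bound, for abstract covariance increments. -/
lemma aux_point {ρ : ℝ} (hρ : 1 ≤ ρ) {w : ℝ → ℝ → ℝ → ℝ → ℝ} (hw : IsControl2D w)
    (XX XY YX YY : ℝ → ℝ → ℝ → ℝ → ℝ) (s t : ℝ)
    (hl : ∀ K ∈ [XX, XY, YX, YY], ∀ a b c d e, K a c d e = K a b d e + K b c d e)
    (hr : ∀ K ∈ [XX, XY, YX, YY], ∀ a b c d e, K a b c e = K a b c d + K a b d e)
    (hb : ∀ K ∈ [XX, XY, YX, YY], ∀ a b c d, s ≤ a → a ≤ b → b ≤ t → s ≤ c → c ≤ d → d ≤ t →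
      |K a b c d| ^ ρ ≤ w a b c d)
    (f : ℝ → ℝ → ℝ)
    (hf : ∀ u v, f u v = XY s u s u * XY s v s v + XX s u s v * YY s u s v
      + XY s u s v * YX s u s v)
    {u u' v v' : ℝ} (h1 : s ≤ u) (h2 : u ≤ u') (h3 : u' ≤ t) (h4 : s ≤ v) (h5 : v ≤ v')
    (h6 : v' ≤ t) :
    ‖rectInc f u u' v v'‖ ^ ρ ≤ 12 ^ (ρ - 1) *
      ((w u u' s t + w s t u u') * (w v v' s t + w s t v v')
        + 4 * (w u u' v v' * w s t s t) + 4 * (w u u' s t * w s t v v')) := by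
  have hu' : s ≤ u' := h1.trans h2
  have hv' : s ≤ v' := h4.trans h5
  have hut : u ≤ t := h2.trans h3
  have hvt : v ≤ t := h5.trans h6
  have bb : ∀ K ∈ [XX, XY, YX, YY], ∀ a b c d a' b' c' d', s ≤ a → a ≤ b → b ≤ t → s ≤ c → c ≤ d →
      d ≤ t → a' ≤ a → b ≤ b' → c' ≤ c → d ≤ d' → |K a b c d| ^ ρ ≤ w a' b' c' d' := by
    intro K hK a b c d a' b' c' d' g1 g2 g3 g4 g5 g6 g7 g8 g9 g10
    exact (hb K hK a b c d g1 g2 g3 g4 g5 g6).trans (aux_mono hw g7 g2 g8 g9 g5 g10)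
  have mXX : XX ∈ [XX, XY, YX, YY] := by simp
  have mXY : XY ∈ [XX, XY, YX, YY] := by simp
  have mYX : YX ∈ [XX, XY, YX, YY] := by simp
  have mYY : YY ∈ [XX, XY, YX, YY] := by simp
  have key : ∀ F ∈ [XX, XY, YX, YY], ∀ G ∈ [XX, XY, YX, YY], ∀ i : Fin 4,
      |(![F u u' v v' * G s u' s v', F s u s v * G u u' v v', F u u' s v * G s u' v v',
        G u u' s v' * F s u v v'] i)| ^ ρ ≤
      ![w u u' v v' * w s t s t, w u u' v v' * w s t s t, w u u' s t * w s t v v',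
        w u u' s t * w s t v v'] i := by
    intro F hF G hG i
    fin_cases i
    · exact aux_mul (by apply bb F hF <;> first | assumption | exact le_rfl)
        (by apply bb G hG <;> first | assumption | exact le_rfl)
    · show |F s u s v * G u u' v v'| ^ ρ ≤ w u u' v v' * w s t s t
      rw [mul_comm (F _ _ _ _)]
      exact aux_mul (by apply bb G hG <;> first | assumption | exact le_rfl)
        (by apply bb F hF <;> first | assumption | exact le_rfl)
    · exact aux_mul (by apply bb F hF <;> first | assumption | exact le_rfl)
        (by apply bb G hG <;> first | assumption | exact le_rfl)
    · exact aux_mul (by apply bb G hG <;> first | assumption | exact le_rfl)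
        (by apply bb F hF <;> first | assumption | exact le_rfl)
  have key1 : ∀ i : Fin 4, |(![XY u u' s u' * XY v v' s v', XY u u' s u' * XY s v v v',
      XY s u u u' * XY v v' s v', XY s u u u' * XY s v v v'] i)| ^ ρ ≤
      ![w u u' s t * w v v' s t, w u u' s t * w s t v v', w s t u u' * w v v' s t,
        w s t u u' * w s t v v'] i := by
    intro i
    fin_cases i <;>
    exact aux_mul (by apply bb XY mXY <;> first | assumption | exact le_rfl)
        (by apply bb XY mXY <;> first | assumption | exact le_rfl)
  have fin := aux_sum12 hρ _ _ _ _ _ _ key1 (key XX mXX YY mYY) (key XY mXY YX mYX)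
  rw [Real.norm_eq_abs]
  have hgoal : rectInc f u u' v v' = XY u u' s u' * XY v v' s v' + XY u u' s u' * XY s v v v' +
      XY s u u u' * XY v v' s v' + XY s u u u' * XY s v v v' +
      (XX u u' v v' * YY s u' s v' + XX s u s v * YY u u' v v' + XX u u' s v * YY s u' v v' +
        YY u u' s v' * XX s u v v') +
      (XY u u' v v' * YX s u' s v' + XY s u s v * YX u u' v v' + XY u u' s v * YX s u' v v' +
        YX u u' s v' * XY s u v v') := by
    have q1 : XY s u' s u' = XY s u s u + XY s u u u' + XY u u' s u' := by
      rw [hl XY mXY s u u' s u', hr XY mXY s u s u u']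
    have q2 : XY s v' s v' = XY s v s v + XY s v v v' + XY v v' s v' := by
      rw [hl XY mXY s v v' s v', hr XY mXY s v s v v']
    have q3 : ∀ K ∈ [XX, XY, YX, YY], K s u s v' = K s u s v + K s u v v' :=
      fun K hK => hr K hK _ _ _ _ _
    have q4 : ∀ K ∈ [XX, XY, YX, YY], K s u' s v = K s u s v + K u u' s v :=
      fun K hK => hl K hK _ _ _ _ _
    have q5 : ∀ K ∈ [XX, XY, YX, YY], K u u' s v' = K u u' s v + K u u' v v' :=
      fun K hK => hr K hK _ _ _ _ _
    have q6 : ∀ K ∈ [XX, XY, YX, YY], K s u' v v' = K s u v v' + K u u' v v' :=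
      fun K hK => hl K hK _ _ _ _ _
    have q7 : ∀ K ∈ [XX, XY, YX, YY], K s u' s v' = K s u s v + K s u v v' + K u u' s v
        + K u u' v v' := by
      intro K hK
      rw [hl K hK s u u' s v', q3 K hK, q5 K hK]; ring
    unfold rectInc
    simp only [hf]
    rw [q1, q2, q3 XX mXX, q3 XY mXY, q3 YX mYX, q3 YY mYY, q4 XX mXX, q4 XY mXY, q4 YX mYX,
      q4 YY mYY, q7 XX mXX, q7 XY mXY, q7 YX mYX, q7 YY mYY, q5 YY mYY, q5 YX mYX,
      q6 YY mYY, q6 YX mYX]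
    ring
  rw [hgoal]
  simp only [Fin.sum_univ_four, Matrix.cons_val] at fin
  refine le_trans (le_of_eq ?_) (fin.trans (le_of_eq ?_))
  · rfl
  · ring

lemma aux_sum_final {ρ : ℝ} {w : ℝ → ℝ → ℝ → ℝ → ℝ} (hw : IsControl2D w) (s t : ℝ) (hst : s ≤ t)
    (f : ℝ → ℝ → ℝ)
    (hp : ∀ u u' v v', s ≤ u → u ≤ u' → u' ≤ t → s ≤ v → v ≤ v' → v' ≤ t →
      ‖rectInc f u u' v v'‖ ^ ρ ≤ 12 ^ (ρ - 1) *
      ((w u u' s t + w s t u u') * (w v v' s t + w s t v v')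
        + 4 * (w u u' v v' * w s t s t) + 4 * (w u u' s t * w s t v v')))
    (x : ℝ) (hx : x ∈ varSums2D f ρ s t s t) :
    x ≤ 12 ^ (ρ - 1) * 12 * (w s t s t) ^ 2 := by
  obtain ⟨n, m, P, Q, ⟨hPm, hP0, hP1⟩, ⟨hQm, hQ0, hQ1⟩, rfl⟩ := hx
  have h0 := hw.1
  have S1 : ∀ (k : ℕ) (R : Fin (k + 1) → ℝ), Monotone R → R 0 = s → R (Fin.last k) = t →
      ∀ c d, c ≤ d → ∑ i : Fin k, w (R i.castSucc) (R i.succ) c d ≤ w s t c d := by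
    intro k R hR a b c d hcd
    have := aux_dissection_sum (fun a b => w a b c d) (fun _ _ => h0 _ _ _ _)
      (fun p q r h h' => hw.2.1 p q r c d h h' hcd) k R hR
    simpa [a, b] using this
  have S2 : ∀ (k : ℕ) (R : Fin (k + 1) → ℝ), Monotone R → R 0 = s → R (Fin.last k) = t →
      ∀ c d, c ≤ d → ∑ i : Fin k, w c d (R i.castSucc) (R i.succ) ≤ w c d s t := by
    intro k R hR a b c d hcd
    have := aux_dissection_sum (fun a b => w c d a b) (fun _ _ => h0 _ _ _ _)
      (fun p q r h h' => hw.2.2 c d p q r hcd h h') k R hR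
    simpa [a, b] using this
  have PA : ∀ i, s ≤ P i := fun i => hP0 ▸ hPm (Fin.zero_le _)
  have PB : ∀ i, P i ≤ t := fun i => hP1 ▸ hPm (Fin.le_last _)
  have QA : ∀ i, s ≤ Q i := fun i => hQ0 ▸ hQm (Fin.zero_le _)
  have QB : ∀ i, Q i ≤ t := fun i => hQ1 ▸ hQm (Fin.le_last _)
  have PS : ∀ i : Fin n, P i.castSucc ≤ P i.succ := fun i => hPm i.castSucc_lt_succ.le
  have QS : ∀ i : Fin m, Q i.castSucc ≤ Q i.succ := fun i => hQm i.castSucc_lt_succ.le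
  have T1 : ∑ i : Fin n, ∑ j : Fin m, w (P i.castSucc) (P i.succ) (Q j.castSucc) (Q j.succ)
      ≤ w s t s t :=
    (Finset.sum_le_sum fun i _ => S2 m Q hQm hQ0 hQ1 _ _ (PS i)).trans
      (S1 n P hPm hP0 hP1 s t hst)
  have A1 := S1 n P hPm hP0 hP1 s t hst
  have A2 := S2 n P hPm hP0 hP1 s t hst
  have B1 := S1 m Q hQm hQ0 hQ1 s t hst
  have B2 := S2 m Q hQm hQ0 hQ1 s t hst
  have W0 := h0 s t s t
  calc _ ≤ ∑ i : Fin n, ∑ j : Fin m, 12 ^ (ρ - 1) *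
      ((w (P i.castSucc) (P i.succ) s t + w s t (P i.castSucc) (P i.succ)) *
        (w (Q j.castSucc) (Q j.succ) s t + w s t (Q j.castSucc) (Q j.succ))
        + 4 * (w (P i.castSucc) (P i.succ) (Q j.castSucc) (Q j.succ) * w s t s t)
        + 4 * (w (P i.castSucc) (P i.succ) s t * w s t (Q j.castSucc) (Q j.succ))) :=
        Finset.sum_le_sum fun i _ => Finset.sum_le_sum fun j _ =>
          hp _ _ _ _ (PA _) (PS _) (PB _) (QA _) (QS _) (QB _)
    _ = 12 ^ (ρ - 1) *
      ((∑ i : Fin n, w (P i.castSucc) (P i.succ) s t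
          + ∑ i : Fin n, w s t (P i.castSucc) (P i.succ)) *
        (∑ j : Fin m, w (Q j.castSucc) (Q j.succ) s t
          + ∑ j : Fin m, w s t (Q j.castSucc) (Q j.succ))
        + 4 * ((∑ i : Fin n, ∑ j : Fin m,
            w (P i.castSucc) (P i.succ) (Q j.castSucc) (Q j.succ)) * w s t s t)
        + 4 * ((∑ i : Fin n, w (P i.castSucc) (P i.succ) s t)
            * ∑ j : Fin m, w s t (Q j.castSucc) (Q j.succ))) := by
      rw [← Finset.sum_add_distrib, ← Finset.sum_add_distrib, Finset.sum_mul_sum,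
        Finset.sum_mul_sum]
      simp only [← Finset.mul_sum, Finset.sum_add_distrib, ← Finset.sum_mul]
    _ ≤ 12 ^ (ρ - 1) * ((w s t s t + w s t s t) * (w s t s t + w s t s t)
        + 4 * (w s t s t * w s t s t) + 4 * (w s t s t * w s t s t)) := by
      have N1 : 0 ≤ ∑ j : Fin m, w (Q j.castSucc) (Q j.succ) s t :=
        Finset.sum_nonneg fun _ _ => h0 _ _ _ _
      have N2 : 0 ≤ ∑ j : Fin m, w s t (Q j.castSucc) (Q j.succ) :=
        Finset.sum_nonneg fun _ _ => h0 _ _ _ _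
      gcongr
    _ = _ := by ring

/-- let `(X,Y)` be a 2-dimensional centered Gaussian process on `[0,1]`
whose covariance has finite 2D `ρ`-variation controlled by a 2D control `w`.  Fix
`s < t`.  Then `f(u,v) := E(X_{s,u}Y_{s,u}X_{s,v}Y_{s,v})` vanishes on the edges
`u = s` and `v = s`, has finite 2D `ρ`-variation on `[s,t]²`, and
`|f|^ρ_{ρ-var;[s,t]²} ≤ C(ρ) ω([s,t]²)²`. -/
theorem stmt_12 (ρ : ℝ) (hρ : 1 ≤ ρ) :
    ∃ C : ℝ, 0 < C ∧
    ∀ (Ω : Type) [MeasurableSpace Ω] (μ : Measure Ω), IsProbabilityMeasure μ →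
    ∀ (X Y : ℝ → Ω → ℝ),
      -- `(X,Y)` is a centered jointly Gaussian process
      (∀ (k : ℕ) (c c' : Fin k → ℝ) (ts : Fin k → ℝ),
        ∃ v : NNReal,
          μ.map (fun ω => ∑ i, (c i * X (ts i) ω + c' i * Y (ts i) ω)) = gaussianReal 0 v) →
      (∀ t, Measurable (X t)) → (∀ t, Measurable (Y t)) →
      ∀ (w : ℝ → ℝ → ℝ → ℝ → ℝ), IsControl2D w →
      -- the covariance of `(X,Y)` is of finite `ρ`-variation controlled by `w`
      (∀ Z ∈ ({X, Y} : Set (ℝ → Ω → ℝ)), ∀ W ∈ ({X, Y} : Set (ℝ → Ω → ℝ)),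
        ∀ a b c d : ℝ, 0 ≤ a → a ≤ b → b ≤ 1 → 0 ≤ c → c ≤ d → d ≤ 1 →
          |∫ ω, (Z b ω - Z a ω) * (W d ω - W c ω) ∂μ| ^ ρ ≤ w a b c d) →
      ∀ s t : ℝ, 0 ≤ s → s < t → t ≤ 1 →
      ∀ f : ℝ → ℝ → ℝ,
        f = (fun u v => ∫ ω, (X u ω - X s ω) * (Y u ω - Y s ω) *
              (X v ω - X s ω) * (Y v ω - Y s ω) ∂μ) →
        (∀ v, f s v = 0) ∧ (∀ u, f u s = 0) ∧
        BddAbove (varSums2D f ρ s t s t) ∧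
        (∀ x ∈ varSums2D f ρ s t s t, x ≤ C * (w s t s t) ^ 2) := by
  refine ⟨12 ^ (ρ - 1) * 12, by positivity, ?_⟩
  intro Ω _ μ hμ X Y hG hX hY w hw hcov s t hs hst ht f hf
  have LX : ∀ u, MemLp (X u) 2 μ := by
    intro u
    obtain ⟨v, hv⟩ := hG 1 (fun _ => 1) (fun _ => 0) (fun _ => u)
    simp at hv
    exact (aux_memLp (hX u) hv).mono_exponent (by norm_num)
  have LY : ∀ u, MemLp (Y u) 2 μ := by
    intro u
    obtain ⟨v, hv⟩ := hG 1 (fun _ => 0) (fun _ => 1) (fun _ => u)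
    simp at hv
    exact (aux_memLp (hY u) hv).mono_exponent (by norm_num)
  let K : (ℝ → Ω → ℝ) → (ℝ → Ω → ℝ) → ℝ → ℝ → ℝ → ℝ → ℝ := fun Z W a b c d =>
    ∫ ω, (Z b ω - Z a ω) * (W d ω - W c ω) ∂μ
  have LZ : ∀ Z ∈ ({X, Y} : Set (ℝ → Ω → ℝ)), ∀ u, MemLp (Z u) 2 μ := by
    rintro Z (rfl | rfl)
    exacts [LX, LY]
  have I : ∀ Z ∈ ({X, Y} : Set (ℝ → Ω → ℝ)), ∀ W ∈ ({X, Y} : Set (ℝ → Ω → ℝ)), ∀ a b c d,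
      Integrable (fun ω => (Z b ω - Z a ω) * (W d ω - W c ω)) μ :=
    fun Z hZ W hW a b c d => ((LZ Z hZ b).sub (LZ Z hZ a)).integrable_mul
      ((LZ W hW d).sub (LZ W hW c))
  have Kl : ∀ Z ∈ ({X, Y} : Set (ℝ → Ω → ℝ)), ∀ W ∈ ({X, Y} : Set (ℝ → Ω → ℝ)),
      ∀ a b c d e, K Z W a c d e = K Z W a b d e + K Z W b c d e := by
    intro Z hZ W hW a b c d e
    simp only [K]
    rw [← integral_add (I Z hZ W hW _ _ _ _) (I Z hZ W hW _ _ _ _)]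
    congr 1; funext ω; ring
  have Kr : ∀ Z ∈ ({X, Y} : Set (ℝ → Ω → ℝ)), ∀ W ∈ ({X, Y} : Set (ℝ → Ω → ℝ)),
      ∀ a b c d e, K Z W a b c e = K Z W a b c d + K Z W a b d e := by
    intro Z hZ W hW a b c d e
    simp only [K]
    rw [← integral_add (I Z hZ W hW _ _ _ _) (I Z hZ W hW _ _ _ _)]
    congr 1; funext ω; ring
  have mX : X ∈ ({X, Y} : Set (ℝ → Ω → ℝ)) := by simp
  have mY : Y ∈ ({X, Y} : Set (ℝ → Ω → ℝ)) := by simp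
  have Kin : ∀ L ∈ [K X X, K X Y, K Y X, K Y Y], ∃ Z ∈ ({X, Y} : Set (ℝ → Ω → ℝ)),
      ∃ W ∈ ({X, Y} : Set (ℝ → Ω → ℝ)), L = K Z W := by
    intro L hL
    simp only [List.mem_cons, List.not_mem_nil, or_false] at hL
    rcases hL with h | h | h | h
    exacts [⟨X, mX, X, mX, h⟩, ⟨X, mX, Y, mY, h⟩, ⟨Y, mY, X, mX, h⟩, ⟨Y, mY, Y, mY, h⟩]
  have hwick : ∀ u v, f u v = K X Y s u s u * K X Y s v s v + K X X s u s v * K Y Y s u s v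
      + K X Y s u s v * K Y X s u s v := by
    intro u v
    rw [hf]
    refine aux_wick (A := fun ω => X u ω - X s ω) (B := fun ω => Y u ω - Y s ω)
      (C := fun ω => X v ω - X s ω) (D := fun ω => Y v ω - Y s ω)
      ((hX u).sub (hX s)) ((hY u).sub (hY s)) ((hX v).sub (hX s)) ((hY v).sub (hY s)) ?_
    intro a b c d
    obtain ⟨σ, hσ⟩ := hG 3 ![-(a + c), a, c] ![-(b + d), b, d] ![s, u, v]
    refine ⟨σ, ?_⟩
    rw [← hσ]
    congr 1
    funext ω
    simp [Fin.sum_univ_three]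
    ring
  have hfinal : ∀ x ∈ varSums2D f ρ s t s t, x ≤ 12 ^ (ρ - 1) * 12 * (w s t s t) ^ 2 := by
    apply aux_sum_final hw s t hst.le f
    intro u u' v v' h1 h2 h3 h4 h5 h6
    refine aux_point hρ hw (K X X) (K X Y) (K Y X) (K Y Y) s t ?_ ?_ ?_ f hwick h1 h2 h3 h4 h5 h6
    · intro L hL
      obtain ⟨Z, hZ, W, hW, rfl⟩ := Kin L hL
      exact Kl Z hZ W hW
    · intro L hL
      obtain ⟨Z, hZ, W, hW, rfl⟩ := Kin L hL
      exact Kr Z hZ W hW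
    · intro L hL a b c d g1 g2 g3 g4 g5 g6
      obtain ⟨Z, hZ, W, hW, rfl⟩ := Kin L hL
      exact hcov Z hZ W hW a b c d (hs.trans g1) g2 (g3.trans ht) (hs.trans g4) g5 (g6.trans ht)
  refine ⟨?_, ?_, ⟨_, hfinal⟩, hfinal⟩
  · intro v; rw [hf]; simp
  · intro u; rw [hf]; simp
end

section
/- Let X = (X¹,…,X^d) be a centered Gaussian process with independent components and piecewise linear sample paths, covariance of finite 2D ρ-variation (ρ ∈ [1,2)) controlled by ω, and let X^{i,j}_{s,t} := ∫_s^t X^i_{s,u} dX^j_u be the second iterated integral. Then for i ≠ j and all s<t, s'<t': E(X^{i,j}_{s,t} X^{i,j}_{s',t'}) ≤ C(ρ) ω([s,t]×[s',t'])^{2/ρ}; in particular E(|X^{i,j}_{s,t}|²) ≤ C ω([s,t]²)^{2/ρ}. -/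
open MeasureTheory ProbabilityTheory

/-- The second iterated integral `∫_s^t X^i_{s,u} dX^j_u`, defined pathwise (for
piecewise linear sample paths the integrator acts through the a.e. derivative). -/
noncomputable def iterInt2 {Ω : Type*} {d : ℕ} (X : Fin d → ℝ → Ω → ℝ)
    (i j : Fin d) (s t : ℝ) (ω : Ω) : ℝ :=
  ∫ u in s..t, (X i u ω - X i s ω) * deriv (fun r => X j r ω) u

/-- the skip map on indices -/
def skipIdx (j k : ℕ) : ℕ := if k < j then k else k + 1

lemma skipIdx_mono (j : ℕ) : Monotone (skipIdx j) := by
  intro a b h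
  unfold skipIdx
  split_ifs <;> omega

lemma young_skip {T : Type*} (G : T → T → T → T → ℝ)
    (h1 : ∀ a b c x y, G a c x y = G a b x y + G b c x y)
    (h2 : ∀ a b x y z, G a b x z = G a b x y + G a b y z)
    (m u : ℕ → T) (j : ℕ) (n : ℕ) :
    ∑ k ∈ Finset.range (j + 2 + n), G (m 0) (m (k + 1)) (u k) (u (k + 1)) =
    ∑ k ∈ Finset.range (j + 1 + n), G (m 0) (m (skipIdx (j + 1) (k + 1)))
        (u (skipIdx (j + 1) k)) (u (skipIdx (j + 1) (k + 1)))
      - G (m (j + 1)) (m (j + 2)) (u j) (u (j + 1)) := by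
  induction n with
  | zero =>
    rw [add_zero, add_zero, Finset.sum_range_succ, Finset.sum_range_succ, Finset.sum_range_succ]
    have : ∑ k ∈ Finset.range j, G (m 0) (m (skipIdx (j + 1) (k + 1)))
        (u (skipIdx (j + 1) k)) (u (skipIdx (j + 1) (k + 1))) =
        ∑ k ∈ Finset.range j, G (m 0) (m (k + 1)) (u k) (u (k + 1)) := by
      apply Finset.sum_congr rfl
      intro k hk
      rw [Finset.mem_range] at hk
      have e1 : skipIdx (j + 1) (k + 1) = k + 1 := by unfold skipIdx; rw [if_pos (by omega)]
      have e2 : skipIdx (j + 1) k = k := by unfold skipIdx; rw [if_pos (by omega)]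
      rw [e1, e2]
    rw [this]
    have e1 : skipIdx (j + 1) (j + 1) = j + 2 := by unfold skipIdx; rw [if_neg (by omega)]
    have e2 : skipIdx (j + 1) j = j := by unfold skipIdx; rw [if_pos (by omega)]
    rw [e1, e2, h2 (m 0) (m (j + 2)) (u j) (u (j + 1)) (u (j + 2)),
      h1 (m 0) (m (j + 1)) (m (j + 2)) (u j) (u (j + 1))]
    ring
  | succ n ih =>
    have a1 : j + 2 + (n + 1) = (j + 2 + n) + 1 := by ring
    have a2 : j + 1 + (n + 1) = (j + 1 + n) + 1 := by ring
    rw [a1, a2, Finset.sum_range_succ, ih, Finset.sum_range_succ _ (j + 1 + n)]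
    have e1 : skipIdx (j + 1) (j + 1 + n + 1) = j + 2 + n + 1 := by
      unfold skipIdx; rw [if_neg (by omega)]; omega
    have e2 : skipIdx (j + 1) (j + 1 + n) = j + 2 + n := by
      unfold skipIdx; rw [if_neg (by omega)]; omega
    rw [e1, e2]
    ring

lemma superadd_sum {T : Type*} [Preorder T] (α : T → T → ℝ) (h0 : ∀ a b, 0 ≤ α a b)
    (h : ∀ a b c, a ≤ b → b ≤ c → α a b + α b c ≤ α a c) (m : ℕ → T) (hm : Monotone m) (n : ℕ) :
    ∑ k ∈ Finset.range n, α (m k) (m (k + 1)) ≤ α (m 0) (m n) := by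
  induction n with
  | zero => simpa using h0 _ _
  | succ n ih =>
    rw [Finset.sum_range_succ]
    have := h (m 0) (m n) (m (n + 1)) (hm (by omega)) (hm (by omega))
    linarith

lemma exists_small (n : ℕ) (hn : 0 < n) (x y : ℕ → ℝ) (A B : ℝ) (hx : ∀ k, 0 ≤ x k)
    (hy : ∀ k, 0 ≤ y k) (hA : ∑ k ∈ Finset.range n, x k ≤ A)
    (hB : ∑ k ∈ Finset.range n, y k ≤ B) :
    ∃ j < n, x j * y j ≤ A * B / (n : ℝ) ^ 2 := by
  by_contra! hcon
  have hn' : (0 : ℝ) < n := by exact_mod_cast hn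
  have hA0 : 0 ≤ A := (Finset.sum_nonneg (fun k _ => hx k)).trans hA
  have hB0 : 0 ≤ B := (Finset.sum_nonneg (fun k _ => hy k)).trans hB
  have hs : ∑ k ∈ Finset.range n, √(A * B) / n < ∑ k ∈ Finset.range n, √(x k) * √(y k) := by
    apply Finset.sum_lt_sum_of_nonempty (by simpa using hn.ne')
    intro k hk
    have := hcon k (Finset.mem_range.1 hk)
    rw [← Real.sqrt_mul (hx k)]
    calc √(A * B) / n = √(A * B / (n : ℝ) ^ 2) := by
          rw [Real.sqrt_div (by positivity), Real.sqrt_sq hn'.le]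
      _ < _ := Real.sqrt_lt_sqrt (by positivity) this
  have h2 := Real.sum_sqrt_mul_sqrt_le (Finset.range n) hx hy
  have h3 : √(∑ k ∈ Finset.range n, x k) * √(∑ k ∈ Finset.range n, y k) ≤ √A * √B := by
    gcongr
  rw [← Real.sqrt_mul hA0] at h3
  simp only [Finset.sum_const, Finset.card_range, nsmul_eq_mul] at hs
  rw [mul_div_cancel₀ _ hn'.ne'] at hs
  linarith

lemma young1D {T : Type*} [Preorder T] (ρ : ℝ) (hρ1 : 1 ≤ ρ) (G : T → T → T → T → ℝ)
    (h1 : ∀ a b c x y, G a c x y = G a b x y + G b c x y)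
    (h2 : ∀ a b x y z, G a b x z = G a b x y + G a b y z)
    (α β : T → T → ℝ) (hα0 : ∀ a b, 0 ≤ α a b) (hβ0 : ∀ a b, 0 ≤ β a b)
    (hα : ∀ a b c, a ≤ b → b ≤ c → α a b + α b c ≤ α a c)
    (hβ : ∀ a b c, a ≤ b → b ≤ c → β a b + β b c ≤ β a c)
    (K : ℝ) (hK : 0 ≤ K)
    (hG : ∀ a b x y, a ≤ b → x ≤ y → |G a b x y| ≤ K * (α a b * β x y) ^ (1 / ρ)) (n : ℕ) :
    ∀ m u : ℕ → T, Monotone m → Monotone u →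
    |∑ k ∈ Finset.range n, G (m 0) (m (k + 1)) (u k) (u (k + 1))| ≤
      (1 + ∑ r ∈ Finset.range n, 1 / (r : ℝ) ^ (2 / ρ)) *
        (K * (α (m 0) (m n) * β (u 0) (u n)) ^ (1 / ρ)) := by
  induction n with
  | zero =>
    intro m u hm hu
    have := mul_nonneg (hα0 (m 0) (m 0)) (hβ0 (u 0) (u 0))
    simp only [Finset.range_zero, Finset.sum_empty, abs_zero]
    positivity
  | succ n ih =>
    intro m u hm hu
    rcases Nat.eq_zero_or_pos n with rfl | hn
    · have hz : (0 : ℝ) ^ (2 / ρ) = 0 := Real.zero_rpow (by positivity)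
      simpa [hz] using hG (m 0) (m 1) (u 0) (u 1) (hm (by omega)) (hu (by omega))
    · have hn' : (0 : ℝ) < n := by exact_mod_cast hn
      set A := α (m 0) (m (n + 1)) with hA
      set B := β (u 0) (u (n + 1)) with hB
      have hA0 : 0 ≤ A := hα0 _ _
      have hB0 : 0 ≤ B := hβ0 _ _
      have sA : ∑ k ∈ Finset.range n, α (m (k + 1)) (m (k + 2)) ≤ A := by
        have := superadd_sum α hα0 hα m hm (n + 1)
        rw [Finset.sum_range_succ'] at this
        have := hα0 (m 0) (m (0 + 1))
        linarith
      have sB : ∑ k ∈ Finset.range n, β (u k) (u (k + 1)) ≤ B := by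
        have := superadd_sum β hβ0 hβ u hu (n + 1)
        rw [Finset.sum_range_succ] at this
        have := hβ0 (u n) (u (n + 1))
        linarith
      obtain ⟨j, hj, hjs⟩ := exists_small n hn (fun k => α (m (k + 1)) (m (k + 2)))
        (fun k => β (u k) (u (k + 1))) A B (fun _ => hα0 _ _) (fun _ => hβ0 _ _) sA sB
      obtain ⟨l, rfl⟩ : ∃ l, n = j + 1 + l := ⟨n - (j + 1), by omega⟩
      have hsk := young_skip G h1 h2 m u j l
      have ih' := ih (m ∘ skipIdx (j + 1)) (u ∘ skipIdx (j + 1)) (hm.comp (skipIdx_mono _))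
        (hu.comp (skipIdx_mono _))
      have e0 : skipIdx (j + 1) 0 = 0 := by unfold skipIdx; rw [if_pos (by omega)]
      have e1 : skipIdx (j + 1) (j + 1 + l) = j + 1 + l + 1 := by
        unfold skipIdx; rw [if_neg (by omega)]
      simp only [Function.comp, e0, e1] at ih'
      rw [show j + 2 + l = j + 1 + l + 1 by ring] at hsk
      rw [hsk, Finset.sum_range_succ _ (j + 1 + l)]
      have hg := hG (m (j + 1)) (m (j + 2)) (u j) (u (j + 1)) (hm (by omega)) (hu (by omega))
      have hg2 : (α (m (j + 1)) (m (j + 2)) * β (u j) (u (j + 1))) ^ (1 / ρ) ≤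
          1 / ((j + 1 + l : ℕ) : ℝ) ^ (2 / ρ) * (A * B) ^ (1 / ρ) := by
        calc _ ≤ (A * B / ((j + 1 + l : ℕ) : ℝ) ^ 2) ^ (1 / ρ) := by
              apply Real.rpow_le_rpow (mul_nonneg (hα0 _ _) (hβ0 _ _)) hjs (by positivity)
          _ = _ := by
              rw [Real.div_rpow (by positivity) (by positivity), ← Real.rpow_natCast,
                ← Real.rpow_mul hn'.le]
              rw [show ((2 : ℕ) : ℝ) * (1 / ρ) = 2 / ρ by push_cast; ring]
              ring
      have hg3 := mul_le_mul_of_nonneg_left hg2 hK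
      refine (abs_sub _ _).trans ?_
      rw [← hA, ← hB] at ih'
      calc _ ≤ _ + _ := add_le_add ih' (hg.trans hg3)
        _ = _ := by ring

lemma young2D {T : Type*} [Preorder T] (ρ : ℝ) (hρ1 : 1 ≤ ρ) (Z : ℝ) 
    (hZ : ∀ n : ℕ, 1 + ∑ r ∈ Finset.range n, 1 / (r : ℝ) ^ (2 / ρ) ≤ Z)
    (F G : T → T → T → T → ℝ)
    (hF1 : ∀ a b c x y, F a c x y = F a b x y + F b c x y)
    (hF2 : ∀ a b x y z, F a b x z = F a b x y + F a b y z)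
    (hG1 : ∀ a b c x y, G a c x y = G a b x y + G b c x y)
    (hG2 : ∀ a b x y z, G a b x z = G a b x y + G a b y z)
    (w : T → T → T → T → ℝ) (w0 : ∀ a b x y, 0 ≤ w a b x y)
    (hw1 : ∀ a b c x y, a ≤ b → b ≤ c → x ≤ y → w a b x y + w b c x y ≤ w a c x y)
    (hw2 : ∀ a b x y z, a ≤ b → x ≤ y → y ≤ z → w a b x y + w a b y z ≤ w a b x z)
    (hF : ∀ a b x y, a ≤ b → x ≤ y → |F a b x y| ≤ (w a b x y) ^ (1 / ρ))
    (hG : ∀ a b x y, a ≤ b → x ≤ y → |G a b x y| ≤ (w a b x y) ^ (1 / ρ))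
    (n n' : ℕ) (m u m' u' : ℕ → T) (hm : Monotone m) (hu : Monotone u) (hm' : Monotone m')
    (hu' : Monotone u') :
    |∑ l ∈ Finset.range n', ∑ k ∈ Finset.range n,
      F (m 0) (m (k + 1)) (m' 0) (m' (l + 1)) * G (u k) (u (k + 1)) (u' l) (u' (l + 1))| ≤
      Z * (Z * (w (m 0) (m n) (m' 0) (m' n') * w (u 0) (u n) (u' 0) (u' n')) ^ (1 / ρ)) := by
  have hZ0 : 0 ≤ Z := by
    have := hZ 0
    simp at this
    linarith
  have key : ∀ a b x y, a ≤ b → x ≤ y →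
      |∑ k ∈ Finset.range n, F (m 0) (m (k + 1)) a b * G (u k) (u (k + 1)) x y| ≤
      Z * (w (m 0) (m n) a b * w (u 0) (u n) x y) ^ (1 / ρ) := by
    intro a b x y hab hxy
    have h := young1D ρ hρ1 (fun p q r s => F p q a b * G r s x y)
      (by intro p q r s t; simp only [hF1 p q r, add_mul])
      (by intro p q r s t; simp only [hG1 r s t, mul_add])
      (fun p q => w p q a b) (fun p q => w p q x y)
      (fun _ _ => w0 _ _ _ _) (fun _ _ => w0 _ _ _ _)
      (fun p q r h h' => hw1 _ _ _ _ _ h h' hab)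
      (fun p q r h h' => hw1 _ _ _ _ _ h h' hxy) 1 zero_le_one
      (by
        intro p q r s hpq hrs
        rw [abs_mul, one_mul, Real.mul_rpow (w0 _ _ _ _) (w0 _ _ _ _)]
        exact mul_le_mul (hF _ _ _ _ hpq hab) (hG _ _ _ _ hrs hxy) (abs_nonneg _)
          (Real.rpow_nonneg (w0 _ _ _ _) _)) n m u hm hu
    rw [one_mul] at h
    exact h.trans (mul_le_mul_of_nonneg_right (hZ n)
      (Real.rpow_nonneg (mul_nonneg (w0 _ _ _ _) (w0 _ _ _ _)) _))
  have h := young1D ρ hρ1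
    (fun a b x y => ∑ k ∈ Finset.range n, F (m 0) (m (k + 1)) a b * G (u k) (u (k + 1)) x y)
    (by intro a b c x y; simp only [hF2 _ _ a b c, add_mul, Finset.sum_add_distrib])
    (by intro a b x y z; simp only [hG2 _ _ x y z, mul_add, Finset.sum_add_distrib])
    (fun a b => w (m 0) (m n) a b) (fun a b => w (u 0) (u n) a b)
    (fun _ _ => w0 _ _ _ _) (fun _ _ => w0 _ _ _ _)
    (fun a b c h h' => hw2 _ _ _ _ _ (hm (by omega)) h h')
    (fun a b c h h' => hw2 _ _ _ _ _ (hu (by omega)) h h') Z hZ0 key n' m' u' hm' hu'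
  refine h.trans (mul_le_mul_of_nonneg_right (hZ n') ?_)
  exact mul_nonneg hZ0 (Real.rpow_nonneg (mul_nonneg (w0 _ _ _ _) (w0 _ _ _ _)) _)

/-- the grid point: `P k` clamped to `[s,t]` -/
noncomputable def gridPt {n : ℕ} (P : Fin (n + 1) → ℝ) (s t : ℝ) (k : ℕ) : ℝ :=
  max s (min t (P ⟨min k n, by omega⟩))

/-- tags: `s`, then midpoints of grid cells -/
noncomputable def tagPt {n : ℕ} (P : Fin (n + 1) → ℝ) (s t : ℝ) : ℕ → ℝ
  | 0 => s
  | k + 1 => (gridPt P s t k + gridPt P s t (k + 1)) / 2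

lemma gridPt_mono {n : ℕ} (P : Fin (n + 1) → ℝ) (hP : Monotone P) (s t : ℝ) :
    Monotone (gridPt P s t) := by
  intro a b h
  unfold gridPt
  apply max_le_max le_rfl (min_le_min le_rfl (hP _))
  rw [Fin.mk_le_mk]
  omega

lemma gridPt_ge {n : ℕ} (P : Fin (n + 1) → ℝ) (s t : ℝ) (k : ℕ) : s ≤ gridPt P s t k :=
  le_max_left _ _

lemma gridPt_le {n : ℕ} (P : Fin (n + 1) → ℝ) (s t : ℝ) (hst : s ≤ t) (k : ℕ) :
    gridPt P s t k ≤ t :=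
  max_le hst (min_le_left _ _)

lemma gridPt_zero {n : ℕ} (P : Fin (n + 1) → ℝ) (hP : P 0 = 0) (s t : ℝ) (hs : 0 ≤ s) :
    gridPt P s t 0 = s := by
  unfold gridPt
  apply max_eq_left
  apply (min_le_right _ _).trans
  have : (⟨min 0 n, by omega⟩ : Fin (n + 1)) = 0 := by ext; simp
  rw [this, hP]
  exact hs

lemma gridPt_last {n : ℕ} (P : Fin (n + 1) → ℝ) (hP : P (Fin.last n) = 1) (s t : ℝ)
    (hst : s ≤ t) (ht : t ≤ 1) : gridPt P s t n = t := by
  unfold gridPt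
  have : (⟨min n n, by omega⟩ : Fin (n + 1)) = Fin.last n := by ext; simp
  rw [this, hP, min_eq_left ht, max_eq_right hst]

lemma tagPt_mono {n : ℕ} (P : Fin (n + 1) → ℝ) (hP : Monotone P) (s t : ℝ) :
    Monotone (tagPt P s t) := by
  apply monotone_nat_of_le_succ
  intro k
  have hg := gridPt_mono P hP s t
  cases k with
  | zero =>
    have h1 := gridPt_ge P s t 0
    have h2 := gridPt_ge P s t 1
    simp only [tagPt, zero_add]
    linarith
  | succ k =>
    have h1 := hg (show k ≤ k + 1 by omega)
    have h2 := hg (show k + 1 ≤ k + 1 + 1 by omega)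
    simp only [tagPt]
    linarith

lemma tagPt_ge {n : ℕ} (P : Fin (n + 1) → ℝ) (hP : Monotone P) (s t : ℝ) (k : ℕ) :
    s ≤ tagPt P s t k := tagPt_mono P hP s t (Nat.zero_le k)

lemma tagPt_le {n : ℕ} (P : Fin (n + 1) → ℝ) (s t : ℝ) (hst : s ≤ t) (k : ℕ) :
    tagPt P s t k ≤ t := by
  cases k with
  | zero => exact hst
  | succ k =>
    have h1 := gridPt_le P s t hst k
    have h2 := gridPt_le P s t hst (k + 1)
    simp only [tagPt]
    linarith

lemma affine_piece (f g : ℝ → ℝ) (a b c : ℝ) (hab : a ≤ b) (p q p' q' : ℝ)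
    (hf : a < b → ∀ r, a ≤ r → r ≤ b → f r = p + q * r)
    (hg : a < b → ∀ r, a ≤ r → r ≤ b → g r = p' + q' * r) :
    IntervalIntegrable (fun r => (f r - c) * deriv g r) MeasureTheory.volume a b ∧
    ∫ r in a..b, (f r - c) * deriv g r = (f ((a + b) / 2) - c) * (g b - g a) := by
  rcases hab.eq_or_lt with rfl | hlt
  · simp
  have hf := hf hlt
  have hg := hg hlt
  have hd : ∀ r ∈ Set.Ioo a b, (p + q * r - c) * q' = (f r - c) * deriv g r := by
    intro r hr
    have : g =ᶠ[nhds r] fun r => p' + q' * r := by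
      filter_upwards [Ioo_mem_nhds hr.1 hr.2] with x hx using hg x hx.1.le hx.2.le
    rw [this.deriv_eq, hf r hr.1.le hr.2.le]
    congr 1
    have : HasDerivAt (fun r => p' + q' * r) (q' * 1) r :=
      ((hasDerivAt_id r).const_mul q').const_add p'
    rw [this.deriv, mul_one]
  have hae : ∀ᵐ r ∂MeasureTheory.volume, r ∈ Set.uIoc a b →
      (p + q * r - c) * q' = (f r - c) * deriv g r := by
    have hb : ∀ᵐ r ∂(MeasureTheory.volume : MeasureTheory.Measure ℝ), r ≠ b := by
      simp [MeasureTheory.ae_iff]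
    filter_upwards [hb] with r hr hr'
    rw [Set.uIoc_of_le hab] at hr'
    exact hd r ⟨hr'.1, lt_of_le_of_ne hr'.2 hr⟩
  have hI : IntervalIntegrable (fun r => (p + q * r - c) * q') MeasureTheory.volume a b := by
    apply Continuous.intervalIntegrable
    fun_prop
  constructor
  · refine hI.congr_ae ?_
    rw [Filter.EventuallyEq, MeasureTheory.ae_restrict_iff' measurableSet_uIoc]
    exact hae
  · rw [← intervalIntegral.integral_congr_ae hae, hf _ (by linarith) (by linarith), hg b hab le_rfl,
      hg a le_rfl hab]
    have : ∀ r, HasDerivAt (fun r => ((p - c) * r + q * r ^ 2 / 2) * q') ((p + q * r - c) * q') r := by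
      intro r
      have h1 := ((((hasDerivAt_id r).const_mul (p - c)).add
        ((((hasDerivAt_id r).pow 2).const_mul q).div_const 2)).mul_const q')
      refine h1.congr_deriv ?_
      simp
      left
      ring
    rw [intervalIntegral.integral_eq_sub_of_hasDerivAt (fun r _ => this r) hI]
    ring

lemma pathwise {n : ℕ} (P : Fin (n + 1) → ℝ) (hP : IsDissection 0 1 P) (f g : ℝ → ℝ)
    (hf : ∀ (k : Fin n) (t : ℝ), P k.castSucc ≤ t → t ≤ P k.succ →
        f t = f (P k.castSucc) +
          ((t - P k.castSucc) / (P k.succ - P k.castSucc)) * (f (P k.succ) - f (P k.castSucc)))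
    (hg : ∀ (k : Fin n) (t : ℝ), P k.castSucc ≤ t → t ≤ P k.succ →
        g t = g (P k.castSucc) +
          ((t - P k.castSucc) / (P k.succ - P k.castSucc)) * (g (P k.succ) - g (P k.castSucc)))
    (s t : ℝ) (hs : 0 ≤ s) (hst : s ≤ t) (ht : t ≤ 1) :
    ∫ r in s..t, (f r - f s) * deriv g r =
      ∑ k ∈ Finset.range n, (f (tagPt P s t (k + 1)) - f (tagPt P s t 0)) *
        (g (gridPt P s t (k + 1)) - g (gridPt P s t k)) := by
  have key : ∀ k < n, IntervalIntegrable (fun r => (f r - f s) * deriv g r) MeasureTheory.volume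
        (gridPt P s t k) (gridPt P s t (k + 1)) ∧
      ∫ r in (gridPt P s t k)..(gridPt P s t (k + 1)), (f r - f s) * deriv g r =
        (f ((gridPt P s t k + gridPt P s t (k + 1)) / 2) - f s) *
          (g (gridPt P s t (k + 1)) - g (gridPt P s t k)) := by
    intro k hk
    have e1 : (⟨min k n, by omega⟩ : Fin (n + 1)) = Fin.castSucc ⟨k, hk⟩ := by
      ext; simp; omega
    have e2 : (⟨min (k + 1) n, by omega⟩ : Fin (n + 1)) = Fin.succ ⟨k, hk⟩ := by
      ext; simp; omega
    have sub : gridPt P s t k < gridPt P s t (k + 1) → P (Fin.castSucc ⟨k, hk⟩) ≤ gridPt P s t k ∧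
        gridPt P s t (k + 1) ≤ P (Fin.succ ⟨k, hk⟩) := by
      unfold gridPt
      rw [e1, e2]
      intro h
      generalize P (Fin.castSucc ⟨k, hk⟩) = x at *
      generalize P (Fin.succ ⟨k, hk⟩) = y at *
      rcases le_total t x with h1 | h1 <;> rcases le_total t y with h2 | h2 <;>
      rcases le_total s x with h3 | h3 <;> rcases le_total s y with h4 | h4 <;>
      simp_all <;> grind
    set x := P (Fin.castSucc ⟨k, hk⟩) with hx
    set y := P (Fin.succ ⟨k, hk⟩) with hy
    refine affine_piece f g _ _ _ (gridPt_mono P hP.1 s t (by omega))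
      (f x - x / (y - x) * (f y - f x)) ((f y - f x) / (y - x))
      (g x - x / (y - x) * (g y - g x)) ((g y - g x) / (y - x)) ?_ ?_
    · intro h r h1 h2
      rw [hf ⟨k, hk⟩ r ((sub h).1.trans h1) (h2.trans (sub h).2), ← hx, ← hy]
      ring
    · intro h r h1 h2
      rw [hg ⟨k, hk⟩ r ((sub h).1.trans h1) (h2.trans (sub h).2), ← hx, ← hy]
      ring
  have := intervalIntegral.sum_integral_adjacent_intervals (fun k hk => (key k hk).1)
  rw [gridPt_zero P hP.2.1 s t hs, gridPt_last P hP.2.2 s t hst ht] at this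
  rw [← this]
  apply Finset.sum_congr rfl
  intro k hk
  rw [(key k (Finset.mem_range.1 hk)).2]
  simp only [tagPt]

/-- let `X = (X¹,…,X^d)` be a centered Gaussian process with independent
components and piecewise linear sample paths, whose covariance has finite 2D
`ρ`-variation (`ρ ∈ [1,2)`) controlled by `w`.  Then for `i ≠ j`,
`E(𝐗^{i,j}_{s,t} 𝐗^{i,j}_{s',t'}) ≤ C(ρ) w([s,t]×[s',t'])^{2/ρ}`, and in particular
`E(|𝐗^{i,j}_{s,t}|²) ≤ C w([s,t]²)^{2/ρ}`. -/
theorem stmt_13 (ρ : ℝ) (hρ1 : 1 ≤ ρ) (hρ2 : ρ < 2) :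
    ∃ C : ℝ, 0 < C ∧
    ∀ (Ω : Type) [MeasurableSpace Ω] (μ : Measure Ω), IsProbabilityMeasure μ →
    ∀ (d : ℕ) (X : Fin d → ℝ → Ω → ℝ),
      -- centered jointly Gaussian
      (∀ (k : ℕ) (c : Fin k → ℝ) (idx : Fin k → Fin d) (ts : Fin k → ℝ),
        ∃ v : NNReal, μ.map (fun ω => ∑ i, c i * X (idx i) (ts i) ω) = gaussianReal 0 v) →
      (∀ i t, Measurable (X i t)) →
      -- independent components
      ProbabilityTheory.iIndep
        (fun i : Fin d => ⨆ t ∈ Set.Icc (0:ℝ) 1, MeasurableSpace.comap (X i t) inferInstance) μ →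
      -- piecewise linear sample paths
      ∀ (n : ℕ) (P : Fin (n + 1) → ℝ), IsDissection 0 1 P → StrictMono P →
      (∀ (i : Fin d) (k : Fin n) (t : ℝ), P k.castSucc ≤ t → t ≤ P k.succ → ∀ ω,
        X i t ω = X i (P k.castSucc) ω +
          ((t - P k.castSucc) / (P k.succ - P k.castSucc)) *
            (X i (P k.succ) ω - X i (P k.castSucc) ω)) →
      -- covariance of finite ρ-variation controlled by `w`
      ∀ (w : ℝ → ℝ → ℝ → ℝ → ℝ), IsControl2D w →
      (∀ (i : Fin d) (a b c e : ℝ), 0 ≤ a → a ≤ b → b ≤ 1 → 0 ≤ c → c ≤ e → e ≤ 1 →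
        |∫ ω, (X i b ω - X i a ω) * (X i e ω - X i c ω) ∂μ| ^ ρ ≤ w a b c e) →
      ∀ i j : Fin d, i ≠ j →
      ∀ s t s' t' : ℝ, 0 ≤ s → s < t → t ≤ 1 → 0 ≤ s' → s' < t' → t' ≤ 1 →
        (∫ ω, iterInt2 X i j s t ω * iterInt2 X i j s' t' ω ∂μ) ≤
          C * (w s t s' t') ^ (2 / ρ) ∧
        (∫ ω, (iterInt2 X i j s t ω) ^ 2 ∂μ) ≤ C * (w s t s t) ^ (2 / ρ) := by
  have hρ0 : 0 < ρ := by linarith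
  have hsum : Summable (fun r : ℕ => 1 / (r : ℝ) ^ (2 / ρ)) := by
    rw [Real.summable_one_div_nat_rpow, lt_div_iff₀ hρ0]
    linarith
  set Z : ℝ := 1 + ∑' r : ℕ, 1 / (r : ℝ) ^ (2 / ρ) with hZdef
  have hZ : ∀ n : ℕ, 1 + ∑ r ∈ Finset.range n, 1 / (r : ℝ) ^ (2 / ρ) ≤ Z := by
    intro n
    have := hsum.sum_le_tsum (Finset.range n) (fun r _ => by positivity)
    linarith
  have hZ0 : 0 < Z := by
    have := hZ 0
    simp at this
    linarith
  refine ⟨Z * Z, by positivity, ?_⟩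
  intro Ω _ μ hμ d X hgauss hmeas hind n P hP hPs hlin w hw hcov i j hij
  have hmem : ∀ i t, MemLp (X i t) 2 μ := by
    intro i t
    obtain ⟨v, hv⟩ := hgauss 1 (fun _ => 1) (fun _ => i) (fun _ => t)
    simp at hv
    have h := memLp_id_gaussianReal' (μ := 0) (v := v) 2 (by simp)
    rw [← hv, memLp_map_measure_iff aestronglyMeasurable_id (hmeas i t).aemeasurable] at h
    exact h
  have main : ∀ s t s' t' : ℝ, 0 ≤ s → s < t → t ≤ 1 → 0 ≤ s' → s' < t' → t' ≤ 1 →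
        (∫ ω, iterInt2 X i j s t ω * iterInt2 X i j s' t' ω ∂μ) ≤
          Z * Z * (w s t s' t') ^ (2 / ρ) := by
    intro s t s' t' hs hst ht hs' hst' ht'
    have hI : ∀ s t : ℝ, 0 ≤ s → s < t → t ≤ 1 → ∀ ω, iterInt2 X i j s t ω =
        ∑ k ∈ Finset.range n, (X i (tagPt P s t (k + 1)) ω - X i (tagPt P s t 0) ω) *
        (X j (gridPt P s t (k + 1)) ω - X j (gridPt P s t k) ω) := by
      intro s t hs hst ht ω
      exact pathwise P hP (fun r => X i r ω) (fun r => X j r ω)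
        (fun k t h1 h2 => hlin i k t h1 h2 ω) (fun k t h1 h2 => hlin j k t h1 h2 ω)
        s t hs hst.le ht
    have gI : ∀ s t : ℝ, 0 ≤ s → s < t → t ≤ 1 → ∀ k, gridPt P s t k ∈ Set.Icc (0 : ℝ) 1 :=
      fun s t hs hst ht k => ⟨hs.trans (gridPt_ge P s t k), (gridPt_le P s t hst.le k).trans ht⟩
    have tI : ∀ s t : ℝ, 0 ≤ s → s < t → t ≤ 1 → ∀ k, tagPt P s t k ∈ Set.Icc (0 : ℝ) 1 :=
      fun s t hs hst ht k =>
        ⟨hs.trans (tagPt_ge P hP.1 s t k), (tagPt_le P s t hst.le k).trans ht⟩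
    let u : ℕ → Set.Icc (0 : ℝ) 1 := fun k => ⟨gridPt P s t k, gI s t hs hst ht k⟩
    let u' : ℕ → Set.Icc (0 : ℝ) 1 := fun k => ⟨gridPt P s' t' k, gI s' t' hs' hst' ht' k⟩
    let m : ℕ → Set.Icc (0 : ℝ) 1 := fun k => ⟨tagPt P s t k, tI s t hs hst ht k⟩
    let m' : ℕ → Set.Icc (0 : ℝ) 1 := fun k => ⟨tagPt P s' t' k, tI s' t' hs' hst' ht' k⟩
    let R : Fin d → Set.Icc (0 : ℝ) 1 → Set.Icc (0 : ℝ) 1 → Set.Icc (0 : ℝ) 1 →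
        Set.Icc (0 : ℝ) 1 → ℝ := fun i a b x y =>
      ∫ ω, (X i b ω - X i a ω) * (X i y ω - X i x ω) ∂μ
    have hRint : ∀ i (a b x y : ℝ),
        Integrable (fun ω => (X i b ω - X i a ω) * (X i y ω - X i x ω)) μ := fun i a b x y =>
      MemLp.integrable_mul ((hmem i b).sub (hmem i a)) ((hmem i y).sub (hmem i x))
    have hR1 : ∀ i a b c x y, R i a c x y = R i a b x y + R i b c x y := by
      intro i a b c x y
      simp only [R]
      rw [← integral_add (hRint i _ _ _ _) (hRint i _ _ _ _)]
      congr 1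
      ext ω
      ring
    have hR2 : ∀ i a b x y z, R i a b x z = R i a b x y + R i a b y z := by
      intro i a b x y z
      simp only [R]
      rw [← integral_add (hRint i _ _ _ _) (hRint i _ _ _ _)]
      congr 1
      ext ω
      ring
    have hRw : ∀ i (a b x y : Set.Icc (0 : ℝ) 1), a ≤ b → x ≤ y →
        |R i a b x y| ≤ (w a b x y) ^ (1 / ρ) := by
      intro i a b x y hab hxy
      have h := hcov i a b x y a.2.1 hab b.2.2 x.2.1 hxy y.2.2
      have h2 := Real.rpow_le_rpow (by positivity) h (show 0 ≤ 1 / ρ by positivity)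
      rw [← Real.rpow_mul (abs_nonneg _), mul_one_div_cancel hρ0.ne', Real.rpow_one] at h2
      exact h2
    have hy := young2D ρ hρ1 Z hZ (R i) (R j) (hR1 i) (hR2 i) (hR1 j) (hR2 j)
      (fun a b x y => w a b x y) (fun _ _ _ _ => hw.1 _ _ _ _)
      (fun a b c x y h1 h2 h3 => hw.2.1 _ _ _ _ _ h1 h2 h3)
      (fun a b x y z h1 h2 h3 => hw.2.2 _ _ _ _ _ h1 h2 h3) (hRw i) (hRw j) n n m u m' u'
      (fun a b h => tagPt_mono P hP.1 s t h) (fun a b h => gridPt_mono P hP.1 s t h)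
      (fun a b h => tagPt_mono P hP.1 s' t' h) (fun a b h => gridPt_mono P hP.1 s' t' h)
    have hsub : ∀ i, ∀ t ∈ Set.Icc (0 : ℝ) 1,
        Measurable[⨆ t ∈ Set.Icc (0:ℝ) 1, MeasurableSpace.comap (X i t) inferInstance]
          (X i t) := by
      intro i t ht
      exact Measurable.mono (comap_measurable (X i t))
        (le_iSup₂ (f := fun t (_ : t ∈ Set.Icc (0:ℝ) 1) =>
          MeasurableSpace.comap (X i t) inferInstance) t ht) le_rfl
    have hprodm : ∀ i, ∀ a b x y : Set.Icc (0 : ℝ) 1,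
        Measurable[⨆ t ∈ Set.Icc (0:ℝ) 1, MeasurableSpace.comap (X i t) inferInstance]
          (fun ω => (X i b ω - X i a ω) * (X i y ω - X i x ω)) := fun i a b x y =>
      Measurable.mul (Measurable.sub (hsub i b b.2) (hsub i a a.2))
        (Measurable.sub (hsub i y y.2) (hsub i x x.2))
    have hindep : ∀ a b x y a' b' x' y' : Set.Icc (0 : ℝ) 1,
        IndepFun (fun ω => (X i b ω - X i a ω) * (X i y ω - X i x ω))
          (fun ω => (X j b' ω - X j a' ω) * (X j y' ω - X j x' ω)) μ := by
      intro a b x y a' b' x' y'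
      rw [IndepFun_iff_Indep]
      exact indep_of_indep_of_le_left (indep_of_indep_of_le_right (hind.indep hij)
        (hprodm j a' b' x' y').comap_le) (hprodm i a b x y).comap_le
    have hE : (∫ ω, iterInt2 X i j s t ω * iterInt2 X i j s' t' ω ∂μ) =
        ∑ l ∈ Finset.range n, ∑ k ∈ Finset.range n,
          R i (m 0) (m (k + 1)) (m' 0) (m' (l + 1)) *
            R j (u k) (u (k + 1)) (u' l) (u' (l + 1)) := by
      have e : ∀ ω, iterInt2 X i j s t ω * iterInt2 X i j s' t' ω =
          ∑ l ∈ Finset.range n, ∑ k ∈ Finset.range n,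
          ((X i (m (k + 1)) ω - X i (m 0) ω) * (X i (m' (l + 1)) ω - X i (m' 0) ω)) *
          ((X j (u (k + 1)) ω - X j (u k) ω) * (X j (u' (l + 1)) ω - X j (u' l) ω)) := by
        intro ω
        rw [hI s t hs hst ht, hI s' t' hs' hst' ht', Finset.sum_mul_sum, Finset.sum_comm]
        apply Finset.sum_congr rfl
        intro l _
        apply Finset.sum_congr rfl
        intro k _
        simp only [m, u, m', u']
        ring
      simp only [e]
      have hprodInt : ∀ k l, Integrable (fun ω =>
          ((X i (m (k + 1)) ω - X i (m 0) ω) * (X i (m' (l + 1)) ω - X i (m' 0) ω)) *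
          ((X j (u (k + 1)) ω - X j (u k) ω) * (X j (u' (l + 1)) ω - X j (u' l) ω))) μ :=
        fun k l => (hindep _ _ _ _ _ _ _ _).integrable_mul (hRint _ _ _ _ _) (hRint _ _ _ _ _)
      rw [integral_finsetSum _ (fun l _ => integrable_finsetSum _ (fun k _ => hprodInt k l))]
      apply Finset.sum_congr rfl
      intro l _
      rw [integral_finsetSum _ (fun k _ => hprodInt k l)]
      apply Finset.sum_congr rfl
      intro k _
      exact (hindep _ _ _ _ _ _ _ _).integral_fun_mul_eq_mul_integral
        (hRint _ _ _ _ _).aestronglyMeasurable (hRint _ _ _ _ _).aestronglyMeasurable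
    rw [hE]
    refine (le_abs_self _).trans (hy.trans ?_)
    have hw0 := hw.1
    have em0 : (m 0 : ℝ) = s := rfl
    have em0' : (m' 0 : ℝ) = s' := rfl
    have eu0 : (u 0 : ℝ) = s := gridPt_zero P hP.2.1 s t hs
    have eu0' : (u' 0 : ℝ) = s' := gridPt_zero P hP.2.1 s' t' hs'
    have eun : (u n : ℝ) = t := gridPt_last P hP.2.2 s t hst.le ht
    have eun' : (u' n : ℝ) = t' := gridPt_last P hP.2.2 s' t' hst'.le ht'
    have hmn : s ≤ (m n : ℝ) := tagPt_ge P hP.1 s t n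
    have hmn' : s' ≤ (m' n : ℝ) := tagPt_ge P hP.1 s' t' n
    have hmt : (m n : ℝ) ≤ t := tagPt_le P s t hst.le n
    have hmt' : (m' n : ℝ) ≤ t' := tagPt_le P s' t' hst'.le n
    simp only [em0, em0', eu0, eu0', eun, eun']
    have hwle : w s (m n) s' (m' n) ≤ w s t s' t' := by
      have h1 := hw.2.1 s (m n) t s' (m' n) hmn hmt hmn'
      have h2 := hw.2.2 s t s' (m' n) t' hst.le hmn' hmt'
      have h3 := hw0 (m n) t s' (m' n)
      have h4 := hw0 s t (m' n) t'
      linarith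
    have hpow : (w s (m n) s' (m' n) * w s t s' t') ^ (1 / ρ) ≤ (w s t s' t') ^ (2 / ρ) := by
      calc _ ≤ (w s t s' t' * w s t s' t') ^ (1 / ρ) := by
            apply Real.rpow_le_rpow (mul_nonneg (hw0 _ _ _ _) (hw0 _ _ _ _)) _ (by positivity)
            exact mul_le_mul_of_nonneg_right hwle (hw0 _ _ _ _)
        _ = _ := by
            rw [← pow_two, ← Real.rpow_natCast, ← Real.rpow_mul (hw0 _ _ _ _)]
            congr 1
            push_cast
            ring
    rw [← mul_assoc]
    exact mul_le_mul_of_nonneg_left hpow (by positivity)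
  intro s t s' t' hs hst ht hs' hst' ht'
  refine ⟨main s t s' t' hs hst ht hs' hst' ht', ?_⟩
  have := main s t s t hs hst ht hs hst ht
  simp only [pow_two]
  exact this
end

section
/- Let x, y ∈ C₀([0,1], G^N(ℝ^d)). Then d_∞(x,y) ≤ d₀(x,y) ≤ C max{d_∞(x,y), d_∞(x,y)^{1/N}(‖x‖_∞+‖y‖_∞)^{1-1/N}} for a constant C = C(N,d), i.e. the distances d₀ and d_∞ are locally 1/N-Hölder equivalent on path space. -/
/-- The (step-`N` truncated) tensor algebra over `ℝ^d`, with tensors represented by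
their coefficients on words in the letters `1,…,d`. -/
abbrev TTA (d : ℕ) := List (Fin d) → ℝ

/-- Truncated tensor product: coefficients of words of length `> N` are discarded. -/
def ttaMul (N d : ℕ) (x y : TTA d) : TTA d := fun w =>
  if w.length ≤ N then ∑ i ∈ Finset.range (w.length + 1), x (w.take i) * y (w.drop i) else 0

/-- The unit `1` of the truncated tensor algebra. -/
def ttaOne (d : ℕ) : TTA d := fun w => if w = [] then 1 else 0

/-- The signature `exp(v)` of a single linear segment with increment `v ∈ ℝ^d`. -/
noncomputable def segExp (N d : ℕ) (v : EuclideanSpace ℝ (Fin d)) : TTA d := fun w =>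
  if w.length ≤ N then (w.map fun a => v a).prod / (Nat.factorial w.length) else 0

/-- The step-`N` signature of the piecewise linear path with successive increments `L`. -/
noncomputable def pwProd (N d : ℕ) (L : List (EuclideanSpace ℝ (Fin d))) : TTA d :=
  L.foldl (fun acc v => ttaMul N d acc (segExp N d v)) (ttaOne d)

/-- The free step-`N` nilpotent group `G^N(ℝ^d)`: signatures of piecewise linear
(equivalently, of bounded variation) paths. -/
def FreeNilpotent (N d : ℕ) : Set (TTA d) := { g | ∃ L, pwProd N d L = g }

/-- The representation of the inverse path: reversed, negated increments. -/
def invList {d : ℕ} (L : List (EuclideanSpace ℝ (Fin d))) :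
    List (EuclideanSpace ℝ (Fin d)) := (L.map fun v => -v).reverse

-- The group inverse in `G^N(ℝ^d)`.
open Classical in
noncomputable def ttaInv (N d : ℕ) (g : TTA d) : TTA d :=
  if h : ∃ L, pwProd N d L = g then pwProd N d (invList h.choose) else ttaOne d

/-- The Carnot–Carathéodory norm: the infimal length of a path whose signature is `g`. -/
noncomputable def ccNorm (N d : ℕ) (g : TTA d) : ℝ :=
  sInf { r | ∃ L, pwProd N d L = g ∧ r = (L.map fun v => ‖v‖).sum }

/-- The Carnot–Carathéodory distance `d(g,h) = ‖g⁻¹ ⊗ h‖`. -/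
noncomputable def ccDist (N d : ℕ) (g h : TTA d) : ℝ :=
  ccNorm N d (ttaMul N d (ttaInv N d g) h)


namespace CCN
section Algebra
variable {N d : ℕ}

def IsTrunc (N d : ℕ) (x : TTA d) : Prop := ∀ w, N < w.length → x w = 0

lemma mul_apply (x y : TTA d) {w : List (Fin d)} (h : w.length ≤ N) :
    ttaMul N d x y w = ∑ i ∈ Finset.range (w.length + 1), x (w.take i) * y (w.drop i) := by
  simp [ttaMul, h]

lemma trunc_mul (x y : TTA d) : IsTrunc N d (ttaMul N d x y) := by
  intro w hw
  simp [ttaMul, not_le.mpr hw]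

lemma trunc_one : IsTrunc N d (ttaOne d) := by
  intro w hw
  have : w ≠ [] := by rintro rfl; simp at hw
  simp [ttaOne, this]

lemma one_mul_tta {x : TTA d} (hx : IsTrunc N d x) : ttaMul N d (ttaOne d) x = x := by
  funext w
  by_cases h : w.length ≤ N
  · rw [mul_apply _ _ h, Finset.sum_eq_single 0]
    · simp [ttaOne]
    · intro i hi h0
      have : w.take i ≠ [] := by
        intro hh
        have := congrArg List.length hh
        simp at this hi
        rcases this with h1 | h1
        · exact h0 h1
        · subst h1; simp at hi; omega
      simp [ttaOne, this]
    · simp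
  · rw [trunc_mul _ _ w (not_le.mp h), hx w (not_le.mp h)]

lemma mul_one_tta {x : TTA d} (hx : IsTrunc N d x) : ttaMul N d x (ttaOne d) = x := by
  funext w
  by_cases h : w.length ≤ N
  · rw [mul_apply _ _ h, Finset.sum_eq_single w.length]
    · simp [ttaOne]
    · intro i hi h0
      have : w.drop i ≠ [] := by
        intro hh
        have := congrArg List.length hh
        simp at this hi
        omega
      simp [ttaOne, this]
    · simp
  · rw [trunc_mul _ _ w (not_le.mp h), hx w (not_le.mp h)]

lemma mul_assoc_tta (x y z : TTA d) :
    ttaMul N d (ttaMul N d x y) z = ttaMul N d x (ttaMul N d y z) := by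
  funext w
  by_cases h : w.length ≤ N
  · rw [mul_apply _ _ h, mul_apply _ _ h]
    have e1 : ∀ i ∈ Finset.range (w.length + 1),
        ttaMul N d x y (w.take i) * z (w.drop i) =
        ∑ j ∈ Finset.range (i + 1),
          x (w.take j) * (y ((w.drop j).take (i - j)) * z (w.drop i)) := by
      intro i hi
      simp at hi
      have hl : (w.take i).length = i := by simp; omega
      rw [mul_apply _ _ (by omega), hl, Finset.sum_mul]
      refine Finset.sum_congr rfl fun j hj => ?_
      simp at hj
      rw [List.take_take, List.drop_take, min_eq_left (by omega), mul_assoc]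
    have e2 : ∀ i ∈ Finset.range (w.length + 1),
        x (w.take i) * ttaMul N d y z (w.drop i) =
        ∑ j ∈ Finset.range (w.length - i + 1),
          x (w.take i) * (y ((w.drop i).take j) * z (w.drop (i + j))) := by
      intro i hi
      simp at hi
      have hl : (w.drop i).length = w.length - i := by simp
      rw [mul_apply _ _ (by omega), hl, Finset.mul_sum]
      refine Finset.sum_congr rfl fun j hj => ?_
      rw [List.drop_drop]
    rw [Finset.sum_congr rfl e1, Finset.sum_congr rfl e2, Finset.sum_sigma', Finset.sum_sigma']
    refine Finset.sum_nbij' (fun p => ⟨p.2, p.1 - p.2⟩) (fun p => ⟨p.1 + p.2, p.1⟩) ?_ ?_ ?_ ?_ ?_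
    · rintro ⟨i, j⟩ hp; simp at hp ⊢; omega
    · rintro ⟨i, j⟩ hp; simp at hp ⊢; omega
    · rintro ⟨i, j⟩ hp
      simp at hp ⊢
      omega
    · rintro ⟨i, j⟩ hp; simp at hp ⊢
    · rintro ⟨i, j⟩ hp
      simp at hp
      have : j + (i - j) = i := by omega
      simp only [this]
  · rw [trunc_mul _ _ w (not_le.mp h), trunc_mul _ _ w (not_le.mp h)]

lemma trunc_seg (v : EuclideanSpace ℝ (Fin d)) : IsTrunc N d (segExp N d v) := by
  intro w hw
  simp [segExp, not_le.mpr hw]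

lemma pw_nil : pwProd N d [] = ttaOne d := rfl

lemma pw_concat (L : List (EuclideanSpace ℝ (Fin d))) (v) :
    pwProd N d (L ++ [v]) = ttaMul N d (pwProd N d L) (segExp N d v) := by
  simp [pwProd]

lemma pw_trunc (L : List (EuclideanSpace ℝ (Fin d))) : IsTrunc N d (pwProd N d L) := by
  induction L using List.reverseRecOn with
  | nil => exact trunc_one
  | append_singleton L v ih => rw [pw_concat]; exact trunc_mul _ _

lemma pw_append (L M : List (EuclideanSpace ℝ (Fin d))) :
    pwProd N d (L ++ M) = ttaMul N d (pwProd N d L) (pwProd N d M) := by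
  induction M using List.reverseRecOn with
  | nil => simp [pw_nil, mul_one_tta (pw_trunc L)]
  | append_singleton M v ih =>
    rw [← List.append_assoc, pw_concat, ih, pw_concat, mul_assoc_tta]

lemma pw_single (v : EuclideanSpace ℝ (Fin d)) : pwProd N d [v] = segExp N d v := by
  have := pw_concat (N := N) [] v
  rw [List.nil_append] at this
  rw [this, pw_nil, one_mul_tta (trunc_seg v)]

lemma exp_sum (a b : ℝ) (n : ℕ) :
    ∑ i ∈ Finset.range (n + 1), (a ^ i / (i.factorial : ℝ)) * (b ^ (n - i) / ((n - i).factorial : ℝ))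
      = (a + b) ^ n / (n.factorial : ℝ) := by
  rw [add_pow, Finset.sum_div]
  refine Finset.sum_congr rfl fun i hi => ?_
  simp at hi
  rw [Nat.cast_choose ℝ (by omega : i ≤ n)]
  have h1 : (i.factorial : ℝ) ≠ 0 := by positivity
  have h2 : ((n - i).factorial : ℝ) ≠ 0 := by positivity
  have h3 : (n.factorial : ℝ) ≠ 0 := by positivity
  field_simp

lemma prod_smul_map (c : ℝ) (v : EuclideanSpace ℝ (Fin d)) (w : List (Fin d)) :
    (w.map fun a => (c • v) a).prod = c ^ w.length * (w.map fun a => v a).prod := by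
  induction w with
  | nil => simp
  | cons a w ih =>
    simp only [List.map_cons, List.prod_cons, List.length_cons, ih]
    simp only [PiLp.smul_apply, smul_eq_mul]
    ring

lemma seg_smul_apply (c : ℝ) (v : EuclideanSpace ℝ (Fin d)) (w : List (Fin d)) :
    segExp N d (c • v) w = c ^ w.length * segExp N d v w := by
  unfold segExp
  split_ifs
  · rw [prod_smul_map]; ring
  · simp

lemma seg_mul (a b : ℝ) (v : EuclideanSpace ℝ (Fin d)) :
    ttaMul N d (segExp N d (a • v)) (segExp N d (b • v)) = segExp N d ((a + b) • v) := by
  funext w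
  by_cases h : w.length ≤ N
  · rw [mul_apply _ _ h]
    have : segExp N d ((a + b) • v) w = (w.map fun a => v a).prod * ((a+b)^w.length / (w.length.factorial : ℝ)) := by
      rw [seg_smul_apply]; simp [segExp, h]; ring
    rw [this, ← exp_sum, Finset.mul_sum]
    refine Finset.sum_congr rfl fun i hi => ?_
    simp at hi
    have hl : (w.take i).length = i := by simp; omega
    have hl2 : (w.drop i).length = w.length - i := by simp
    rw [seg_smul_apply, seg_smul_apply, hl, hl2]
    unfold segExp
    rw [if_pos (by omega), if_pos (by omega), hl, hl2]
    have : (w.map fun a => v a).prod = ((w.take i).map fun a => v a).prod * ((w.drop i).map fun a => v a).prod := by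
      rw [← List.prod_append, ← List.map_append, List.take_append_drop]
    rw [this]; ring
  · rw [trunc_mul _ _ w (not_le.mp h), trunc_seg _ w (not_le.mp h)]

lemma seg_zero : segExp N d 0 = ttaOne d := by
  funext w
  have := seg_smul_apply (N := N) (d := d) 0 0 w
  rw [smul_zero] at this
  rcases w with _ | ⟨a, w⟩
  · simp [segExp, ttaOne]
  · rw [this]; simp [ttaOne]

lemma seg_mul_neg (v : EuclideanSpace ℝ (Fin d)) :
    ttaMul N d (segExp N d v) (segExp N d (-v)) = ttaOne d := by
  have := seg_mul (N := N) 1 (-1) v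
  simpa [seg_zero] using this

lemma pw_mul_inv (L : List (EuclideanSpace ℝ (Fin d))) :
    ttaMul N d (pwProd N d L) (pwProd N d (invList L)) = ttaOne d := by
  induction L with
  | nil => simp [invList, pw_nil, one_mul_tta trunc_one]
  | cons v L ih =>
    have e1 : v :: L = [v] ++ L := rfl
    have e2 : invList (v :: L) = invList L ++ [-v] := by simp [invList]
    rw [e2, e1, pw_append, pw_append, mul_assoc_tta, ← mul_assoc_tta (pwProd N d L), ih,
      one_mul_tta (pw_trunc _), pw_single, pw_single, seg_mul_neg]

lemma invList_invList (L : List (EuclideanSpace ℝ (Fin d))) : invList (invList L) = L := by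
  simp [invList]

lemma pw_inv_mul (L : List (EuclideanSpace ℝ (Fin d))) :
    ttaMul N d (pwProd N d (invList L)) (pwProd N d L) = ttaOne d := by
  have := pw_mul_inv (N := N) (invList L)
  rwa [invList_invList] at this

lemma pw_inv_congr {L M : List (EuclideanSpace ℝ (Fin d))} (h : pwProd N d L = pwProd N d M) :
    pwProd N d (invList L) = pwProd N d (invList M) := by
  rw [← mul_one_tta (pw_trunc (invList L)), ← pw_mul_inv M, ← h, ← mul_assoc_tta, pw_inv_mul,
    one_mul_tta (pw_trunc _)]

lemma inv_pw (L : List (EuclideanSpace ℝ (Fin d))) :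
    ttaInv N d (pwProd N d L) = pwProd N d (invList L) := by
  have hex : ∃ M, pwProd N d M = pwProd N d L := ⟨L, rfl⟩
  unfold ttaInv
  rw [dif_pos hex]
  exact pw_inv_congr hex.choose_spec

/-- Length of a piecewise linear path. -/
noncomputable def len {d : ℕ} (L : List (EuclideanSpace ℝ (Fin d))) : ℝ := (L.map fun v => ‖v‖).sum

lemma len_nonneg (L : List (EuclideanSpace ℝ (Fin d))) : 0 ≤ len L := by
  unfold len
  apply List.sum_nonneg
  simp only [List.mem_map]
  rintro _ ⟨v, _, rfl⟩
  exact norm_nonneg v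

lemma len_append (L M : List (EuclideanSpace ℝ (Fin d))) : len (L ++ M) = len L + len M := by
  simp [len]

lemma len_inv (L : List (EuclideanSpace ℝ (Fin d))) : len (invList L) = len L := by
  simp [len, invList, Function.comp_def]

lemma len_smul (c : ℝ) (L : List (EuclideanSpace ℝ (Fin d))) :
    len (L.map (c • ·)) = |c| * len L := by
  induction L with
  | nil => simp [len]
  | cons v L ih =>
    simp only [len, List.map_cons, List.sum_cons] at ih ⊢
    rw [ih, norm_smul, Real.norm_eq_abs]; ring

lemma pw_smul_apply (c : ℝ) (L : List (EuclideanSpace ℝ (Fin d))) (w : List (Fin d)) :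
    pwProd N d (L.map (c • ·)) w = c ^ w.length * pwProd N d L w := by
  induction L using List.reverseRecOn generalizing w with
  | nil => 
    rcases w with _ | ⟨a, w⟩
    · simp [pw_nil]
    · simp [pw_nil, ttaOne]
  | append_singleton L v ih =>
    rw [List.map_append, List.map_singleton, pw_concat, pw_concat]
    by_cases h : w.length ≤ N
    · rw [mul_apply _ _ h, mul_apply _ _ h, Finset.mul_sum]
      refine Finset.sum_congr rfl fun i hi => ?_
      simp at hi
      have hl : (w.take i).length = i := by simp; omega
      have hl2 : (w.drop i).length = w.length - i := by simp
      rw [ih, seg_smul_apply, hl, hl2]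
      have : c ^ w.length = c ^ i * c ^ (w.length - i) := by rw [← pow_add]; congr 1; omega
      rw [this]; ring
    · rw [trunc_mul _ _ w (not_le.mp h), trunc_mul _ _ w (not_le.mp h), mul_zero]

lemma seg_bound (v : EuclideanSpace ℝ (Fin d)) (w : List (Fin d)) :
    |segExp N d v w| ≤ ‖v‖ ^ w.length / (w.length.factorial : ℝ) := by
  unfold segExp
  split_ifs
  · rw [abs_div, Nat.abs_cast]
    gcongr
    induction w with
    | nil => simp
    | cons a w ih =>
      simp only [List.map_cons, List.prod_cons, List.length_cons, abs_mul, pow_succ']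
      have : |v a| ≤ ‖v‖ := by simpa using PiLp.norm_apply_le v a
      gcongr
      exact ih (by simp at *; omega)
  · simp; positivity

lemma pw_bound' (L : List (EuclideanSpace ℝ (Fin d))) (w : List (Fin d)) :
    |pwProd N d L w| ≤ len L ^ w.length / (w.length.factorial : ℝ) := by
  induction L using List.reverseRecOn generalizing w with
  | nil => 
    rcases w with _ | ⟨a, w⟩
    · simp [pw_nil, ttaOne]
    · simp [pw_nil, ttaOne, len]
  | append_singleton L v ih =>
    have h0 := len_nonneg L
    rw [pw_concat, len_append]
    have hv : len [v] = ‖v‖ := by simp [len]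
    rw [hv]
    by_cases h : w.length ≤ N
    · rw [mul_apply _ _ h, ← exp_sum]
      refine (Finset.abs_sum_le_sum_abs _ _).trans (Finset.sum_le_sum fun i hi => ?_)
      simp at hi
      have hl : (w.take i).length = i := by simp; omega
      have hl2 : (w.drop i).length = w.length - i := by simp
      rw [abs_mul]
      have h1 := ih (w.take i)
      have h2 := seg_bound (N := N) v (w.drop i)
      rw [hl] at h1
      rw [hl2] at h2
      gcongr
    · rw [trunc_mul _ _ w (not_le.mp h)]; simp; positivity

lemma pw_bound (L : List (EuclideanSpace ℝ (Fin d))) (w : List (Fin d)) :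
    |pwProd N d L w| ≤ len L ^ w.length := by
  have h0 := len_nonneg L
  refine (pw_bound' L w).trans (div_le_self (by positivity) ?_)
  exact_mod_cast Nat.one_le_iff_ne_zero.mpr (Nat.factorial_ne_zero _)

lemma pw_nil_word (L : List (EuclideanSpace ℝ (Fin d))) : pwProd N d L [] = 1 := by
  induction L using List.reverseRecOn with
  | nil => simp [pw_nil, ttaOne]
  | append_singleton L v ih =>
    rw [pw_concat, mul_apply _ _ (by simp)]
    simp [ih, segExp]

lemma pw_level (L : List (EuclideanSpace ℝ (Fin d))) (w : List (Fin d)) (h : w.length ≤ N) :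
    pwProd (N + 1) d L w = pwProd N d L w := by
  induction L using List.reverseRecOn generalizing w with
  | nil => simp [pw_nil]
  | append_singleton L v ih =>
    rw [pw_concat, pw_concat, mul_apply _ _ h, mul_apply _ _ (by omega)]
    refine Finset.sum_congr rfl fun i hi => ?_
    simp at hi
    have hl : (w.take i).length = i := by simp; omega
    have hl2 : (w.drop i).length = w.length - i := by simp
    rw [ih _ (by omega)]
    congr 1
    unfold segExp
    rw [if_pos (by omega), if_pos (by omega)]

end Algebra

section Layer
variable {N d : ℕ}

/-- `L` represents an element of the top layer of `G^{N+1}` with top component `z`. -/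
def IsTop (N d : ℕ) (L : List (EuclideanSpace ℝ (Fin d)))
    (z : List.Vector (Fin d) (N + 1) → ℝ) : Prop :=
  pwProd N d L = ttaOne d ∧ ∀ w : List.Vector (Fin d) (N + 1), pwProd (N + 1) d L w.1 = z w

lemma IsTop.nil : IsTop N d [] 0 := by
  refine ⟨rfl, fun w => ?_⟩
  have : w.1 ≠ [] := by
    intro h
    have := w.2
    rw [h] at this
    simp at this
  simp [pw_nil, ttaOne, this]

lemma IsTop.lower {L : List (EuclideanSpace ℝ (Fin d))} {z} (h : IsTop N d L z)
    (w : List (Fin d)) (hw : w.length ≤ N) : pwProd (N + 1) d L w = ttaOne d w := by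
  rw [pw_level L w hw, h.1]

lemma IsTop.append {L M : List (EuclideanSpace ℝ (Fin d))} {z z'} (h : IsTop N d L z)
    (h' : IsTop N d M z') : IsTop N d (L ++ M) (z + z') := by
  refine ⟨by rw [pw_append, h.1, h'.1, one_mul_tta trunc_one], ?_⟩
  rintro ⟨w, hw⟩
  rw [pw_append, mul_apply _ _ (by simp [hw])]
  simp only [hw]
  rw [Finset.sum_eq_add_of_mem 0 (N + 1) (by simp) (by simp) (by omega)]
  · have e1 : w.take (N + 1) = w := List.take_of_length_le (by omega)
    have e2 : w.drop (N + 1) = [] := List.drop_of_length_le (by omega)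
    rw [e1, e2, List.take_zero, List.drop_zero, pw_nil_word, pw_nil_word]
    have h1 := h.2 ⟨w, hw⟩
    have h2 := h'.2 ⟨w, hw⟩
    simp only at h1 h2
    rw [h1, h2]
    change 1 * z' ⟨w, hw⟩ + z ⟨w, hw⟩ * 1 = z ⟨w, hw⟩ + z' ⟨w, hw⟩
    ring
  · intro i hi hne
    simp at hi
    have hl : (w.take i).length = i := by simp; omega
    have : w.take i ≠ [] := by
      intro hh; rw [hh] at hl; simp at hl; omega
    rw [h.lower _ (by omega)]
    simp [ttaOne, this]

lemma IsTop.inv {L : List (EuclideanSpace ℝ (Fin d))} {z} (h : IsTop N d L z) :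
    IsTop N d (invList L) (-z) := by
  have h1 : pwProd N d (invList L) = ttaOne d := by
    have := pw_inv_congr (N := N) (L := L) (M := []) (by rw [h.1, pw_nil])
    rw [this]; simp [invList, pw_nil]
  have h2 : IsTop N d (invList L) (fun w => pwProd (N + 1) d (invList L) w.1) := ⟨h1, fun w => rfl⟩
  have h3 := h.append h2
  have h4 : z + (fun w => pwProd (N + 1) d (invList L) w.1) = 0 := by
    funext w
    rw [← h3.2 w, pw_append, pw_mul_inv, ← IsTop.nil.2 w, pw_nil]
  have : (-z) = (fun w : List.Vector (Fin d) (N + 1) => pwProd (N + 1) d (invList L) w.1) :=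
    neg_eq_of_add_eq_zero_right h4
  rwa [this]

lemma IsTop.scale {L : List (EuclideanSpace ℝ (Fin d))} {z} (h : IsTop N d L z) (c : ℝ) :
    IsTop N d (L.map (c • ·)) (c ^ (N + 1) • z) := by
  constructor
  · funext w
    rw [pw_smul_apply, h.1]
    rcases w with _ | ⟨a, w⟩ <;> simp [ttaOne]
  · rintro ⟨w, hw⟩
    rw [pw_smul_apply]
    have := h.2 ⟨w, hw⟩
    simp only at this
    rw [this, hw]
    rfl

lemma IsTop.congr {L M : List (EuclideanSpace ℝ (Fin d))} {z} (h : IsTop N d L z)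
    (h' : IsTop N d M z) : pwProd (N + 1) d L = pwProd (N + 1) d M := by
  funext w
  rcases lt_trichotomy w.length (N + 1) with hw | hw | hw
  · rw [h.lower _ (by omega), h'.lower _ (by omega)]
  · exact (h.2 ⟨w, hw⟩).trans (h'.2 ⟨w, hw⟩).symm
  · rw [pw_trunc L w hw, pw_trunc M w hw]

lemma IsTop.smul_len {L : List (EuclideanSpace ℝ (Fin d))} {z} (h : IsTop N d L z) (c m : ℝ)
    (hm : 0 ≤ m) (hc : |c| ≤ m ^ (N + 1)) :
    ∃ L', IsTop N d L' (c • z) ∧ len L' ≤ m * len L := by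
  obtain ⟨r, hr0, hr⟩ : ∃ r : ℝ, 0 ≤ r ∧ r ^ (N + 1) = |c| :=
    ⟨|c| ^ (((N + 1 : ℕ) : ℝ)⁻¹), by positivity,
      Real.rpow_inv_natCast_pow (abs_nonneg c) (by omega)⟩
  have hrm : r ≤ m := by
    rw [← hr] at hc
    exact le_of_pow_le_pow_left₀ (by omega) hm hc
  have h1 := h.scale r
  have hl : len (L.map (r • ·)) ≤ m * len L := by
    rw [len_smul, abs_of_nonneg hr0]
    exact mul_le_mul_of_nonneg_right hrm (len_nonneg L)
  rw [hr] at h1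
  rcases le_total 0 c with h0 | h0
  · rw [abs_of_nonneg h0] at h1
    exact ⟨_, h1, hl⟩
  · rw [abs_of_nonpos h0] at h1
    refine ⟨_, ?_, (len_inv _).trans_le hl⟩
    have := h1.inv
    rwa [neg_smul, neg_neg] at this

/-- The top layer is a linear space. -/
def topLayer (N d : ℕ) : Submodule ℝ (List.Vector (Fin d) (N + 1) → ℝ) where
  carrier := {z | ∃ L, IsTop N d L z}
  add_mem' := by
    rintro a b ⟨L, hL⟩ ⟨M, hM⟩
    exact ⟨_, hL.append hM⟩
  zero_mem' := ⟨[], IsTop.nil⟩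
  smul_mem' := by
    rintro c z ⟨L, hL⟩
    obtain ⟨L', h, _⟩ := hL.smul_len c (|c| + 1) (by positivity) (by
      have h1 : 1 ≤ |c| + 1 := by linarith [abs_nonneg c]
      calc |c| ≤ |c| + 1 := by linarith
        _ ≤ _ := le_self_pow₀ h1 (by omega))
    exact ⟨L', h⟩

lemma layer_bound (N d : ℕ) : ∃ C : ℝ, 0 ≤ C ∧ ∀ z, (∃ L, IsTop N d L z) → ∀ M : ℝ, 0 ≤ M →
    (∀ w, |z w| ≤ M ^ (N + 1)) → ∃ L, IsTop N d L z ∧ len L ≤ C * M := by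
  classical
  let B := Module.finBasis ℝ (topLayer N d)
  have hB : ∀ i, ∃ L, IsTop N d L (B i : List.Vector (Fin d) (N + 1) → ℝ) := fun i => (B i).2
  choose A hA using hB
  let f := LinearMap.toContinuousLinearMap B.equivFun.toLinearMap
  have hA0 : 0 ≤ ∑ i, len (A i) := Finset.sum_nonneg fun i _ => len_nonneg _
  refine ⟨(‖f‖ + 1) * ∑ i, len (A i), by positivity, ?_⟩
  intro z hz M hM hzM
  let Z : topLayer N d := ⟨z, hz⟩
  have hc : ∀ i, |B.equivFun Z i| ≤ ((‖f‖ + 1) * M) ^ (N + 1) := by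
    intro i
    have h1 : |B.equivFun Z i| ≤ ‖f Z‖ := norm_le_pi_norm (f Z) i
    have h2 : ‖f Z‖ ≤ ‖f‖ * ‖Z‖ := f.le_opNorm Z
    have h3 : ‖Z‖ ≤ M ^ (N + 1) := (pi_norm_le_iff_of_nonneg (by positivity)).2 hzM
    have h4 : ‖f‖ ≤ (‖f‖ + 1) ^ (N + 1) := by
      have h1 : 1 ≤ ‖f‖ + 1 := by linarith [norm_nonneg f]
      calc ‖f‖ ≤ ‖f‖ + 1 := by linarith
        _ ≤ _ := le_self_pow₀ h1 (by omega)
    calc _ ≤ ‖f‖ * ‖Z‖ := h1.trans h2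
      _ ≤ (‖f‖ + 1) ^ (N + 1) * M ^ (N + 1) := by gcongr
      _ = _ := by rw [mul_pow]
  have key : ∀ s : Finset (Fin (Module.finrank ℝ (topLayer N d))),
      ∃ L, IsTop N d L (∑ i ∈ s, B.equivFun Z i • (B i : List.Vector (Fin d) (N + 1) → ℝ)) ∧
        len L ≤ ∑ i ∈ s, ((‖f‖ + 1) * M) * len (A i) := by
    intro s
    induction s using Finset.induction_on with
    | empty => exact ⟨[], by simpa using IsTop.nil, by simp [len]⟩
    | insert i s hi ih =>
      obtain ⟨L, hL, hl⟩ := ih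
      obtain ⟨L', hL', hl'⟩ := (hA i).smul_len _ _ (by positivity) (hc i)
      refine ⟨L' ++ L, ?_, ?_⟩
      · rw [Finset.sum_insert hi]; exact hL'.append hL
      · rw [Finset.sum_insert hi, len_append]; exact add_le_add hl' hl
  obtain ⟨L, hL, hl⟩ := key Finset.univ
  refine ⟨L, ?_, ?_⟩
  · have h1 := B.sum_equivFun Z
    have h2 := congrArg (Subtype.val) h1
    simp only [Submodule.coe_sum, Submodule.coe_smul] at h2
    rw [h2] at hL
    exact hL
  · rw [← Finset.mul_sum] at hl
    linarith

lemma ball_box (N d : ℕ) : ∃ C : ℝ, 0 ≤ C ∧ ∀ L M, 0 ≤ M →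
    (∀ w : List (Fin d), 1 ≤ w.length → w.length ≤ N → |pwProd N d L w| ≤ M ^ w.length) →
    ∃ L', pwProd N d L' = pwProd N d L ∧ len L' ≤ C * M := by
  induction N with
  | zero =>
    refine ⟨0, le_rfl, fun L M _ _ => ⟨[], ?_, by simp [len]⟩⟩
    funext w
    rcases w with _ | ⟨a, w⟩
    · rw [pw_nil_word, pw_nil_word]
    · rw [pw_trunc _ _ (by simp), pw_trunc _ _ (by simp)]
  | succ N ih =>
    obtain ⟨C, hC, ih⟩ := ih
    obtain ⟨D, hD, hlay⟩ := layer_bound N d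
    refine ⟨C + D * (((N : ℝ) + 2) * (C + 1)), by positivity, ?_⟩
    intro L M hM hL
    have hL0 : ∀ w : List (Fin d), w.length ≤ N + 1 → |pwProd (N + 1) d L w| ≤ M ^ w.length := by
      intro w hw
      rcases w with _ | ⟨a, w⟩
      · simp [pw_nil_word]
      · exact hL _ (by simp) hw
    obtain ⟨L', hL', hl'⟩ := ih L M hM (fun w h1 h2 => by
      rw [← pw_level L w h2]; exact hL w h1 (by omega))
    have hT : IsTop N d (invList L' ++ L) (fun w => pwProd (N + 1) d (invList L' ++ L) w.1) := by
      refine ⟨?_, fun w => rfl⟩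
      rw [pw_append, ← hL', pw_inv_mul]
    obtain ⟨L'', hL'', hl''⟩ := hlay _ ⟨_, hT⟩ (((N : ℝ) + 2) * (C + 1) * M) (by positivity) (by
      rintro ⟨w, hw⟩
      simp only
      rw [pw_append, mul_apply _ _ hw.le]
      refine (Finset.abs_sum_le_sum_abs _ _).trans ?_
      calc _ ≤ ∑ i ∈ Finset.range (w.length + 1), (C + 1) ^ (N + 1) * M ^ (N + 1) := by
            refine Finset.sum_le_sum fun i hi => ?_
            simp at hi
            have hl : (w.take i).length = i := by simp; omega
            have hl2 : (w.drop i).length = w.length - i := by simp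
            rw [abs_mul]
            have h1 := pw_bound (N := N + 1) (invList L') (w.take i)
            have h2 := hL0 (w.drop i) (by omega)
            rw [hl, len_inv] at h1
            rw [hl2] at h2
            have h3 : len L' ^ i ≤ ((C + 1) * M) ^ i :=
              pow_le_pow_left₀ (len_nonneg _) (by linarith) i
            have h4 : (C + 1) ^ i ≤ (C + 1) ^ (N + 1) :=
              pow_le_pow_right₀ (by linarith) (by omega)
            calc _ ≤ ((C + 1) * M) ^ i * M ^ (w.length - i) := by
                  gcongr; exact h1.trans h3
              _ = (C + 1) ^ i * M ^ (N + 1) := by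
                  rw [mul_pow, mul_assoc, ← pow_add]; congr 2; omega
              _ ≤ _ := by gcongr
        _ = ((N : ℝ) + 2) * ((C + 1) ^ (N + 1) * M ^ (N + 1)) := by
            rw [Finset.sum_const, Finset.card_range, nsmul_eq_mul, hw]; push_cast; ring
        _ ≤ ((N : ℝ) + 2) ^ (N + 1) * ((C + 1) ^ (N + 1) * M ^ (N + 1)) := by
            gcongr
            exact le_self_pow₀ (by linarith [(Nat.cast_nonneg N : (0:ℝ) ≤ N)]) (by omega)
        _ = _ := by rw [mul_pow, mul_pow]; ring)
    refine ⟨L' ++ L'', ?_, ?_⟩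
    · rw [pw_append, hL''.congr hT, pw_append, ← mul_assoc_tta, pw_mul_inv,
        one_mul_tta (pw_trunc _)]
    · rw [len_append]; linarith

end Layer

section Norm
variable {N d : ℕ}

lemma bdd (g : TTA d) :
    BddBelow { r | ∃ L, pwProd N d L = g ∧ r = (L.map fun v => ‖v‖).sum } :=
  ⟨0, by rintro r ⟨L, _, rfl⟩; exact len_nonneg L⟩

lemma ccNorm_le (L : List (EuclideanSpace ℝ (Fin d))) : ccNorm N d (pwProd N d L) ≤ len L :=
  csInf_le (bdd _) ⟨L, rfl, rfl⟩

lemma ccNorm_nonneg (g : TTA d) : 0 ≤ ccNorm N d g := by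
  apply Real.sInf_nonneg
  rintro r ⟨L, _, rfl⟩
  exact len_nonneg L

lemma le_ccNorm (L : List (EuclideanSpace ℝ (Fin d))) (r : ℝ)
    (h : ∀ M, pwProd N d M = pwProd N d L → r ≤ len M) : r ≤ ccNorm N d (pwProd N d L) := by
  apply le_csInf
  · exact ⟨_, L, rfl, rfl⟩
  · rintro _ ⟨M, hM, rfl⟩
    exact h M hM

lemma exists_len_lt (L : List (EuclideanSpace ℝ (Fin d))) (r : ℝ)
    (h : ccNorm N d (pwProd N d L) < r) : ∃ M, pwProd N d M = pwProd N d L ∧ len M < r := by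
  by_contra! hh
  exact absurd (le_ccNorm L r hh) (not_le.mpr h)

lemma abs_le_ccNorm (L : List (EuclideanSpace ℝ (Fin d))) (w : List (Fin d)) :
    |pwProd N d L w| ≤ ccNorm N d (pwProd N d L) ^ w.length := by
  rcases w with _ | ⟨a, w⟩
  · simp [pw_nil_word]
  · set k := (a :: w).length with hk
    have hk0 : k ≠ 0 := by simp [hk]
    have h1 : |pwProd N d L (a :: w)| ^ ((k : ℝ)⁻¹) ≤ ccNorm N d (pwProd N d L) := by
      apply le_ccNorm
      intro M hM
      have h2 := pw_bound (N := N) M (a :: w)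
      rw [hM] at h2
      refine le_of_pow_le_pow_left₀ hk0 (len_nonneg M) ?_
      rwa [Real.rpow_inv_natCast_pow (abs_nonneg _) hk0]
    calc _ = (|pwProd N d L (a :: w)| ^ ((k : ℝ)⁻¹)) ^ k :=
          (Real.rpow_inv_natCast_pow (abs_nonneg _) hk0).symm
      _ ≤ _ := pow_le_pow_left₀ (by positivity) h1 _

lemma ccNorm_append (A B : List (EuclideanSpace ℝ (Fin d))) :
    ccNorm N d (pwProd N d (A ++ B)) ≤ ccNorm N d (pwProd N d A) + ccNorm N d (pwProd N d B) := by
  refine le_of_forall_pos_le_add fun e he => ?_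
  obtain ⟨A', hA, ha⟩ := exists_len_lt (N := N) A _ (lt_add_of_pos_right _ (half_pos he))
  obtain ⟨B', hB, hb⟩ := exists_len_lt (N := N) B _ (lt_add_of_pos_right _ (half_pos he))
  rw [pw_append, ← hA, ← hB, ← pw_append]
  have := ccNorm_le (N := N) (A' ++ B')
  rw [len_append] at this
  rw [hA, hB]
  linarith

lemma ccNorm_invList (A : List (EuclideanSpace ℝ (Fin d))) :
    ccNorm N d (pwProd N d (invList A)) ≤ ccNorm N d (pwProd N d A) := by
  apply le_ccNorm
  intro M hM
  rw [← pw_inv_congr hM, ← len_inv M]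
  exact ccNorm_le _

lemma sub_mul_tta (x y g : TTA d) :
    ttaMul N d (x - y) g = ttaMul N d x g - ttaMul N d y g := by
  funext w
  simp only [ttaMul, Pi.sub_apply]
  split_ifs
  · rw [← Finset.sum_sub_distrib]
    exact Finset.sum_congr rfl fun i _ => by ring
  · simp

lemma mul_sub_tta (x y g : TTA d) :
    ttaMul N d g (x - y) = ttaMul N d g x - ttaMul N d g y := by
  funext w
  simp only [ttaMul, Pi.sub_apply]
  split_ifs
  · rw [← Finset.sum_sub_distrib]
    exact Finset.sum_congr rfl fun i _ => by ring
  · simp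

/-- `u` has no constant term and its level `k` part is at most `E * R ^ (k-1)`. -/
def Small (d : ℕ) (E R : ℝ) (u : TTA d) : Prop :=
  u [] = 0 ∧ ∀ w : List (Fin d), 1 ≤ w.length → |u w| ≤ E * R ^ (w.length - 1)

lemma Small.mul_right {E R : ℝ} (hE : 0 ≤ E) (hR : 0 ≤ R) {u g : TTA d} (hu : Small d E R u)
    (hg : ∀ w, |g w| ≤ R ^ w.length) : Small d ((N + 1) * E) R (ttaMul N d u g) := by
  refine ⟨by rw [mul_apply _ _ (by simp)]; simp [hu.1], fun w hw => ?_⟩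
  by_cases h : w.length ≤ N
  · rw [mul_apply _ _ h]
    refine (Finset.abs_sum_le_sum_abs _ _).trans ?_
    calc _ ≤ ∑ i ∈ Finset.range (w.length + 1), E * R ^ (w.length - 1) := by
          refine Finset.sum_le_sum fun i hi => ?_
          simp at hi
          rcases Nat.eq_zero_or_pos i with rfl | hi0
          · simp only [List.take_zero, hu.1, zero_mul, abs_zero]; positivity
          · have hl : (w.take i).length = i := by simp; omega
            have hl2 : (w.drop i).length = w.length - i := by simp
            have h1 := hu.2 (w.take i) (by omega)
            have h2 := hg (w.drop i)
            rw [hl] at h1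
            rw [hl2] at h2
            rw [abs_mul]
            calc _ ≤ (E * R ^ (i - 1)) * R ^ (w.length - i) := by gcongr
              _ = _ := by rw [mul_assoc, ← pow_add]; congr 2; omega
      _ = ((w.length : ℝ) + 1) * (E * R ^ (w.length - 1)) := by
          rw [Finset.sum_const, Finset.card_range, nsmul_eq_mul]; push_cast; ring
      _ ≤ ((N : ℝ) + 1) * (E * R ^ (w.length - 1)) := by gcongr
      _ = _ := by ring
  · rw [trunc_mul _ _ w (not_le.mp h), abs_zero]; positivity

lemma Small.mul_left {E R : ℝ} (hE : 0 ≤ E) (hR : 0 ≤ R) {u g : TTA d} (hu : Small d E R u)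
    (hg : ∀ w, |g w| ≤ R ^ w.length) : Small d ((N + 1) * E) R (ttaMul N d g u) := by
  refine ⟨by rw [mul_apply _ _ (by simp)]; simp [hu.1], fun w hw => ?_⟩
  by_cases h : w.length ≤ N
  · rw [mul_apply _ _ h]
    refine (Finset.abs_sum_le_sum_abs _ _).trans ?_
    calc _ ≤ ∑ i ∈ Finset.range (w.length + 1), E * R ^ (w.length - 1) := by
          refine Finset.sum_le_sum fun i hi => ?_
          simp at hi
          rcases Nat.eq_zero_or_pos (w.length - i) with hi0 | hi0
          · have : w.drop i = [] := List.drop_of_length_le (by omega)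
            simp only [this, hu.1, mul_zero, abs_zero]; positivity
          · have hl : (w.take i).length = i := by simp; omega
            have hl2 : (w.drop i).length = w.length - i := by simp
            have h1 := hu.2 (w.drop i) (by omega)
            have h2 := hg (w.take i)
            rw [hl2] at h1
            rw [hl] at h2
            rw [abs_mul]
            calc _ ≤ R ^ i * (E * R ^ (w.length - i - 1)) := by gcongr
              _ = E * (R ^ i * R ^ (w.length - i - 1)) := by ring
              _ = _ := by rw [← pow_add]; congr 2; omega
      _ = ((w.length : ℝ) + 1) * (E * R ^ (w.length - 1)) := by
          rw [Finset.sum_const, Finset.card_range, nsmul_eq_mul]; push_cast; ring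
      _ ≤ ((N : ℝ) + 1) * (E * R ^ (w.length - 1)) := by gcongr
      _ = _ := by ring
  · rw [trunc_mul _ _ w (not_le.mp h), abs_zero]; positivity

lemma conj_bound (N d : ℕ) : ∃ C : ℝ, 0 ≤ C ∧
    ∀ (A H : List (EuclideanSpace ℝ (Fin d))) (e R m : ℝ), 0 ≤ e → e ≤ R → 0 ≤ m → m ≤ R →
      m ^ N = e * R ^ (N - 1) →
      ccNorm N d (pwProd N d A) ≤ R → ccNorm N d (pwProd N d H) ≤ e →
      ccNorm N d (pwProd N d (invList A ++ (H ++ A))) ≤ C * m := by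
  obtain ⟨C, hC, hbox⟩ := ball_box N d
  refine ⟨C * ((N : ℝ) + 1) ^ 2, by positivity, ?_⟩
  intro A H e R m he heR hm hmR hmN hA hH
  have hR : 0 ≤ R := he.trans heR
  have hu : Small d e R (pwProd N d H - ttaOne d) := by
    refine ⟨by simp [pw_nil_word, ttaOne], fun w hw => ?_⟩
    have hw0 : w ≠ [] := by rintro rfl; simp at hw
    simp only [Pi.sub_apply, ttaOne, hw0, if_false, sub_zero]
    calc _ ≤ _ := abs_le_ccNorm H w
      _ ≤ e ^ w.length := pow_le_pow_left₀ (ccNorm_nonneg _) hH _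
      _ = e * e ^ (w.length - 1) := by rw [← pow_succ']; congr 1; omega
      _ ≤ _ := by gcongr
  have hgA : ∀ w, |pwProd N d A w| ≤ R ^ w.length := fun w =>
    (abs_le_ccNorm A w).trans (pow_le_pow_left₀ (ccNorm_nonneg _) hA _)
  have hgI : ∀ w, |pwProd N d (invList A) w| ≤ R ^ w.length := fun w =>
    (abs_le_ccNorm _ w).trans
      (pow_le_pow_left₀ (ccNorm_nonneg _) ((ccNorm_invList A).trans hA) _)
  have hs := (hu.mul_right (N := N) he hR hgA).mul_left (N := N) (by positivity) hR hgI
  have heq : ttaMul N d (pwProd N d (invList A))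
      (ttaMul N d (pwProd N d H - ttaOne d) (pwProd N d A)) =
      pwProd N d (invList A ++ (H ++ A)) - ttaOne d := by
    rw [sub_mul_tta, mul_sub_tta, one_mul_tta (pw_trunc _), pw_inv_mul, pw_append, pw_append]
  rw [heq] at hs
  obtain ⟨L, hL, hl⟩ := hbox (invList A ++ (H ++ A)) (((N : ℝ) + 1) ^ 2 * m) (by positivity) (by
    intro w hw hwN
    have h1 := hs.2 w hw
    have hw0 : w ≠ [] := by rintro rfl; simp at hw
    simp only [Pi.sub_apply, ttaOne, hw0, if_false, sub_zero] at h1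
    have h2 : e * R ^ (w.length - 1) ≤ m ^ w.length := by
      rcases hR.eq_or_lt with h0 | h0
      · have : e = 0 := le_antisymm (heR.trans h0.symm.le) he
        rw [this, zero_mul]; positivity
      · have hp : 0 < R ^ (N - w.length) := by positivity
        refine le_of_mul_le_mul_right ?_ hp
        calc e * R ^ (w.length - 1) * R ^ (N - w.length) = e * R ^ (N - 1) := by
              rw [mul_assoc, ← pow_add]; congr 2; omega
          _ = m ^ w.length * m ^ (N - w.length) := by
              rw [← hmN, ← pow_add]; congr 1; omega
          _ ≤ _ := by gcongr
    have h3 : ((N : ℝ) + 1) ^ 2 ≤ (((N : ℝ) + 1) ^ 2) ^ w.length := by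
      refine le_self_pow₀ ?_ (by omega)
      exact one_le_pow₀ (by linarith [(Nat.cast_nonneg N : (0:ℝ) ≤ N)])
    calc _ ≤ _ := h1
      _ = ((N : ℝ) + 1) ^ 2 * (e * R ^ (w.length - 1)) := by ring
      _ ≤ (((N : ℝ) + 1) ^ 2) ^ w.length * m ^ w.length := by gcongr
      _ = _ := by rw [mul_pow])
  calc _ ≤ len L := by rw [← hL]; exact ccNorm_le L
    _ ≤ _ := hl
    _ = _ := by ring

end Norm

section Final
variable {N d : ℕ}

lemma rpow_part {N : ℕ} (hN : 1 ≤ N) {b R : ℝ} (hb : 0 ≤ b) (hR : 0 ≤ R) :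
    (b ^ ((N : ℝ)⁻¹) * R ^ (1 - (N : ℝ)⁻¹)) ^ N = b * R ^ (N - 1) := by
  have hN0 : (N : ℝ) ≠ 0 := by positivity
  rw [mul_pow, Real.rpow_inv_natCast_pow hb (by omega), ← Real.rpow_mul_natCast hR]
  have : (1 - (N : ℝ)⁻¹) * (N : ℝ) = ((N - 1 : ℕ) : ℝ) := by
    rw [Nat.cast_sub hN]; field_simp; simp
  rw [this, Real.rpow_natCast]

lemma final_bound (hN : 1 ≤ N) {C : ℝ} (hC : 0 ≤ C)
    (hconj : ∀ (A H : List (EuclideanSpace ℝ (Fin d))) (e R m : ℝ), 0 ≤ e → e ≤ R → 0 ≤ m → m ≤ R →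
      m ^ N = e * R ^ (N - 1) →
      ccNorm N d (pwProd N d A) ≤ R → ccNorm N d (pwProd N d H) ≤ e →
      ccNorm N d (pwProd N d (invList A ++ (H ++ A))) ≤ C * m)
    {b bx c : ℝ} (hb : 0 ≤ b) (hbx : 0 ≤ bx) (hc : 0 ≤ c)
    {A B A' B' : List (EuclideanSpace ℝ (Fin d))}
    (hds : ccDist N d (pwProd N d A) (pwProd N d A') ≤ b)
    (hdt : ccDist N d (pwProd N d B) (pwProd N d B') ≤ b)
    (hns : ccNorm N d (pwProd N d A) ≤ bx) (hnt : ccNorm N d (pwProd N d B) ≤ bx) :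
    ccDist N d (ttaMul N d (ttaInv N d (pwProd N d A)) (pwProd N d B))
      (ttaMul N d (ttaInv N d (pwProd N d A')) (pwProd N d B')) ≤
      (2 * C + 1) * max b (b ^ ((N : ℝ)⁻¹) * (bx + c) ^ (1 - (N : ℝ)⁻¹)) := by
  have hp : 0 ≤ 1 - (N : ℝ)⁻¹ := by
    have : (N : ℝ)⁻¹ ≤ 1 := inv_le_one_of_one_le₀ (by exact_mod_cast hN)
    linarith
  have hp1 : 1 - (N : ℝ)⁻¹ ≤ 1 := by
    have : 0 ≤ (N : ℝ)⁻¹ := by positivity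
    linarith
  unfold ccDist at hds hdt ⊢
  simp only [inv_pw, ← pw_append] at hds hdt ⊢
  set R := max b (2 * bx) with hRdef
  have hR : 0 ≤ R := hb.trans (le_max_left _ _)
  set m := b ^ ((N : ℝ)⁻¹) * R ^ (1 - (N : ℝ)⁻¹) with hm
  have hm0 : 0 ≤ m := by positivity
  have hmN : m ^ N = b * R ^ (N - 1) := rpow_part hN hb hR
  have hmR : m ≤ R := by
    refine le_of_pow_le_pow_left₀ (by omega : N ≠ 0) hR ?_
    calc m ^ N = b * R ^ (N - 1) := hmN
      _ ≤ R * R ^ (N - 1) := by gcongr; exact le_max_left _ _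
      _ = R ^ N := by rw [← pow_succ']; congr 1; omega
  have hG : ccNorm N d (pwProd N d (invList A ++ B)) ≤ R := by
    have h1 := ccNorm_append (N := N) (invList A) B
    have h2 := ccNorm_invList (N := N) A
    refine le_trans ?_ (le_max_right b (2 * bx))
    linarith
  have hH : ccNorm N d (pwProd N d (invList (invList A ++ A'))) ≤ b :=
    (ccNorm_invList _).trans hds
  have h1 := hconj (invList A ++ B) (invList (invList A ++ A')) b R m hb (le_max_left _ _) hm0 hmR
    hmN hG hH
  have hi : invList (invList A ++ A') = invList A' ++ A := by
    have : invList (invList A ++ A') = invList A' ++ invList (invList A) := by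
      simp [invList]
    rw [this, invList_invList]
  rw [hi] at h1
  have h2 := ccNorm_append (N := N) (invList (invList A ++ B) ++ ((invList A' ++ A) ++ (invList A ++ B)))
    (invList B ++ B')
  have heq : pwProd N d (invList (invList A ++ B) ++ ((invList A' ++ A) ++ (invList A ++ B)) ++
      (invList B ++ B')) = pwProd N d (invList (invList A ++ B) ++ (invList A' ++ B')) := by
    have c1 : ∀ z, IsTrunc N d z → ttaMul N d (pwProd N d A) (ttaMul N d (pwProd N d (invList A)) z) = z := by
      intro z hz; rw [← mul_assoc_tta, pw_mul_inv, one_mul_tta hz]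
    have c2 : ∀ z, IsTrunc N d z → ttaMul N d (pwProd N d B) (ttaMul N d (pwProd N d (invList B)) z) = z := by
      intro z hz; rw [← mul_assoc_tta, pw_mul_inv, one_mul_tta hz]
    simp only [List.append_assoc]
    rw [pw_append, pw_append (invList (invList A ++ B))]
    congr 1
    rw [pw_append, pw_append (invList A')]
    congr 1
    rw [pw_append, pw_append, c1 _ (pw_trunc _), pw_append, pw_append, c2 _ (pw_trunc _)]
  rw [heq] at h2
  set X := max b (b ^ ((N : ℝ)⁻¹) * (bx + c) ^ (1 - (N : ℝ)⁻¹)) with hX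
  have hbX : b ≤ X := le_max_left _ _
  have hmX : m ≤ 2 * X := by
    rcases le_total (2 * bx) b with h | h
    · have hRb : R = b := max_eq_left h
      have : m ≤ b := by rw [← hRb]; exact hmR
      linarith
    · have hRb : R = 2 * bx := max_eq_right h
      have h3 : R ^ (1 - (N : ℝ)⁻¹) ≤ 2 * (bx + c) ^ (1 - (N : ℝ)⁻¹) := by
        rw [hRb]
        calc (2 * bx) ^ (1 - (N : ℝ)⁻¹) ≤ (2 * (bx + c)) ^ (1 - (N : ℝ)⁻¹) :=
              Real.rpow_le_rpow (by positivity) (by linarith) hp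
          _ = 2 ^ (1 - (N : ℝ)⁻¹) * (bx + c) ^ (1 - (N : ℝ)⁻¹) :=
              Real.mul_rpow (by norm_num) (by positivity)
          _ ≤ 2 * (bx + c) ^ (1 - (N : ℝ)⁻¹) := by
              gcongr
              calc (2:ℝ) ^ (1 - (N : ℝ)⁻¹) ≤ 2 ^ (1:ℝ) :=
                    Real.rpow_le_rpow_of_exponent_le (by norm_num) hp1
                _ = 2 := Real.rpow_one 2
      calc m ≤ b ^ ((N : ℝ)⁻¹) * (2 * (bx + c) ^ (1 - (N : ℝ)⁻¹)) := by rw [hm]; gcongr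
        _ = 2 * (b ^ ((N : ℝ)⁻¹) * (bx + c) ^ (1 - (N : ℝ)⁻¹)) := by ring
        _ ≤ 2 * X := by gcongr; exact le_max_right _ _
  have h5 : C * m ≤ C * (2 * X) := by gcongr
  calc _ ≤ _ := h2
    _ ≤ C * (2 * X) + X := by linarith
    _ = _ := by ring

end Final
end CCN

/-- on `C₀([0,1], G^N(ℝ^d))` the distances `d₀` and `d_∞` are locally
`1/N`-Hölder equivalent: `d_∞(x,y) ≤ d₀(x,y)` and
`d₀(x,y) ≤ C max{d_∞(x,y), d_∞(x,y)^{1/N} (‖x‖_∞+‖y‖_∞)^{1-1/N}}`, expressed here via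
upper bounds for the respective suprema. -/
theorem stmt_15 (N d : ℕ) (hN : 1 ≤ N) :
    ∃ C : ℝ, 0 < C ∧
      ∀ x y : ℝ → TTA d,
        (∀ t ∈ Set.Icc (0:ℝ) 1, x t ∈ FreeNilpotent N d) →
        (∀ t ∈ Set.Icc (0:ℝ) 1, y t ∈ FreeNilpotent N d) →
        (∀ w : List (Fin d), ContinuousOn (fun t => x t w) (Set.Icc 0 1)) →
        (∀ w : List (Fin d), ContinuousOn (fun t => y t w) (Set.Icc 0 1)) →
        x 0 = ttaOne d → y 0 = ttaOne d →
        -- `d_∞(x,y) ≤ d₀(x,y)`: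
        ((∀ b : ℝ, (∀ s t, 0 ≤ s → s ≤ t → t ≤ 1 →
            ccDist N d (ttaMul N d (ttaInv N d (x s)) (x t))
                       (ttaMul N d (ttaInv N d (y s)) (y t)) ≤ b) →
          ∀ t ∈ Set.Icc (0:ℝ) 1, ccDist N d (x t) (y t) ≤ b) ∧
        -- `d₀(x,y) ≤ C max{d_∞, d_∞^{1/N}(‖x‖_∞+‖y‖_∞)^{1-1/N}}`:
        (∀ b bx b'y : ℝ, 0 ≤ b → 0 ≤ bx → 0 ≤ b'y →
          (∀ t ∈ Set.Icc (0:ℝ) 1, ccDist N d (x t) (y t) ≤ b) →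
          (∀ t ∈ Set.Icc (0:ℝ) 1, ccNorm N d (x t) ≤ bx) →
          (∀ t ∈ Set.Icc (0:ℝ) 1, ccNorm N d (y t) ≤ b'y) →
          ∀ s t, 0 ≤ s → s ≤ t → t ≤ 1 →
            ccDist N d (ttaMul N d (ttaInv N d (x s)) (x t))
                       (ttaMul N d (ttaInv N d (y s)) (y t)) ≤
              C * max b (b ^ ((N : ℝ)⁻¹) * (bx + b'y) ^ (1 - (N : ℝ)⁻¹)))) := by
  obtain ⟨C, hC, hconj⟩ := CCN.conj_bound N d
  refine ⟨2 * C + 1, by positivity, ?_⟩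
  intro x y hx hy _ _ hx0 hy0
  constructor
  · intro b hb t ht
    have h := hb 0 t le_rfl ht.1 ht.2
    obtain ⟨B, hB⟩ := hx t ht
    obtain ⟨B', hB'⟩ := hy t ht
    have h1 : ttaInv N d (ttaOne d) = ttaOne d := by
      rw [← CCN.pw_nil (N := N), CCN.inv_pw]; rfl
    rw [hx0, hy0, h1, ← hB, ← hB', CCN.one_mul_tta (CCN.pw_trunc _),
      CCN.one_mul_tta (CCN.pw_trunc _)] at h
    rw [← hB, ← hB']
    exact h
  · intro b bx b'y hb hbx hby hd hnx hny s t hs hst ht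
    have hsI : s ∈ Set.Icc (0:ℝ) 1 := ⟨hs, hst.trans ht⟩
    have htI : t ∈ Set.Icc (0:ℝ) 1 := ⟨hs.trans hst, ht⟩
    have hds := hd s hsI
    have hdt := hd t htI
    have hns := hnx s hsI
    have hnt := hnx t htI
    obtain ⟨A, hA⟩ := hx s hsI
    obtain ⟨B, hB⟩ := hx t htI
    obtain ⟨A', hA'⟩ := hy s hsI
    obtain ⟨B', hB'⟩ := hy t htI
    rw [← hA] at hns hds
    rw [← hB] at hnt hdt
    rw [← hA'] at hds
    rw [← hB'] at hdt
    rw [← hA, ← hB, ← hA', ← hB']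
    exact CCN.final_bound hN hC hconj hb hbx hby hds hdt hns hnt
end
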